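/- arXiv:2209.09600 — 2 statements merged into one kernel-verified Lean document; each statement's English description precedes it below -/
import Mathlib

section
/- (Stability estimate for the difference of two 2D MHD solutions.) Let ν, η > 0, let r ≥ 0 be an integer, let 0 < σ < min(ν, η), let N > 1 and δ > 0. Let (u, b) and (w, m) be global smooth solutions of the MHD system on 𝕋², both with zero-average divergence-free initial data, and set v = w − u and h = m − b. Assume ‖u(0,·)‖_{H^j} + ‖b(0,·)‖_{H^j} ≤ C₁ N^j and ‖v(0,·)‖_{H^j} + ‖h(0,·)‖_{H^j} ≤ C₁ δ for all integers 0 ≤ j ≤ r. Set Γ̃ = 1 + ‖u(0,·)‖²_{L²} + ‖b(0,·)‖²_{L²} + ‖v(0,·)‖²_{L²} + ‖h(0,·)‖²_{L²}. Then there is a constant C depending only on r, σ, C₁ such that for all t ≥ 0: ‖v(t,·)‖²_{H^r} + ‖h(t,·)‖²_{H^r} ≤ δ²·N^{2r}·e^{−2σt}·e^{CΓ̃/σ²}. -/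
open MeasureTheory Real Set

noncomputable section

/-- Partial derivative of a scalar function on `ℝ^d` in the `i`-th coordinate direction. -/
def pd {d : ℕ} (i : Fin d) (f : (Fin d → ℝ) → ℝ) : (Fin d → ℝ) → ℝ :=
  fun x => fderiv ℝ f x (Pi.single i 1)

/-- Iterated partial derivative along a list of directions. -/
def pdList {d : ℕ} : List (Fin d) → ((Fin d → ℝ) → ℝ) → ((Fin d → ℝ) → ℝ)
  | [], f => f
  | i :: l, f => pd i (pdList l f)

/-- The list of directions associated to a multi-index `α`
(the direction `i` repeated `α i` times). -/
def mIdxList {d : ℕ} (α : Fin d → ℕ) : List (Fin d) :=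
  ((List.finRange d).map fun i => List.replicate (α i) i).flatten

/-- The partial derivative `∂^α f` for a multi-index `α`. -/
def pdM {d : ℕ} (α : Fin d → ℕ) (f : (Fin d → ℝ) → ℝ) : (Fin d → ℝ) → ℝ :=
  pdList (mIdxList α) f

/-- `|∇^m w|²(x) = ∑_{|α| = m} |∂^α w(x)|²` for a vector field `w : ℝ^d → ℝ^k`. -/
def gradSq {d k : ℕ} (m : ℕ) (w : (Fin d → ℝ) → Fin k → ℝ) (x : Fin d → ℝ) : ℝ :=
  ∑ α ∈ Finset.Nat.antidiagonalTuple d m, ∑ i, pdM α (fun y => w y i) x ^ 2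

/-- The fundamental domain `[0,L]^d` of the torus `ℝ^d/(Lℤ)^d`. -/
def box (d : ℕ) (L : ℝ) : Set (Fin d → ℝ) := Set.Icc 0 fun _ => L

/-- Square of the Sobolev `H^r` norm on the torus of period `L`. -/
def HnormSq {d k : ℕ} (L : ℝ) (r : ℕ) (w : (Fin d → ℝ) → Fin k → ℝ) : ℝ :=
  ∑ m ∈ Finset.range (r + 1), ∫ x in box d L, gradSq m w x

/-- The Sobolev `H^r` norm on the torus of period `L`. -/
def Hnorm {d k : ℕ} (L : ℝ) (r : ℕ) (w : (Fin d → ℝ) → Fin k → ℝ) : ℝ :=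
  Real.sqrt (HnormSq L r w)

/-- The `L²` norm on the torus of period `L`. -/
def L2norm {d k : ℕ} (L : ℝ) (w : (Fin d → ℝ) → Fin k → ℝ) : ℝ :=
  Real.sqrt (∫ x in box d L, ∑ i, w x i ^ 2)

/-- The `L^∞` norm of `∇^m w`. -/
def LinfGrad {d k : ℕ} (m : ℕ) (w : (Fin d → ℝ) → Fin k → ℝ) : ℝ :=
  ⨆ x : Fin d → ℝ, Real.sqrt (gradSq m w x)

/-- The `L^∞` norm of `w`. -/
def Linf {d k : ℕ} (w : (Fin d → ℝ) → Fin k → ℝ) : ℝ := LinfGrad 0 w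

/-- `L`-periodicity in each coordinate direction. -/
def Prdc {d : ℕ} {E : Type*} (L : ℝ) (w : (Fin d → ℝ) → E) : Prop :=
  ∀ (x : Fin d → ℝ) (i : Fin d), w (x + Pi.single i L) = w x

/-- Zero average on the torus. -/
def ZeroAvg {d k : ℕ} (L : ℝ) (w : (Fin d → ℝ) → Fin k → ℝ) : Prop :=
  ∀ i, (∫ x in box d L, w x i) = 0

/-- Divergence of a vector field on `ℝ^d`. -/
def divg {d : ℕ} (w : (Fin d → ℝ) → Fin d → ℝ) (x : Fin d → ℝ) : ℝ :=
  ∑ i, pd i (fun y => w y i) x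

/-- A smooth solution of the MHD system with viscosity `ν` and resistivity `η` on the torus
`ℝ^d/(Lℤ)^d`, on the time interval `J` (the equations are imposed at positive times of `J`). -/
structure IsMHD (d : ℕ) (L ν η : ℝ) (J : Set ℝ)
    (u b : ℝ → (Fin d → ℝ) → Fin d → ℝ) (P : ℝ → (Fin d → ℝ) → ℝ) : Prop where
  smooth_u : ContDiffOn ℝ (⊤ : ℕ∞) (fun p : ℝ × (Fin d → ℝ) => u p.1 p.2) (J ×ˢ Set.univ)
  smooth_b : ContDiffOn ℝ (⊤ : ℕ∞) (fun p : ℝ × (Fin d → ℝ) => b p.1 p.2) (J ×ˢ Set.univ)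
  smooth_P : ContDiffOn ℝ (⊤ : ℕ∞) (fun p : ℝ × (Fin d → ℝ) => P p.1 p.2) (J ×ˢ Set.univ)
  periodic_u : ∀ t ∈ J, Prdc L (u t)
  periodic_b : ∀ t ∈ J, Prdc L (b t)
  periodic_P : ∀ t ∈ J, Prdc L (P t)
  div_u : ∀ t ∈ J, ∀ x, divg (u t) x = 0
  div_b : ∀ t ∈ J, ∀ x, divg (b t) x = 0
  momentum : ∀ t ∈ J, 0 < t → ∀ x i,
    deriv (fun s => u s x i) t + (∑ j, u t x j * pd j (fun y => u t y i) x) + pd i (P t) x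
      = ν * (∑ j, pd j (pd j fun y => u t y i) x) + ∑ j, b t x j * pd j (fun y => b t y i) x
  induction_eq : ∀ t ∈ J, 0 < t → ∀ x i,
    deriv (fun s => b s x i) t + (∑ j, u t x j * pd j (fun y => b t y i) x)
      = (∑ j, b t x j * pd j (fun y => u t y i) x)
        + η * (∑ j, pd j (pd j fun y => b t y i) x)

/-- Projection from `ℝ^d` onto the torus `ℝ^d/(Lℤ)^d`. -/
def torusProj (d : ℕ) (L : ℝ) (x : Fin d → ℝ) : Fin d → AddCircle L :=
  fun i => (x i : AddCircle L)

/-- A magnetic line of the field `b`: the image on the torus of a maximal (hence, since the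
relevant fields are smooth and periodic, globally defined) integral curve of `b`. -/
def IsMagLine (d : ℕ) (L : ℝ) (b : (Fin d → ℝ) → Fin d → ℝ)
    (s : Set (Fin d → AddCircle L)) : Prop :=
  ∃ γ : ℝ → Fin d → ℝ, (∀ τ : ℝ, HasDerivAt γ (b (γ τ)) τ) ∧
    s = torusProj d L '' Set.range γ

/-- The families of magnetic lines of `b₁` and `b₂` are topologically equivalent: some
self-homeomorphism of the torus maps the family of magnetic lines of `b₁` bijectively onto the
family of magnetic lines of `b₂`. -/
def MagLinesEquiv (d : ℕ) (L : ℝ) (b₁ b₂ : (Fin d → ℝ) → Fin d → ℝ) : Prop :=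
  ∃ φ : (Fin d → AddCircle L) ≃ₜ (Fin d → AddCircle L),
    ∀ s : Set (Fin d → AddCircle L), IsMagLine d L b₁ s ↔ IsMagLine d L b₂ (φ '' s)

/-- Smooth scalar functions on the plane that are `1`-periodic in both variables. -/
structure SmoothPer (f : (Fin 2 → ℝ) → ℝ) : Prop where
  smooth : ContDiff ℝ (⊤ : ℕ∞) f
  per : Prdc 1 f

namespace SmoothPer

variable {f g : (Fin 2 → ℝ) → ℝ}

theorem cont (hf : SmoothPer f) : Continuous f := hf.smooth.continuous

theorem diff (hf : SmoothPer f) : Differentiable ℝ f := hf.smooth.differentiable (by simp)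

theorem add (hf : SmoothPer f) (hg : SmoothPer g) : SmoothPer (fun x => f x + g x) :=
  ⟨hf.smooth.add hg.smooth, fun x i => by simp only [hf.per x i, hg.per x i]⟩

theorem sub (hf : SmoothPer f) (hg : SmoothPer g) : SmoothPer (fun x => f x - g x) :=
  ⟨hf.smooth.sub hg.smooth, fun x i => by simp only [hf.per x i, hg.per x i]⟩

theorem mul (hf : SmoothPer f) (hg : SmoothPer g) : SmoothPer (fun x => f x * g x) :=
  ⟨hf.smooth.mul hg.smooth, fun x i => by simp only [hf.per x i, hg.per x i]⟩

theorem neg (hf : SmoothPer f) : SmoothPer (fun x => -f x) :=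
  ⟨hf.smooth.neg, fun x i => by simp only [hf.per x i]⟩

theorem const (c : ℝ) : SmoothPer (fun _ => c) := ⟨contDiff_const, fun _ _ => rfl⟩

theorem const_mul (c : ℝ) (hf : SmoothPer f) : SmoothPer (fun x => c * f x) :=
  (const c).mul hf

theorem pow (hf : SmoothPer f) (n : ℕ) : SmoothPer (fun x => f x ^ n) :=
  ⟨hf.smooth.pow n, fun x i => by simp only [hf.per x i]⟩

theorem sum {ι : Type*} (s : Finset ι) {F : ι → (Fin 2 → ℝ) → ℝ}
    (hF : ∀ i ∈ s, SmoothPer (F i)) : SmoothPer (fun x => ∑ i ∈ s, F i x) :=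
  ⟨ContDiff.sum fun i hi => (hF i hi).smooth,
    fun x j => Finset.sum_congr rfl fun i hi => (hF i hi).per x j⟩

theorem pd (i : Fin 2) (hf : SmoothPer f) : SmoothPer (pd i f) := by
  refine ⟨(hf.smooth.fderiv_right (m := (⊤ : ℕ∞)) (by simp)).clm_apply contDiff_const,
    fun x j => ?_⟩
  have h : f = fun y => f (y + Pi.single j 1) := funext fun y => (hf.per y j).symm
  have h2 : fderiv ℝ f x = fderiv ℝ f (x + Pi.single j 1) := by
    conv_lhs => rw [h]
    exact fderiv_comp_add_right (f := f) (x := x) (Pi.single j 1)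
  simp only [_root_.pd, h2]

theorem pdList (l : List (Fin 2)) (hf : SmoothPer f) : SmoothPer (pdList l f) := by
  induction l with
  | nil => exact hf
  | cons i l ih => exact ih.pd i

end SmoothPer

section PartialDerivatives

variable {f g : (Fin 2 → ℝ) → ℝ}

theorem pd_add (i : Fin 2) (hf : SmoothPer f) (hg : SmoothPer g) :
    pd i (fun x => f x + g x) = fun x => pd i f x + pd i g x := by
  funext x
  simp only [pd]
  rw [fderiv_fun_add (hf.diff x) (hg.diff x)]
  rfl

theorem pd_mul (i : Fin 2) (hf : SmoothPer f) (hg : SmoothPer g) :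
    pd i (fun x => f x * g x) = fun x => pd i f x * g x + f x * pd i g x := by
  funext x
  simp only [pd]
  rw [fderiv_fun_mul (hf.diff x) (hg.diff x)]
  simp only [_root_.add_apply, _root_.smul_apply, smul_eq_mul]
  ring

theorem pd_const (i : Fin 2) (c : ℝ) : pd i (fun _ : Fin 2 → ℝ => c) = fun _ => 0 := by
  funext x
  simp [pd]

theorem pd_const_mul (i : Fin 2) (c : ℝ) (hf : SmoothPer f) :
    pd i (fun x => c * f x) = fun x => c * pd i f x := by
  rw [pd_mul i (SmoothPer.const c) hf, pd_const]
  simp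

theorem pd_sum (i : Fin 2) {ι : Type*} (s : Finset ι) {F : ι → (Fin 2 → ℝ) → ℝ}
    (hF : ∀ j ∈ s, SmoothPer (F j)) :
    pd i (fun x => ∑ j ∈ s, F j x) = fun x => ∑ j ∈ s, pd i (F j) x := by
  funext x
  simp only [pd]
  rw [fderiv_fun_sum fun j hj => (hF j hj).diff x]
  simp

theorem pd_comm (i j : Fin 2) (hf : SmoothPer f) : pd i (pd j f) = pd j (pd i f) := by
  have key : ∀ k l : Fin 2, ∀ x,
      pd k (pd l f) x = fderiv ℝ (fderiv ℝ f) x (Pi.single k 1) (Pi.single l 1) := by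
    intro k l x
    have hd : DifferentiableAt ℝ (fderiv ℝ f) x :=
      ((hf.smooth.fderiv_right (m := (⊤ : ℕ∞)) (by simp)).differentiable (by simp)) x
    change fderiv ℝ (fun y => fderiv ℝ f y (Pi.single l 1)) x (Pi.single k 1) = _
    rw [fderiv_clm_apply hd (differentiableAt_const _)]
    simp
  funext x
  rw [key, key]
  have h2 : ((2 : ℕ∞) : WithTop ℕ∞) ≤ ((⊤ : ℕ∞) : WithTop ℕ∞) := WithTop.coe_le_coe.2 le_top
  exact (hf.smooth.contDiffAt.isSymmSndFDerivAt (by simpa using h2)) _ _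

theorem pdList_add (l : List (Fin 2)) (hf : SmoothPer f) (hg : SmoothPer g) :
    pdList l (fun x => f x + g x) = fun x => pdList l f x + pdList l g x := by
  induction l with
  | nil => rfl
  | cons i l ih =>
    simp only [pdList, ih]
    exact pd_add i (hf.pdList l) (hg.pdList l)

theorem pdList_const_mul (l : List (Fin 2)) (c : ℝ) (hf : SmoothPer f) :
    pdList l (fun x => c * f x) = fun x => c * pdList l f x := by
  induction l with
  | nil => rfl
  | cons i l ih =>
    simp only [pdList, ih]
    exact pd_const_mul i c (hf.pdList l)

theorem pdList_sub (l : List (Fin 2)) (hf : SmoothPer f) (hg : SmoothPer g) :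
    pdList l (fun x => f x - g x) = fun x => pdList l f x - pdList l g x := by
  have h := pdList_add l hf (hg.const_mul (-1))
  rw [pdList_const_mul l (-1) hg] at h
  simpa only [neg_one_mul, ← sub_eq_add_neg] using h

theorem pdList_sum (l : List (Fin 2)) {ι : Type*} (s : Finset ι) {F : ι → (Fin 2 → ℝ) → ℝ}
    (hF : ∀ j ∈ s, SmoothPer (F j)) :
    pdList l (fun x => ∑ j ∈ s, F j x) = fun x => ∑ j ∈ s, pdList l (F j) x := by
  induction l with
  | nil => rfl
  | cons i l ih =>
    simp only [pdList, ih]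
    exact pd_sum i s fun j hj => (hF j hj).pdList l

theorem pdList_pd (l : List (Fin 2)) (i : Fin 2) (hf : SmoothPer f) :
    pdList l (pd i f) = pd i (pdList l f) := by
  induction l with
  | nil => rfl
  | cons j l ih =>
    simp only [pdList, ih]
    exact pd_comm j i (hf.pdList l)

theorem pdList_perm {l₁ l₂ : List (Fin 2)} (h : l₁.Perm l₂) (hf : SmoothPer f) :
    pdList l₁ f = pdList l₂ f := by
  induction h with
  | nil => rfl
  | cons i _ ih => simp only [pdList, ih]
  | swap i j l => exact pd_comm j i (hf.pdList l)
  | trans _ _ ih₁ ih₂ => exact ih₁.trans ih₂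

/-- The splittings of a word `l` into two complementary subwords, the first one nonempty. -/
def properSplits : List (Fin 2) → List (List (Fin 2) × List (Fin 2))
  | [] => []
  | i :: l => ([i], l) ::
      ((properSplits l).map (fun p => (i :: p.1, p.2)) ++
        (properSplits l).map (fun p => (p.1, i :: p.2)))

theorem length_of_mem_properSplits {l : List (Fin 2)} :
    ∀ p ∈ properSplits l, 1 ≤ p.1.length ∧ p.1.length + p.2.length = l.length := by
  induction l with
  | nil => simp [properSplits]
  | cons i l ih =>
    intro p hp
    simp only [properSplits, List.mem_cons, List.mem_append, List.mem_map] at hp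
    rcases hp with rfl | ⟨q, hq, rfl⟩ | ⟨q, hq, rfl⟩
    · simp [add_comm]
    · have := ih q hq
      simp only [List.length_cons]
      omega
    · have := ih q hq
      simp only [List.length_cons]
      omega

theorem length_properSplits_le (l : List (Fin 2)) :
    (properSplits l).length ≤ 2 ^ l.length := by
  have : (properSplits l).length + 1 = 2 ^ l.length := by
    induction l with
    | nil => simp [properSplits]
    | cons i l ih =>
      simp only [properSplits, List.length_cons, List.length_append, List.length_map, pow_succ]
      omega
  omega

theorem SmoothPer.listSum {α : Type*} (L : List α) {F : α → (Fin 2 → ℝ) → ℝ}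
    (hF : ∀ a, SmoothPer (F a)) : SmoothPer (fun x => (L.map fun a => F a x).sum) := by
  induction L with
  | nil => simpa using SmoothPer.const 0
  | cons a L ih => simpa only [List.map_cons, List.sum_cons] using (hF a).add ih

theorem pd_listSum (i : Fin 2) {α : Type*} (L : List α) {F : α → (Fin 2 → ℝ) → ℝ}
    (hF : ∀ a, SmoothPer (F a)) :
    pd i (fun x => (L.map fun a => F a x).sum) = fun x => (L.map fun a => pd i (F a) x).sum := by
  induction L with
  | nil => simpa using pd_const i 0
  | cons a L ih =>
    simp only [List.map_cons, List.sum_cons]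
    rw [pd_add i (hF a) (SmoothPer.listSum L hF), ih]

theorem pdList_mul (l : List (Fin 2)) (hf : SmoothPer f) (hg : SmoothPer g) :
    pdList l (fun x => f x * g x) = fun x => f x * pdList l g x +
      ((properSplits l).map fun p => pdList p.1 f x * pdList p.2 g x).sum := by
  induction l with
  | nil => simp [properSplits, pdList]
  | cons i l ih =>
    have hprod : ∀ p : List (Fin 2) × List (Fin 2),
        SmoothPer (fun x => pdList p.1 f x * pdList p.2 g x) :=
      fun p => (hf.pdList p.1).mul (hg.pdList p.2)
    simp only [pdList, ih]
    rw [pd_add i (hf.mul (hg.pdList l)) (SmoothPer.listSum _ hprod), pd_mul i hf (hg.pdList l),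
      pd_listSum i _ hprod]
    funext x
    simp only [properSplits, List.map_cons, List.sum_cons, List.map_append, List.sum_append,
      List.map_map, Function.comp_def, pdList, pd_mul i (hf.pdList _) (hg.pdList _),
      List.sum_map_add]
    ring

end PartialDerivatives

/-- The integral over the unit torus. -/
def avg (f : (Fin 2 → ℝ) → ℝ) : ℝ := ∫ x in box 2 1, f x

section Integration

variable {f g h : (Fin 2 → ℝ) → ℝ}

theorem isCompact_box (d : ℕ) (L : ℝ) : IsCompact (box d L) := isCompact_Icc

theorem measurableSet_box (d : ℕ) (L : ℝ) : MeasurableSet (box d L) := measurableSet_Icc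

theorem integrableOn_box (hf : Continuous f) : IntegrableOn f (box 2 1) :=
  hf.continuousOn.integrableOn_compact (isCompact_box 2 1)

theorem avg_add (hf : Continuous f) (hg : Continuous g) :
    avg (fun x => f x + g x) = avg f + avg g :=
  integral_add (integrableOn_box hf) (integrableOn_box hg)

theorem avg_sub (hf : Continuous f) (hg : Continuous g) :
    avg (fun x => f x - g x) = avg f - avg g :=
  integral_sub (integrableOn_box hf) (integrableOn_box hg)

theorem avg_const_mul (c : ℝ) (f : (Fin 2 → ℝ) → ℝ) : avg (fun x => c * f x) = c * avg f :=
  integral_const_mul c f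

theorem avg_neg (f : (Fin 2 → ℝ) → ℝ) : avg (fun x => -f x) = -avg f := integral_neg f

theorem avg_sum {ι : Type*} (s : Finset ι) {F : ι → (Fin 2 → ℝ) → ℝ}
    (hF : ∀ i ∈ s, Continuous (F i)) : avg (fun x => ∑ i ∈ s, F i x) = ∑ i ∈ s, avg (F i) :=
  integral_finsetSum s fun i hi => integrableOn_box (hF i hi)

theorem avg_listSum {α : Type*} (L : List α) {F : α → (Fin 2 → ℝ) → ℝ}
    (hF : ∀ a, Continuous (F a)) :
    avg (fun x => (L.map fun a => F a x).sum) = (L.map fun a => avg (F a)).sum := by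
  induction L with
  | nil => simp [avg]
  | cons a L ih =>
    simp only [List.map_cons, List.sum_cons]
    rw [avg_add (hF a) (continuous_list_sum L fun a _ => hF a), ih]

theorem avg_nonneg (hf : ∀ x, 0 ≤ f x) : 0 ≤ avg f := integral_nonneg hf

theorem avg_sq_nonneg (f : (Fin 2 → ℝ) → ℝ) : 0 ≤ avg (fun x => f x ^ 2) :=
  avg_nonneg fun _ => sq_nonneg _

theorem continuous_vec2 : Continuous fun p : ℝ × ℝ => ![p.1, p.2] := by
  refine continuous_pi fun i => ?_
  fin_cases i
  · exact continuous_fst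
  · exact continuous_snd

theorem avg_eq_setIntegral_prod (f : (Fin 2 → ℝ) → ℝ) :
    avg f = ∫ p in Icc (0 : ℝ) 1 ×ˢ Icc (0 : ℝ) 1, f ![p.1, p.2] := by
  have h := (volume_preserving_finTwoArrow ℝ).symm.setIntegral_preimage_emb
    (MeasurableEquiv.measurableEmbedding _) f (box 2 1)
  rw [avg, ← h]
  have hs : (MeasurableEquiv.finTwoArrow (α := ℝ)).symm ⁻¹' (box 2 1)
      = Icc (0 : ℝ) 1 ×ˢ Icc (0 : ℝ) 1 := by
    ext p
    simp only [box, mem_preimage, mem_Icc, Pi.le_def, Fin.forall_fin_two, mem_prod]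
    change ((0 ≤ p.1 ∧ 0 ≤ p.2) ∧ (p.1 ≤ 1 ∧ p.2 ≤ 1)) ↔ _
    tauto
  rw [hs]
  rfl

theorem integrableOn_unitSquare {F : ℝ × ℝ → ℝ} (hF : Continuous F) :
    IntegrableOn F (Icc (0 : ℝ) 1 ×ˢ Icc (0 : ℝ) 1) :=
  hF.continuousOn.integrableOn_compact (isCompact_Icc.prod isCompact_Icc)

theorem avg_eq_intervalIntegral (hf : Continuous f) :
    avg f = ∫ x in (0 : ℝ)..1, ∫ y in (0 : ℝ)..1, f ![x, y] := by
  rw [avg_eq_setIntegral_prod, Measure.volume_eq_prod, setIntegral_prod (fun p => f ![p.1, p.2])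
    (integrableOn_unitSquare (hf.comp continuous_vec2))]
  simp only [integral_Icc_eq_integral_Ioc, intervalIntegral.integral_of_le zero_le_one]

theorem avg_eq_intervalIntegral_swap (hf : Continuous f) :
    avg f = ∫ y in (0 : ℝ)..1, ∫ x in (0 : ℝ)..1, f ![x, y] := by
  rw [avg_eq_intervalIntegral hf]
  refine intervalIntegral_intervalIntegral_swap ?_
  simp only [uIoc_of_le zero_le_one]
  exact (integrableOn_unitSquare (hf.comp continuous_vec2)).mono_set
    (prod_mono Ioc_subset_Icc_self Ioc_subset_Icc_self)

theorem continuous_slice_integral {F : ℝ → ℝ → ℝ} (hF : Continuous (Function.uncurry F)) :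
    Continuous fun x => ∫ y in (0 : ℝ)..1, F x y :=
  intervalIntegral.continuous_parametric_intervalIntegral_of_continuous' hF 0 1

theorem avg_eq_of_slices {F G : ℝ → ℝ} (hF : Continuous F) (hG : Continuous G) :
    avg (fun x => F (x 0) * G (x 1)) = (∫ s in (0 : ℝ)..1, F s) * ∫ s in (0 : ℝ)..1, G s := by
  rw [avg_eq_intervalIntegral (f := fun x => F (x 0) * G (x 1))
    ((hF.comp (continuous_apply 0)).mul (hG.comp (continuous_apply 1)))]
  simp

theorem avg_const (c : ℝ) : avg (fun _ => c) = c := by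
  rw [avg_eq_intervalIntegral continuous_const]
  simp

theorem hasDerivAt_slice_zero (hf : Differentiable ℝ f) (x y : ℝ) :
    HasDerivAt (fun s => f ![s, y]) (pd 0 f ![x, y]) x := by
  have h1 : HasDerivAt (fun s : ℝ => ![s, y]) (Pi.single 0 1 : Fin 2 → ℝ) x := by
    refine hasDerivAt_pi.2 fun i => ?_
    fin_cases i
    · simpa using hasDerivAt_id' x
    · simpa using hasDerivAt_const x y
  exact (hf ![x, y]).hasFDerivAt.comp_hasDerivAt x h1

theorem hasDerivAt_slice_one (hf : Differentiable ℝ f) (x y : ℝ) :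
    HasDerivAt (fun s => f ![x, s]) (pd 1 f ![x, y]) y := by
  have h1 : HasDerivAt (fun s : ℝ => ![x, s]) (Pi.single 1 1 : Fin 2 → ℝ) y := by
    refine hasDerivAt_pi.2 fun i => ?_
    fin_cases i
    · simpa using hasDerivAt_const y x
    · simpa using hasDerivAt_id' y
  exact (hf ![x, y]).hasFDerivAt.comp_hasDerivAt y h1

theorem Prdc.slice_zero (hf : Prdc 1 f) (y : ℝ) : f ![0, y] = f ![1, y] := by
  rw [← hf ![0, y] 0]
  congr 1
  ext i
  fin_cases i <;> simp

theorem Prdc.slice_one (hf : Prdc 1 f) (x : ℝ) : f ![x, 0] = f ![x, 1] := by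
  rw [← hf ![x, 0] 1]
  congr 1
  ext i
  fin_cases i <;> simp

theorem continuous_slice_zero (hf : Continuous f) (y : ℝ) : Continuous fun x => f ![x, y] :=
  hf.comp (continuous_vec2.comp (Continuous.prodMk_left y))

theorem continuous_slice_one (hf : Continuous f) (x : ℝ) : Continuous fun y => f ![x, y] :=
  hf.comp (continuous_vec2.comp (Continuous.prodMk_right x))

/-- The integral of a partial derivative over the torus vanishes. -/
theorem avg_pd (i : Fin 2) (hf : SmoothPer f) : avg (pd i f) = 0 := by
  have hc := (hf.pd i).cont
  fin_cases i
  · rw [avg_eq_intervalIntegral_swap hc]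
    have : ∀ y : ℝ, ∫ x in (0 : ℝ)..1, pd 0 f ![x, y] = 0 := fun y => by
      rw [intervalIntegral.integral_eq_sub_of_hasDerivAt
        (fun x _ => hasDerivAt_slice_zero hf.diff x y)
        ((continuous_slice_zero hc y).intervalIntegrable 0 1), hf.per.slice_zero y, sub_self]
    simp [this]
  · rw [avg_eq_intervalIntegral hc]
    have : ∀ x : ℝ, ∫ y in (0 : ℝ)..1, pd 1 f ![x, y] = 0 := fun x => by
      rw [intervalIntegral.integral_eq_sub_of_hasDerivAt
        (fun y _ => hasDerivAt_slice_one hf.diff x y)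
        ((continuous_slice_one hc x).intervalIntegrable 0 1), hf.per.slice_one x, sub_self]
    simp [this]

theorem avg_pd_mul (i : Fin 2) (hf : SmoothPer f) (hg : SmoothPer g) :
    avg (fun x => pd i f x * g x) = -avg (fun x => f x * pd i g x) := by
  have h := avg_pd i (hf.mul hg)
  rw [pd_mul i hf hg, avg_add ((hf.pd i).mul hg).cont (hf.mul (hg.pd i)).cont] at h
  linarith

theorem avg_pdList_of_ne_nil {l : List (Fin 2)} (hl : l ≠ []) (hf : SmoothPer f) :
    avg (pdList l f) = 0 := by
  cases l with
  | nil => exact absurd rfl hl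
  | cons i l => exact avg_pd i (hf.pdList l)

/-- The Cauchy–Schwarz inequality on the torus. -/
theorem avg_mul_sq_le (hf : Continuous f) (hg : Continuous g) :
    avg (fun x => f x * g x) ^ 2 ≤ avg (fun x => f x ^ 2) * avg (fun x => g x ^ 2) := by
  have key : ∀ t : ℝ, 0 ≤ avg (fun x => g x ^ 2) * (t * t)
      + (2 * avg (fun x => f x * g x)) * t + avg (fun x => f x ^ 2) := fun t => by
    have h := avg_sq_nonneg fun x => f x + t * g x
    have e : (fun x => (f x + t * g x) ^ 2)
        = fun x => (f x ^ 2 + (2 * t) * (f x * g x)) + (t * t) * g x ^ 2 := by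
      funext x; ring
    rw [e, avg_add (by fun_prop) (by fun_prop), avg_add (by fun_prop) (by fun_prop),
      avg_const_mul, avg_const_mul] at h
    linarith
  have := discrim_le_zero key
  rw [discrim] at this
  nlinarith

theorem avg_mul_mul_pow_four_le (hf : Continuous f) (hg : Continuous g) (hh : Continuous h) :
    avg (fun x => f x * g x * h x) ^ 4 ≤
      avg (fun x => f x ^ 4) * avg (fun x => g x ^ 4) * avg (fun x => h x ^ 2) ^ 2 := by
  have h1 := avg_mul_sq_le (hf.mul hg) hh
  have h2 := avg_mul_sq_le (hf.pow 2) (hg.pow 2)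
  have e1 : (fun x => (f x * g x) ^ 2) = fun x => f x ^ 2 * g x ^ 2 := by funext x; ring
  have e2 : (fun x => (f x ^ 2) ^ 2) = fun x => f x ^ 4 := by funext x; ring
  have e3 : (fun x => (g x ^ 2) ^ 2) = fun x => g x ^ 4 := by funext x; ring
  simp only [Pi.mul_apply, Pi.pow_apply] at h1 h2
  rw [e1] at h1
  rw [e2, e3] at h2
  have h3 := pow_le_pow_left₀ (sq_nonneg _) h1 2
  calc _ = (avg (fun x => f x * g x * h x) ^ 2) ^ 2 := by ring
    _ ≤ _ := h3
    _ = avg (fun x => f x ^ 2 * g x ^ 2) ^ 2 * avg (fun x => h x ^ 2) ^ 2 := by ring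
    _ ≤ _ := by gcongr

/-- The oscillation of a `C¹` loop is at most half of its length. -/
theorem abs_sub_le_half_integral {G G' : ℝ → ℝ} (hG : ∀ x, HasDerivAt G (G' x) x)
    (hc : Continuous G') (hp : G 0 = G 1) {x y : ℝ} (hx : x ∈ Icc (0 : ℝ) 1)
    (hy : y ∈ Icc (0 : ℝ) 1) : |G x - G y| ≤ (1 / 2) * ∫ s in (0 : ℝ)..1, |G' s| := by
  wlog hxy : x ≤ y generalizing x y
  · rw [abs_sub_comm]
    exact this hy hx (le_of_not_ge hxy)
  have hi : ∀ a b : ℝ, IntervalIntegrable (fun s => |G' s|) volume a b :=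
    fun a b => hc.abs.intervalIntegrable a b
  have hftc : ∀ a b : ℝ, a ≤ b → |G b - G a| ≤ ∫ s in a..b, |G' s| := fun a b hab => by
    rw [← intervalIntegral.integral_eq_sub_of_hasDerivAt (fun x _ => hG x)
      (hc.intervalIntegrable a b)]
    exact intervalIntegral.abs_integral_le_integral_abs hab
  have h1 := hftc 0 x hx.1
  have h2 := hftc x y hxy
  have h3 := hftc y 1 hy.2
  have h4 := intervalIntegral.integral_add_adjacent_intervals (hi 0 x) (hi x y)
  have h5 := intervalIntegral.integral_add_adjacent_intervals (hi 0 y) (hi y 1)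
  rw [abs_le] at h1 h2 h3 ⊢
  constructor <;> linarith

theorem sq_integral_abs_le {F : ℝ → ℝ} (hF : Continuous F) :
    (∫ s in (0 : ℝ)..1, |F s|) ^ 2 ≤ ∫ s in (0 : ℝ)..1, F s ^ 2 := by
  set c := ∫ s in (0 : ℝ)..1, |F s| with hc
  have h : 0 ≤ ∫ s in (0 : ℝ)..1, (|F s| - c) ^ 2 :=
    intervalIntegral.integral_nonneg zero_le_one fun _ _ => sq_nonneg _
  have e : (fun s => (|F s| - c) ^ 2) = fun s => (F s ^ 2 - (2 * c) * |F s|) + c ^ 2 := by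
    funext s
    rw [sub_sq, sq_abs]
    ring
  have i1 : IntervalIntegrable (fun s => F s ^ 2) volume 0 1 :=
    (hF.pow 2).intervalIntegrable 0 1
  have i2 : IntervalIntegrable (fun s => (2 * c) * |F s|) volume 0 1 :=
    (continuous_const.mul hF.abs).intervalIntegrable 0 1
  rw [e, intervalIntegral.integral_add (i1.sub i2) (by simp), intervalIntegral.integral_sub i1 i2,
    intervalIntegral.integral_const_mul, ← hc] at h
  simp only [intervalIntegral.integral_const, sub_zero, smul_eq_mul, one_mul] at h
  nlinarith

end Integration

section Inequalities

variable {f g h : (Fin 2 → ℝ) → ℝ}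

theorem continuous_integral_slice_zero (hf : Continuous f) :
    Continuous fun y => ∫ x in (0 : ℝ)..1, f ![x, y] :=
  continuous_slice_integral (F := fun y x => f ![x, y])
    (hf.comp (continuous_vec2.comp continuous_swap))

theorem continuous_integral_slice_one (hf : Continuous f) :
    Continuous fun x => ∫ y in (0 : ℝ)..1, f ![x, y] :=
  continuous_slice_integral (F := fun x y => f ![x, y]) (hf.comp continuous_vec2)

theorem intervalIntegral_mono_unit {F G : ℝ → ℝ} (hF : Continuous F) (hG : Continuous G)
    (hle : ∀ x ∈ Icc (0 : ℝ) 1, F x ≤ G x) :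
    ∫ x in (0 : ℝ)..1, F x ≤ ∫ x in (0 : ℝ)..1, G x :=
  intervalIntegral.integral_mono_on zero_le_one (hF.intervalIntegrable 0 1)
    (hG.intervalIntegrable 0 1) hle

/-- A function on the square is bounded by its mean plus half of the lengths of slices. -/
theorem le_avg_add (hf : SmoothPer f) {x y : ℝ} (hx : x ∈ Icc (0 : ℝ) 1)
    (hy : y ∈ Icc (0 : ℝ) 1) :
    f ![x, y] ≤ avg f + (1 / 2) * (∫ s in (0 : ℝ)..1, |pd 0 f ![s, y]|)
      + (1 / 2) * avg (fun z => |pd 1 f z|) := by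
  have c0 := (hf.pd 0).cont
  have c1 := (hf.pd 1).cont
  set A := (1 / 2) * (∫ s in (0 : ℝ)..1, |pd 0 f ![s, y]|) with hA
  set B : ℝ → ℝ := fun x' => ∫ s in (0 : ℝ)..1, |pd 1 f ![x', s]| with hB
  have cB : Continuous B := continuous_integral_slice_one c1.abs
  have h1 : ∀ x' ∈ Icc (0 : ℝ) 1, ∀ y' ∈ Icc (0 : ℝ) 1,
      f ![x, y] - A - (1 / 2) * B x' ≤ f ![x', y'] := by
    intro x' hx' y' hy'
    have e1 := abs_sub_le_half_integral (fun s => hasDerivAt_slice_zero hf.diff s y)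
      (continuous_slice_zero c0 y) (hf.per.slice_zero y) hx hx'
    have e2 := abs_sub_le_half_integral (fun s => hasDerivAt_slice_one hf.diff x' s)
      (continuous_slice_one c1 x') (hf.per.slice_one x') hy hy'
    rw [abs_le] at e1 e2
    simp only [hA, hB]
    linarith [e1.2, e2.2]
  have h2 : ∀ x' ∈ Icc (0 : ℝ) 1,
      f ![x, y] - A - (1 / 2) * B x' ≤ ∫ y' in (0 : ℝ)..1, f ![x', y'] := by
    intro x' hx'
    have := intervalIntegral_mono_unit (continuous_const (y := f ![x, y] - A - (1 / 2) * B x'))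
      (continuous_slice_one hf.cont x') (h1 x' hx')
    simpa using this
  have h3 := intervalIntegral_mono_unit (F := fun x' => f ![x, y] - A - (1 / 2) * B x')
    (by fun_prop) (continuous_integral_slice_one hf.cont) h2
  have cB2 : Continuous fun x' => (1 / 2) * B x' := by fun_prop
  rw [← avg_eq_intervalIntegral hf.cont, intervalIntegral.integral_sub (by simp)
    (cB2.intervalIntegrable 0 1), intervalIntegral.integral_const_mul,
    ← avg_eq_intervalIntegral (f := fun z => |pd 1 f z|) c1.abs] at h3
  simp only [intervalIntegral.integral_const, sub_zero, smul_eq_mul, one_mul] at h3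
  linarith

theorem avg_abs_sq_le (hf : Continuous f) :
    avg (fun z => |f z|) ^ 2 ≤ avg (fun z => f z ^ 2) := by
  have h := avg_mul_sq_le hf.abs (continuous_const (y := (1 : ℝ)))
  simpa [avg_const] using h

/-- The Poincaré inequality on the torus. -/
theorem poincare (hf : SmoothPer f) (h0 : avg f = 0) :
    avg (fun x => f x ^ 2)
      ≤ (1 / 2) * (avg (fun x => pd 0 f x ^ 2) + avg (fun x => pd 1 f x ^ 2)) := by
  have c0 := (hf.pd 0).cont
  have c1 := (hf.pd 1).cont
  set A : ℝ → ℝ := fun y => ∫ s in (0 : ℝ)..1, |pd 0 f ![s, y]| with hA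
  set b := avg (fun z => |pd 1 f z|) with hb
  have cA : Continuous A := continuous_integral_slice_zero c0.abs
  have h1 : ∀ y ∈ Icc (0 : ℝ) 1, ∀ x ∈ Icc (0 : ℝ) 1,
      f ![x, y] ^ 2 ≤ (1 / 2) * (∫ s in (0 : ℝ)..1, pd 0 f ![s, y] ^ 2) + (1 / 2) * b ^ 2 := by
    intro y hy x hx
    have e1 := le_avg_add hf hx hy
    have e2 := le_avg_add hf.neg hx hy
    have e3 : ∀ i, pd i (fun x => -f x) = fun x => -pd i f x := fun i => by
      simpa using pd_const_mul i (-1) hf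
    simp only [e3, abs_neg, avg_neg] at e2
    rw [h0] at e1 e2
    have e4 : |f ![x, y]| ≤ (1 / 2) * A y + (1 / 2) * b := by
      rw [abs_le]
      constructor <;> simp only [hA, hb] <;> linarith
    have e5 : A y ^ 2 ≤ ∫ s in (0 : ℝ)..1, pd 0 f ![s, y] ^ 2 :=
      sq_integral_abs_le (continuous_slice_zero c0 y)
    rw [← sq_abs]
    have e6 := pow_le_pow_left₀ (abs_nonneg _) e4 2
    nlinarith [sq_nonneg (A y - b)]
  have cS : Continuous fun y => ∫ s in (0 : ℝ)..1, pd 0 f ![s, y] ^ 2 :=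
    continuous_integral_slice_zero (f := fun x => pd 0 f x ^ 2) (c0.pow 2)
  have h2 : ∀ y ∈ Icc (0 : ℝ) 1, ∫ x in (0 : ℝ)..1, f ![x, y] ^ 2
      ≤ (1 / 2) * (∫ s in (0 : ℝ)..1, pd 0 f ![s, y] ^ 2) + (1 / 2) * b ^ 2 := fun y hy => by
    have := intervalIntegral_mono_unit ((continuous_slice_zero hf.cont y).pow 2)
      continuous_const (h1 y hy)
    simpa using this
  have h3 := intervalIntegral_mono_unit
    (continuous_integral_slice_zero (f := fun x => f x ^ 2) (hf.cont.pow 2))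
    (G := fun y => (1 / 2) * (∫ s in (0 : ℝ)..1, pd 0 f ![s, y] ^ 2) + (1 / 2) * b ^ 2)
    (by fun_prop) h2
  have cS2 : Continuous fun y => (1 / 2) * (∫ s in (0 : ℝ)..1, pd 0 f ![s, y] ^ 2) := by
    fun_prop
  rw [intervalIntegral.integral_add (cS2.intervalIntegrable 0 1) (by simp),
    intervalIntegral.integral_const_mul,
    ← avg_eq_intervalIntegral_swap (f := fun x => f x ^ 2) (hf.cont.pow 2),
    ← avg_eq_intervalIntegral_swap (f := fun x => pd 0 f x ^ 2) (c0.pow 2)] at h3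
  simp only [intervalIntegral.integral_const, sub_zero, smul_eq_mul, one_mul] at h3
  have h4 : b ^ 2 ≤ avg (fun x => pd 1 f x ^ 2) := avg_abs_sq_le c1
  linarith

theorem sq_le_slice_integral {G G' : ℝ → ℝ} (hG : ∀ x, HasDerivAt G (G' x) x)
    (hc : Continuous G') (hp : G 0 = G 1) {x : ℝ} (hx : x ∈ Icc (0 : ℝ) 1) :
    G x ^ 2 ≤ ∫ s in (0 : ℝ)..1, (G s ^ 2 + |G s * G' s|) := by
  have cG : Continuous G := continuous_iff_continuousAt.2 fun x => (hG x).continuousAt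
  have hd : ∀ x, HasDerivAt (fun s => G s ^ 2) (2 * (G x * G' x)) x := fun x => by
    have := (hG x).pow 2
    refine this.congr_deriv ?_
    push_cast
    ring
  have h1 : ∀ y ∈ Icc (0 : ℝ) 1, G x ^ 2 ≤ G y ^ 2 + ∫ s in (0 : ℝ)..1, |G s * G' s| := by
    intro y hy
    have e := abs_sub_le_half_integral hd (continuous_const.mul (cG.mul hc)) (by simp only [hp])
      hx hy
    simp only [abs_mul (2 : ℝ), abs_two, intervalIntegral.integral_const_mul] at e
    rw [abs_le] at e
    linarith [e.2]
  have h2 := intervalIntegral_mono_unit continuous_const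
    (G := fun y => G y ^ 2 + ∫ s in (0 : ℝ)..1, |G s * G' s|) (by fun_prop) h1
  have cG2 : Continuous fun s => G s ^ 2 := by fun_prop
  have cGG : Continuous fun s => |G s * G' s| := by fun_prop
  rw [intervalIntegral.integral_add (cG2.intervalIntegrable 0 1) (cGG.intervalIntegrable 0 1)]
  rw [intervalIntegral.integral_add (cG2.intervalIntegrable 0 1) (by simp)] at h2
  simpa using h2

theorem avg_congr_mono (hf : Continuous f) (hg : Continuous g)
    (hfg : ∀ x ∈ Icc (0 : ℝ) 1, ∀ y ∈ Icc (0 : ℝ) 1, f ![x, y] ≤ g ![x, y]) :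
    avg f ≤ avg g := by
  rw [avg_eq_intervalIntegral hf, avg_eq_intervalIntegral hg]
  exact intervalIntegral_mono_unit (continuous_integral_slice_one hf)
    (continuous_integral_slice_one hg) fun x hx =>
    intervalIntegral_mono_unit (continuous_slice_one hf x) (continuous_slice_one hg x) (hfg x hx)

theorem avg_pow_four_le (hf : SmoothPer f) :
    avg (fun x => f x ^ 4) ≤ avg (fun x => f x ^ 2 + |f x * pd 0 f x|)
      * avg (fun x => f x ^ 2 + |f x * pd 1 f x|) := by
  have c := hf.cont
  have c0 := (hf.pd 0).cont
  have c1 := (hf.pd 1).cont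
  have d0 : Continuous fun x => f x ^ 2 + |f x * pd 0 f x| := (c.pow 2).add (c.mul c0).abs
  have d1 : Continuous fun x => f x ^ 2 + |f x * pd 1 f x| := (c.pow 2).add (c.mul c1).abs
  set A : ℝ → ℝ := fun y => ∫ s in (0 : ℝ)..1, (f ![s, y] ^ 2 + |f ![s, y] * pd 0 f ![s, y]|)
    with hA
  set B : ℝ → ℝ := fun x => ∫ s in (0 : ℝ)..1, (f ![x, s] ^ 2 + |f ![x, s] * pd 1 f ![x, s]|)
    with hB
  have cA : Continuous A := continuous_integral_slice_zero d0
  have cB : Continuous B := continuous_integral_slice_one d1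
  have h1 : avg (fun x => f x ^ 4) ≤ avg (fun x => B (x 0) * A (x 1)) := by
    refine avg_congr_mono (c.pow 4)
      ((cB.comp (continuous_apply 0)).mul (cA.comp (continuous_apply 1))) fun x hx y hy => ?_
    have e1 : f ![x, y] ^ 2 ≤ A y := sq_le_slice_integral
      (fun s => hasDerivAt_slice_zero hf.diff s y) (continuous_slice_zero c0 y)
      (hf.per.slice_zero y) hx
    have e2 : f ![x, y] ^ 2 ≤ B x := sq_le_slice_integral
      (fun s => hasDerivAt_slice_one hf.diff x s) (continuous_slice_one c1 x)
      (hf.per.slice_one x) hy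
    change f ![x, y] ^ 4 ≤ B x * A y
    calc f ![x, y] ^ 4 = f ![x, y] ^ 2 * f ![x, y] ^ 2 := by ring
      _ ≤ B x * A y := mul_le_mul e2 e1 (sq_nonneg _) ((sq_nonneg _).trans e2)
  rw [avg_eq_of_slices cB cA] at h1
  rw [avg_eq_intervalIntegral_swap d0, avg_eq_intervalIntegral d1, mul_comm]
  exact h1

/-- Ladyzhenskaya's inequality on the two-dimensional torus. -/
theorem ladyzhenskaya (hf : SmoothPer f) (h0 : avg f = 0) :
    avg (fun x => f x ^ 4) ≤ 4 * (avg (fun x => f x ^ 2)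
      * (avg (fun x => pd 0 f x ^ 2) + avg (fun x => pd 1 f x ^ 2))) := by
  have c := hf.cont
  set p := avg (fun x => f x ^ 2) with hp
  set q := avg (fun x => pd 0 f x ^ 2) + avg (fun x => pd 1 f x ^ 2) with hq
  have q0 := avg_sq_nonneg (pd 0 f)
  have q1 := avg_sq_nonneg (pd 1 f)
  have hp0 : 0 ≤ p := avg_sq_nonneg f
  have hq0 : 0 ≤ q := add_nonneg q0 q1
  have hpq : p ≤ q := by
    have := poincare hf h0
    linarith
  have key : ∀ i, avg (fun x => pd i f x ^ 2) ≤ q →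
      avg (fun x => f x ^ 2 + |f x * pd i f x|) ≤ 2 * √(p * q) := by
    intro i hi
    have ci := (hf.pd i).cont
    rw [avg_add (f := fun x => f x ^ 2) (by fun_prop) (g := fun x => |f x * pd i f x|)
      (by fun_prop)]
    have e1 : p ≤ √(p * q) := Real.le_sqrt_of_sq_le (by nlinarith)
    have e2 : avg (fun x => |f x * pd i f x|) ≤ √(p * q) := by
      refine Real.le_sqrt_of_sq_le ?_
      have := avg_mul_sq_le c.abs ci.abs
      simp only [sq_abs, ← abs_mul] at this
      exact this.trans (mul_le_mul_of_nonneg_left hi hp0)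
    linarith
  have k0 := key 0 (by linarith)
  have k1 := key 1 (by linarith)
  calc _ ≤ _ := avg_pow_four_le hf
    _ ≤ (2 * √(p * q)) * (2 * √(p * q)) := by
        refine mul_le_mul k0 k1 (avg_nonneg fun x => by positivity) (by positivity)
    _ = 4 * (p * q) := by
        have := Real.mul_self_sqrt (mul_nonneg hp0 hq0)
        linear_combination 4 * this

end Inequalities

/-- The homogeneous Sobolev norm of order `k`, squared, as a sum over all words of length `k`. -/
def sobSq (k : ℕ) (f : (Fin 2 → ℝ) → ℝ) : ℝ :=
  ∑ w : Fin k → Fin 2, avg (fun x => pdList (List.ofFn w) f x ^ 2)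

section SobolevNorms

variable {f : (Fin 2 → ℝ) → ℝ}

theorem sobSq_nonneg (k : ℕ) (f : (Fin 2 → ℝ) → ℝ) : 0 ≤ sobSq k f :=
  Finset.sum_nonneg fun _ _ => avg_sq_nonneg _

theorem sobSq_succ (k : ℕ) (f : (Fin 2 → ℝ) → ℝ) :
    sobSq (k + 1) f = ∑ w : Fin k → Fin 2, ∑ i : Fin 2,
      avg (fun x => pd i (pdList (List.ofFn w) f) x ^ 2) := by
  rw [sobSq, ← (Fin.consEquiv fun _ : Fin (k + 1) => Fin 2).sum_comp, Fintype.sum_prod_type,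
    Finset.sum_comm]
  refine Finset.sum_congr rfl fun w _ => Finset.sum_congr rfl fun i _ => ?_
  simp [Fin.consEquiv, List.ofFn_succ, pdList]

theorem avg_pdList_sq_le (l : List (Fin 2)) (f : (Fin 2 → ℝ) → ℝ) :
    avg (fun x => pdList l f x ^ 2) ≤ sobSq l.length f := by
  have h := Finset.single_le_sum
    (f := fun w : Fin l.length → Fin 2 => avg (fun x => pdList (List.ofFn w) f x ^ 2))
    (fun _ _ => avg_sq_nonneg _) (Finset.mem_univ l.get)
  simp only [List.ofFn_get] at h
  exact h

theorem avg_grad_pdList_sq_le (l : List (Fin 2)) (f : (Fin 2 → ℝ) → ℝ) :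
    avg (fun x => pd 0 (pdList l f) x ^ 2) + avg (fun x => pd 1 (pdList l f) x ^ 2)
      ≤ sobSq (l.length + 1) f := by
  rw [sobSq_succ]
  have h := Finset.single_le_sum
    (f := fun w : Fin l.length → Fin 2 => ∑ i : Fin 2,
      avg (fun x => pd i (pdList (List.ofFn w) f) x ^ 2))
    (fun _ _ => Finset.sum_nonneg fun _ _ => avg_sq_nonneg _) (Finset.mem_univ l.get)
  simpa only [List.ofFn_get, Fin.sum_univ_two] using h

theorem avg_pdList_eq_zero (l : List (Fin 2)) (hf : SmoothPer f) (h0 : avg f = 0) :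
    avg (pdList l f) = 0 := by
  by_cases hl : l = []
  · rw [hl]
    exact h0
  · exact avg_pdList_of_ne_nil hl hf

theorem sobSq_le_succ (k : ℕ) (hf : SmoothPer f) (h0 : avg f = 0) :
    sobSq k f ≤ (1 / 2) * sobSq (k + 1) f := by
  rw [sobSq_succ, sobSq, Finset.mul_sum]
  refine Finset.sum_le_sum fun w _ => ?_
  rw [Fin.sum_univ_two]
  exact poincare (hf.pdList _) (avg_pdList_eq_zero _ hf h0)

theorem avg_pdList_pow_four_le (l : List (Fin 2)) (hf : SmoothPer f) (h0 : avg f = 0) :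
    avg (fun x => pdList l f x ^ 4) ≤ 4 * (sobSq l.length f * sobSq (l.length + 1) f) := by
  refine (ladyzhenskaya (hf.pdList l) (avg_pdList_eq_zero l hf h0)).trans ?_
  have := sobSq_nonneg l.length f
  gcongr
  · exact add_nonneg (avg_sq_nonneg _) (avg_sq_nonneg _)
  · exact avg_pdList_sq_le l f
  · exact avg_grad_pdList_sq_le l f

theorem avg_grad_sq_eq (hf : SmoothPer f) :
    ∑ i : Fin 2, avg (fun x => pd i f x ^ 2) = -avg (fun x => f x * ∑ i, pd i (pd i f) x) := by
  have h : ∀ i, avg (fun x => pd i f x ^ 2) = -avg (fun x => f x * pd i (pd i f) x) := fun i => by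
    rw [← avg_pd_mul i hf (hf.pd i)]
    simp only [sq]
  simp only [h, Finset.sum_neg_distrib, Finset.mul_sum]
  rw [avg_sum Finset.univ fun i _ => (hf.mul ((hf.pd i).pd i)).cont]

theorem avg_laplacian_sq (hf : SmoothPer f) :
    avg (fun x => (∑ i, pd i (pd i f) x) ^ 2)
      = ∑ i : Fin 2, ∑ j : Fin 2, avg (fun x => pd j (pd i f) x ^ 2) := by
  have h : ∀ i j, avg (fun x => pd i (pd i f) x * pd j (pd j f) x)
      = avg (fun x => pd j (pd i f) x ^ 2) := fun i j => by
    have e1 := avg_pd_mul i (hf.pd i) ((hf.pd j).pd j)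
    have e2 := avg_pd_mul j (hf.pd i) ((hf.pd j).pd i)
    rw [pd_comm i j (hf.pd j)] at e1
    rw [e1, ← e2, pd_comm i j hf]
    simp only [sq]
  simp only [sq (Finset.sum _ _), Finset.sum_mul_sum]
  rw [avg_sum Finset.univ fun i _ => (SmoothPer.sum _ fun j _ =>
    ((hf.pd i).pd i).mul ((hf.pd j).pd j)).cont]
  refine Finset.sum_congr rfl fun i _ => ?_
  rw [avg_sum Finset.univ fun j _ => (((hf.pd i).pd i).mul ((hf.pd j).pd j)).cont]
  exact Finset.sum_congr rfl fun j _ => h i j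

/-- Log-convexity of the homogeneous Sobolev norms. -/
theorem sobSq_sq_le (k : ℕ) (hf : SmoothPer f) :
    sobSq (k + 1) f ^ 2 ≤ sobSq k f * sobSq (k + 2) f := by
  have e2 : sobSq (k + 2) f = ∑ w : Fin k → Fin 2,
      avg (fun x => (∑ i, pd i (pd i (pdList (List.ofFn w) f)) x) ^ 2) := by
    rw [sobSq_succ, ← (Fin.consEquiv fun _ : Fin (k + 1) => Fin 2).sum_comp,
      Fintype.sum_prod_type, Finset.sum_comm]
    refine Finset.sum_congr rfl fun w _ => ?_
    rw [avg_laplacian_sq (hf.pdList _)]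
    refine Finset.sum_congr rfl fun i _ => Finset.sum_congr rfl fun j _ => ?_
    simp [Fin.consEquiv, List.ofFn_succ, pdList]
  rw [e2, sobSq_succ, sobSq]
  refine Finset.sum_sq_le_sum_mul_sum_of_sq_le_mul _ (fun _ _ => avg_sq_nonneg _)
    (fun _ _ => avg_sq_nonneg _) fun w _ => ?_
  have hs := hf.pdList (List.ofFn w)
  rw [avg_grad_sq_eq hs, neg_sq]
  exact avg_mul_sq_le hs.cont (SmoothPer.sum _ fun i _ => (hs.pd i).pd i).cont

theorem mIdxList_two (α : Fin 2 → ℕ) :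
    mIdxList α = List.replicate (α 0) 0 ++ List.replicate (α 1) 1 := by
  simp [mIdxList, List.finRange_succ]

theorem avg_pdM_sq_le {k : ℕ} {α : Fin 2 → ℕ} (hα : α ∈ Finset.Nat.antidiagonalTuple 2 k)
    (f : (Fin 2 → ℝ) → ℝ) : avg (fun x => pdM α f x ^ 2) ≤ sobSq k f := by
  have hl : (mIdxList α).length = k := by
    rw [Finset.Nat.mem_antidiagonalTuple, Fin.sum_univ_two] at hα
    simp [mIdxList_two, hα]
  rw [← hl]
  exact avg_pdList_sq_le _ f

theorem sobSq_le_pdM (k : ℕ) (hf : SmoothPer f) :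
    sobSq k f ≤ 2 ^ k * ∑ α ∈ Finset.Nat.antidiagonalTuple 2 k, avg (fun x => pdM α f x ^ 2) := by
  have h : ∀ w : Fin k → Fin 2, avg (fun x => pdList (List.ofFn w) f x ^ 2)
      ≤ ∑ α ∈ Finset.Nat.antidiagonalTuple 2 k, avg (fun x => pdM α f x ^ 2) := fun w => by
    set l := List.ofFn w
    set α : Fin 2 → ℕ := ![l.count 0, l.count 1] with hα
    have hp : l.Perm (mIdxList α) := by
      rw [List.perm_iff_count, mIdxList_two]
      intro a
      fin_cases a <;> simp [hα, List.count_replicate]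
    have hmem : α ∈ Finset.Nat.antidiagonalTuple 2 k := by
      rw [Finset.Nat.mem_antidiagonalTuple, Fin.sum_univ_two]
      have := hp.length_eq
      rw [mIdxList_two] at this
      simpa [l] using this.symm
    rw [pdList_perm hp hf]
    exact Finset.single_le_sum (f := fun α => avg (fun x => pdM α f x ^ 2))
      (fun _ _ => avg_sq_nonneg _) hmem
  refine (Finset.sum_le_sum fun w _ => h w).trans ?_
  simp

end SobolevNorms

/-- The bilinear form polarizing `sobSq k`. -/
def pairing (k : ℕ) (g f : (Fin 2 → ℝ) → ℝ) : ℝ :=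
  ∑ w : Fin k → Fin 2, avg (fun x => pdList (List.ofFn w) g x * pdList (List.ofFn w) f x)

/-- The Laplacian. -/
def lapl (f : (Fin 2 → ℝ) → ℝ) (x : Fin 2 → ℝ) : ℝ := ∑ j, pd j (pd j f) x

/-- The derivative of the scalar `f` in the direction of the vector field `X`. -/
def conv (X : Fin 2 → (Fin 2 → ℝ) → ℝ) (f : (Fin 2 → ℝ) → ℝ) (x : Fin 2 → ℝ) : ℝ :=
  ∑ j, X j x * pd j f x

section Pairing

variable {f g h : (Fin 2 → ℝ) → ℝ} {X : Fin 2 → (Fin 2 → ℝ) → ℝ}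

theorem SmoothPer.lapl (hf : SmoothPer f) : SmoothPer (lapl f) :=
  SmoothPer.sum _ fun j _ => (hf.pd j).pd j

theorem SmoothPer.conv (hX : ∀ j, SmoothPer (X j)) (hf : SmoothPer f) : SmoothPer (conv X f) :=
  SmoothPer.sum _ fun j _ => (hX j).mul (hf.pd j)

theorem pairing_self (k : ℕ) (f : (Fin 2 → ℝ) → ℝ) : pairing k f f = sobSq k f := by
  simp only [pairing, sobSq, sq]

theorem pairing_comm (k : ℕ) (f g : (Fin 2 → ℝ) → ℝ) : pairing k g f = pairing k f g := by
  simp only [pairing, mul_comm]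

theorem pairing_add (k : ℕ) (hg : SmoothPer g) (hh : SmoothPer h) (hf : SmoothPer f) :
    pairing k (fun x => g x + h x) f = pairing k g f + pairing k h f := by
  simp only [pairing, ← Finset.sum_add_distrib]
  refine Finset.sum_congr rfl fun w _ => ?_
  rw [pdList_add _ hg hh, ← avg_add ((hg.pdList _).mul (hf.pdList _)).cont
    ((hh.pdList _).mul (hf.pdList _)).cont]
  simp only [add_mul]

theorem pairing_const_mul (k : ℕ) (c : ℝ) (hg : SmoothPer g) (f : (Fin 2 → ℝ) → ℝ) :
    pairing k (fun x => c * g x) f = c * pairing k g f := by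
  simp only [pairing, Finset.mul_sum]
  refine Finset.sum_congr rfl fun w _ => ?_
  rw [pdList_const_mul _ c hg, ← avg_const_mul]
  simp only [mul_assoc]

theorem pairing_sub (k : ℕ) (hg : SmoothPer g) (hh : SmoothPer h) (hf : SmoothPer f) :
    pairing k (fun x => g x - h x) f = pairing k g f - pairing k h f := by
  have e := pairing_add k hg (hh.const_mul (-1)) hf
  rw [pairing_const_mul k (-1) hh] at e
  simpa only [neg_one_mul, ← sub_eq_add_neg] using e

theorem pairing_sum (k : ℕ) {ι : Type*} [DecidableEq ι] (s : Finset ι)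
    {F : ι → (Fin 2 → ℝ) → ℝ} (hF : ∀ i, SmoothPer (F i)) (hf : SmoothPer f) :
    pairing k (fun x => ∑ i ∈ s, F i x) f = ∑ i ∈ s, pairing k (F i) f := by
  induction s using Finset.induction_on with
  | empty =>
    have := pairing_const_mul k 0 hf f
    simpa using this
  | insert a s ha ih =>
    simp only [Finset.sum_insert ha]
    rw [pairing_add k (hF a) (SmoothPer.sum s fun i _ => hF i) hf, ih]

theorem pairing_pd (k : ℕ) (i : Fin 2) (hg : SmoothPer g) (hf : SmoothPer f) :
    pairing k (pd i g) f = -pairing k g (pd i f) := by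
  simp only [pairing, ← Finset.sum_neg_distrib]
  refine Finset.sum_congr rfl fun w _ => ?_
  rw [pdList_pd _ i hg, pdList_pd _ i hf, avg_pd_mul i (hg.pdList _) (hf.pdList _)]

theorem sobSq_succ_eq_pd (k : ℕ) (hf : SmoothPer f) :
    sobSq (k + 1) f = ∑ i : Fin 2, sobSq k (pd i f) := by
  rw [sobSq_succ, Finset.sum_comm]
  simp only [sobSq, pdList_pd _ _ hf]

theorem pairing_lapl (k : ℕ) (hg : SmoothPer g) (hf : SmoothPer f) :
    pairing k (lapl g) f = -∑ j, pairing k (pd j g) (pd j f) := by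
  have : lapl g = fun x => ∑ j, pd j (pd j g) x := rfl
  rw [this, pairing_sum k Finset.univ (fun j => (hg.pd j).pd j) hf, ← Finset.sum_neg_distrib]
  exact Finset.sum_congr rfl fun j _ => pairing_pd k j (hg.pd j) hf

theorem sobSq_add (k : ℕ) (hf : SmoothPer f) (hg : SmoothPer g) :
    sobSq k (fun x => f x + g x) = sobSq k f + 2 * pairing k f g + sobSq k g := by
  have e := hf.add hg
  rw [← pairing_self, pairing_add k hf hg e, pairing_comm k _ f, pairing_comm k _ g,
    pairing_add k hf hg hf, pairing_add k hf hg hg, pairing_self, pairing_self, pairing_comm k f g]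
  ring

theorem sobSq_sub (k : ℕ) (hf : SmoothPer f) (hg : SmoothPer g) :
    sobSq k (fun x => f x - g x) = sobSq k f - 2 * pairing k f g + sobSq k g := by
  have e := hf.sub hg
  rw [← pairing_self, pairing_sub k hf hg e, pairing_comm k _ f, pairing_comm k _ g,
    pairing_sub k hf hg hf, pairing_sub k hf hg hg, pairing_self, pairing_self, pairing_comm k f g]
  ring

theorem sobSq_sub_le (k : ℕ) (hf : SmoothPer f) (hg : SmoothPer g) :
    sobSq k (fun x => f x - g x) ≤ 2 * sobSq k f + 2 * sobSq k g := by
  have h1 := sobSq_sub k hf hg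
  have h2 := sobSq_add k hf hg
  have h3 := sobSq_nonneg k (fun x => f x + g x)
  linarith

/-- The two-by-two diffusion matrix with eigenvalues `ν`, `η` is bounded below by `σ`. -/
theorem diffusion_coercive {ν η σ : ℝ} (hν : σ ≤ ν) (hη : σ ≤ η) (k : ℕ) (hf : SmoothPer f)
    (hg : SmoothPer g) :
    σ * (sobSq k f + sobSq k g) ≤ (ν + η) / 2 * (sobSq k f + sobSq k g)
      + (ν - η) / 2 * (2 * pairing k f g) := by
  have h1 := sobSq_add k hf hg
  have h2 := sobSq_sub k hf hg
  have h3 := sobSq_nonneg k (fun x => f x + g x)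
  have h4 := sobSq_nonneg k (fun x => f x - g x)
  nlinarith [mul_nonneg (sub_nonneg.2 hν) h3, mul_nonneg (sub_nonneg.2 hη) h4]

/-- Transport by a divergence-free field preserves the `L²` norm. -/
theorem avg_conv_mul_self (hX : ∀ j, SmoothPer (X j)) (hdiv : ∀ x, ∑ j, pd j (X j) x = 0)
    (hf : SmoothPer f) : avg (fun x => conv X f x * f x) = 0 := by
  have e : ∀ j, avg (fun x => X j x * pd j f x * f x)
      = -avg (fun x => pd j (X j) x * f x ^ 2) - avg (fun x => X j x * pd j f x * f x) := by
    intro j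
    have e1 := avg_pd_mul j hf ((hX j).mul hf)
    rw [pd_mul j (hX j) hf] at e1
    have e2 : (fun x => f x * (pd j (X j) x * f x + X j x * pd j f x))
        = fun x => pd j (X j) x * f x ^ 2 + X j x * pd j f x * f x := by
      funext x; ring
    have e3 : (fun x => pd j f x * (X j x * f x)) = fun x => X j x * pd j f x * f x := by
      funext x; ring
    rw [e2, e3, avg_add (((hX j).pd j).mul (hf.pow 2)).cont
      (((hX j).mul (hf.pd j)).mul hf).cont] at e1
    linarith
  have h1 : avg (fun x => conv X f x * f x)
      = ∑ j, avg (fun x => X j x * pd j f x * f x) := by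
    simp only [conv, Finset.sum_mul]
    exact avg_sum _ fun j _ => (((hX j).mul (hf.pd j)).mul hf).cont
  have h2 : ∑ j, avg (fun x => pd j (X j) x * f x ^ 2) = 0 := by
    rw [← avg_sum (F := fun j x => pd j (X j) x * f x ^ 2) Finset.univ
      fun j _ => (((hX j).pd j).mul (hf.pow 2)).cont]
    simp only [← Finset.sum_mul, hdiv, zero_mul, avg_const]
  have h3 := Finset.sum_congr rfl fun j (_ : j ∈ Finset.univ) => e j
  rw [Finset.sum_sub_distrib, Finset.sum_neg_distrib, h2] at h3
  rw [h1]
  linarith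

theorem conv_eq_div (hX : ∀ j, SmoothPer (X j)) (hdiv : ∀ x, ∑ j, pd j (X j) x = 0)
    (hf : SmoothPer f) : conv X f = fun x => ∑ j, pd j (fun y => X j y * f y) x := by
  funext x
  simp only [conv, fun j => pd_mul j (hX j) hf, Finset.sum_add_distrib, ← Finset.sum_mul, hdiv,
    zero_mul, zero_add]

theorem avg_conv (hX : ∀ j, SmoothPer (X j)) (hdiv : ∀ x, ∑ j, pd j (X j) x = 0)
    (hf : SmoothPer f) : avg (conv X f) = 0 := by
  rw [conv_eq_div hX hdiv hf, avg_sum _ fun j _ => (((hX j).mul hf).pd j).cont]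
  exact Finset.sum_eq_zero fun j _ => avg_pd j ((hX j).mul hf)

theorem avg_lapl (hf : SmoothPer f) : avg (lapl f) = 0 := by
  have : lapl f = fun x => ∑ j, pd j (pd j f) x := rfl
  rw [this, avg_sum _ fun j _ => ((hf.pd j).pd j).cont]
  exact Finset.sum_eq_zero fun j _ => avg_pd j (hf.pd j)

theorem pairing_grad (k : ℕ) (hX : ∀ j, SmoothPer (X j)) (hdiv : ∀ x, ∑ j, pd j (X j) x = 0)
    (hg : SmoothPer g) : ∑ j, pairing k (pd j g) (X j) = 0 := by
  have h : ∀ j, pairing k (pd j g) (X j) = -pairing k (pd j (X j)) g := fun j => by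
    rw [pairing_pd k j hg (hX j), pairing_comm]
  simp only [h, Finset.sum_neg_distrib]
  rw [← pairing_sum k Finset.univ (fun j => (hX j).pd j) hg]
  simp only [hdiv]
  simpa using pairing_const_mul k 0 hg g

theorem trilinear_bound (a b c : List (Fin 2)) (hf : SmoothPer f) (hf0 : avg f = 0)
    (hg : SmoothPer g) (hg0 : avg g = 0) (hh : SmoothPer h) :
    avg (fun x => pdList a f x * pdList b g x * pdList c h x) ^ 4
      ≤ 16 * (sobSq a.length f * sobSq (a.length + 1) f)
        * (sobSq b.length g * sobSq (b.length + 1) g) * sobSq c.length h ^ 2 := by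
  refine (avg_mul_mul_pow_four_le (hf.pdList a).cont (hg.pdList b).cont (hh.pdList c).cont).trans ?_
  have h1 := avg_pdList_pow_four_le a hf hf0
  have h2 := avg_pdList_pow_four_le b hg hg0
  have h3 := avg_pdList_sq_le c h
  have p3 := avg_sq_nonneg (pdList c h)
  have p2 : 0 ≤ avg (fun x => pdList b g x ^ 4) := avg_nonneg fun x => by positivity
  have p1 := mul_nonneg (sobSq_nonneg a.length f) (sobSq_nonneg (a.length + 1) f)
  have p4 := mul_nonneg (sobSq_nonneg b.length g) (sobSq_nonneg (b.length + 1) g)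
  calc _ ≤ (4 * (sobSq a.length f * sobSq (a.length + 1) f))
        * (4 * (sobSq b.length g * sobSq (b.length + 1) g)) * sobSq c.length h ^ 2 := by
        gcongr
    _ = _ := by ring

theorem abs_listSum_le {α : Type*} (L : List α) (F : α → ℝ) (B : ℝ)
    (h : ∀ a ∈ L, |F a| ≤ B) : |(L.map F).sum| ≤ L.length * B := by
  induction L with
  | nil => simp
  | cons a L ih =>
    simp only [List.map_cons, List.sum_cons, List.length_cons]
    have h1 := h a List.mem_cons_self
    have h2 := ih fun b hb => h b (List.mem_cons_of_mem a hb)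
    have h3 := abs_add_le (F a) (L.map F).sum
    push_cast
    linarith

/-- Leibniz' rule applied to a transport term, with the leading term removed by
incompressibility. -/
theorem abs_pairing_conv_self_le (k : ℕ) (hX : ∀ j, SmoothPer (X j))
    (hdiv : ∀ x, ∑ j, pd j (X j) x = 0) (hf : SmoothPer f) {B : ℝ} (hB0 : 0 ≤ B)
    (hB : ∀ j : Fin 2, ∀ a b c : List (Fin 2), 1 ≤ a.length → a.length + b.length = k →
      c.length = k →
      |avg (fun x => pdList a (X j) x * pdList (j :: b) f x * pdList c f x)| ≤ B) :
    |pairing k (conv X f) f| ≤ 2 ^ k * (2 * (2 ^ k * B)) := by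
  have hw : ∀ w : Fin k → Fin 2,
      |avg (fun x => pdList (List.ofFn w) (conv X f) x * pdList (List.ofFn w) f x)|
        ≤ 2 * (2 ^ k * B) := by
    intro w
    set l := List.ofFn w with hl
    have hlk : l.length = k := by simp [hl]
    have hg := hf.pdList l
    have hXf : ∀ j, ∀ p : List (Fin 2) × List (Fin 2),
        SmoothPer (fun x => pdList p.1 (X j) x * pdList (j :: p.2) f x * pdList l f x) :=
      fun j p => (((hX j).pdList _).mul (hf.pdList _)).mul hg
    have e : (fun x => pdList l (conv X f) x * pdList l f x)
        = fun x => conv X (pdList l f) x * pdList l f x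
          + ∑ j, ((properSplits l).map fun p =>
              pdList p.1 (X j) x * pdList (j :: p.2) f x * pdList l f x).sum := by
      have : conv X f = fun x => ∑ j, X j x * pd j f x := rfl
      rw [this, pdList_sum l _ fun j _ => (hX j).mul (hf.pd j)]
      simp only [fun j => pdList_mul l (hX j) (hf.pd j), Finset.sum_add_distrib, add_mul,
        fun l j => pdList_pd l j hf, List.sum_map_mul_right, Finset.sum_mul, conv, pdList]
    rw [e, avg_add ((SmoothPer.conv hX hg).mul hg).cont
      (SmoothPer.sum _ fun j _ => SmoothPer.listSum _ (hXf j)).cont,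
      avg_conv_mul_self hX hdiv hg, zero_add,
      avg_sum _ fun j _ => (SmoothPer.listSum _ (hXf j)).cont]
    refine (Finset.abs_sum_le_sum_abs _ _).trans ?_
    have hj : ∀ j : Fin 2, |avg (fun x => ((properSplits l).map fun p =>
        pdList p.1 (X j) x * pdList (j :: p.2) f x * pdList l f x).sum)| ≤ 2 ^ k * B := by
      intro j
      rw [avg_listSum _ fun p => (hXf j p).cont]
      refine (abs_listSum_le _ _ B fun p hp => ?_).trans ?_
      · have := length_of_mem_properSplits p hp
        exact hB j p.1 p.2 l this.1 (this.2.trans hlk) hlk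
      · have : ((properSplits l).length : ℝ) ≤ 2 ^ k := by
          rw [← hlk]
          exact_mod_cast length_properSplits_le l
        gcongr
    calc _ ≤ ∑ _j : Fin 2, 2 ^ k * B := Finset.sum_le_sum fun j _ => hj j
      _ = _ := by simp
  rw [pairing]
  calc _ ≤ _ := Finset.abs_sum_le_sum_abs _ _
    _ ≤ ∑ _w : Fin k → Fin 2, 2 * (2 ^ k * B) := Finset.sum_le_sum fun w _ => hw w
    _ = _ := by simp

end Pairing

/-- Products of terms of a logarithmically convex sequence grow when the indices spread out. -/
theorem mul_le_mul_of_logConvex {a : ℕ → ℝ} (h0 : ∀ k, 0 ≤ a k)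
    (h : ∀ k, a (k + 1) ^ 2 ≤ a k * a (k + 2)) (i m n : ℕ) :
    a (i + m) * a (i + n) ≤ a i * a (i + m + n) := by
  have step : ∀ n i, a (i + 1) * a (i + n) ≤ a i * a (i + n + 1) := by
    intro n
    induction n with
    | zero => intro i; simp [mul_comm]
    | succ n ih =>
      intro i
      have e1 := ih i
      have e2 := h (i + n)
      rcases (h0 (i + n + 1)).eq_or_lt with hz | hz
      · have := mul_nonneg (h0 i) (h0 (i + (n + 1) + 1))
        rw [← add_assoc, ← hz, mul_zero]
        exact this
      · refine le_of_mul_le_mul_right ?_ hz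
        calc a (i + 1) * a (i + (n + 1)) * a (i + n + 1) = a (i + 1) * a (i + n + 1) ^ 2 := by
              rw [← add_assoc]; ring
          _ ≤ a (i + 1) * (a (i + n) * a (i + n + 2)) := by have := h0 (i + 1); gcongr
          _ = a (i + 1) * a (i + n) * a (i + n + 2) := by ring
          _ ≤ a i * a (i + n + 1) * a (i + n + 2) := by have := h0 (i + n + 2); gcongr
          _ = _ := by rw [show i + (n + 1) + 1 = i + n + 2 by ring]; ring
  induction m generalizing i n with
  | zero => simp
  | succ m ih =>
    cases n with
    | zero => simp [mul_comm]
    | succ n =>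
      have e1 := ih (i + 1) n
      have e2 := step (m + n + 1) i
      rw [show i + 1 + m + n = i + (m + n + 1) by ring] at e1
      rw [show i + (m + 1) = i + 1 + m by ring, show i + (n + 1) = i + 1 + n by ring,
        show i + 1 + m + (n + 1) = i + (m + n + 1) + 1 by ring]
      exact e1.trans e2

/-- The homogeneous Sobolev energy of order `k` of a pair of vector fields. -/
def energy (k : ℕ) (Y : Bool → Fin 2 → (Fin 2 → ℝ) → ℝ) : ℝ :=
  ∑ p : Bool × Fin 2, sobSq k (Y p.1 p.2)

/-- A pair of smooth periodic divergence-free vector fields of zero mean. -/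
structure Solenoidal (Y : Bool → Fin 2 → (Fin 2 → ℝ) → ℝ) : Prop where
  smooth : ∀ s i, SmoothPer (Y s i)
  mean : ∀ s i, avg (Y s i) = 0
  div : ∀ s x, ∑ j, pd j (Y s j) x = 0

section Energy

variable {X Y Z : Bool → Fin 2 → (Fin 2 → ℝ) → ℝ}

theorem energy_nonneg (k : ℕ) (Y : Bool → Fin 2 → (Fin 2 → ℝ) → ℝ) : 0 ≤ energy k Y :=
  Finset.sum_nonneg fun _ _ => sobSq_nonneg _ _

theorem sobSq_le_energy (k : ℕ) (Y : Bool → Fin 2 → (Fin 2 → ℝ) → ℝ) (s : Bool) (i : Fin 2) :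
    sobSq k (Y s i) ≤ energy k Y :=
  Finset.single_le_sum (f := fun p : Bool × Fin 2 => sobSq k (Y p.1 p.2))
    (fun _ _ => sobSq_nonneg _ _) (Finset.mem_univ (s, i))

theorem energy_le_succ (hY : Solenoidal Y) (k : ℕ) : 2 * energy k Y ≤ energy (k + 1) Y := by
  rw [energy, energy, Finset.mul_sum]
  refine Finset.sum_le_sum fun p _ => ?_
  have := sobSq_le_succ k (hY.smooth p.1 p.2) (hY.mean p.1 p.2)
  linarith

theorem energy_sq_le (hY : Solenoidal Y) (k : ℕ) :
    energy (k + 1) Y ^ 2 ≤ energy k Y * energy (k + 2) Y :=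
  Finset.sum_sq_le_sum_mul_sum_of_sq_le_mul _ (fun _ _ => sobSq_nonneg _ _)
    (fun _ _ => sobSq_nonneg _ _) fun p _ => sobSq_sq_le k (hY.smooth p.1 p.2)

theorem energy_mul_le (hY : Solenoidal Y) (i m n : ℕ) :
    energy (i + m) Y * energy (i + n) Y ≤ energy i Y * energy (i + m + n) Y :=
  mul_le_mul_of_logConvex (fun k => energy_nonneg k Y) (energy_sq_le hY) i m n

theorem Solenoidal.sub (hX : Solenoidal X) (hY : Solenoidal Y) :
    Solenoidal fun s i x => X s i x - Y s i x where
  smooth s i := (hX.smooth s i).sub (hY.smooth s i)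
  mean s i := by
    rw [avg_sub (hX.smooth s i).cont (hY.smooth s i).cont, hX.mean, hY.mean, sub_zero]
  div s x := by
    have h : ∀ j, pd j (fun x => X s j x - Y s j x) = fun x => pd j (X s j) x - pd j (Y s j) x :=
      fun j => pdList_sub [j] (hX.smooth s j) (hY.smooth s j)
    simp only [h, Finset.sum_sub_distrib, hX.div, hY.div, sub_zero]

theorem energy_sub_le (hX : Solenoidal X) (hY : Solenoidal Y) (k : ℕ) :
    energy k (fun s i x => X s i x - Y s i x) ≤ 2 * energy k X + 2 * energy k Y := by
  simp only [energy, Finset.mul_sum, ← Finset.sum_add_distrib]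
  exact Finset.sum_le_sum fun p _ => sobSq_sub_le k (hX.smooth _ _) (hY.smooth _ _)

/-- The right-hand side of the MHD system in Elsässer variables, with forcing `-G`. -/
def elsasserRhs (ν η : ℝ) (p : (Fin 2 → ℝ) → ℝ) (Y G : Bool → Fin 2 → (Fin 2 → ℝ) → ℝ)
    (s : Bool) (i : Fin 2) (x : Fin 2 → ℝ) : ℝ :=
  (ν + η) / 2 * lapl (Y s i) x + (ν - η) / 2 * lapl (Y (!s) i) x - pd i p x - G s i x

theorem pairing_elsasserRhs_le {ν η σ : ℝ} (hν : σ ≤ ν) (hη : σ ≤ η) {p : (Fin 2 → ℝ) → ℝ}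
    {G : Bool → Fin 2 → (Fin 2 → ℝ) → ℝ} (hp : SmoothPer p) (hG : ∀ s i, SmoothPer (G s i))
    (hY : Solenoidal Y) (k : ℕ) :
    ∑ q : Bool × Fin 2, pairing k (elsasserRhs ν η p Y G q.1 q.2) (Y q.1 q.2)
      ≤ -(σ * energy (k + 1) Y)
        + ∑ q : Bool × Fin 2, |pairing k (G q.1 q.2) (Y q.1 q.2)| := by
  have e : ∀ q : Bool × Fin 2, pairing k (elsasserRhs ν η p Y G q.1 q.2) (Y q.1 q.2)
      = -(∑ j, ((ν + η) / 2 * sobSq k (pd j (Y q.1 q.2))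
          + (ν - η) / 2 * pairing k (pd j (Y (!q.1) q.2)) (pd j (Y q.1 q.2))))
        - pairing k (pd q.2 p) (Y q.1 q.2) - pairing k (G q.1 q.2) (Y q.1 q.2) := by
    intro q
    have h1 := (hY.smooth q.1 q.2)
    have h2 := (hY.smooth (!q.1) q.2)
    have a1 := h1.lapl.const_mul ((ν + η) / 2)
    have a2 := h2.lapl.const_mul ((ν - η) / 2)
    have : elsasserRhs ν η p Y G q.1 q.2 = fun x => (ν + η) / 2 * lapl (Y q.1 q.2) x
      + (ν - η) / 2 * lapl (Y (!q.1) q.2) x - pd q.2 p x - G q.1 q.2 x := rfl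
    rw [this, pairing_sub k ((a1.add a2).sub (hp.pd q.2)) (hG _ _) h1,
      pairing_sub k (a1.add a2) (hp.pd q.2) h1, pairing_add k a1 a2 h1,
      pairing_const_mul k _ h1.lapl, pairing_const_mul k _ h2.lapl, pairing_lapl k h1 h1,
      pairing_lapl k h2 h1]
    simp only [pairing_self, Finset.sum_add_distrib, ← Finset.mul_sum]
    ring
  simp only [e, Finset.sum_sub_distrib, Finset.sum_neg_distrib]
  have hpr : ∑ q : Bool × Fin 2, pairing k (pd q.2 p) (Y q.1 q.2) = 0 := by
    rw [Fintype.sum_prod_type]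
    exact Finset.sum_eq_zero fun s _ => pairing_grad k (hY.smooth s) (hY.div s) hp
  have hN : -∑ q : Bool × Fin 2, pairing k (G q.1 q.2) (Y q.1 q.2)
      ≤ ∑ q : Bool × Fin 2, |pairing k (G q.1 q.2) (Y q.1 q.2)| := by
    rw [← Finset.sum_neg_distrib]
    exact Finset.sum_le_sum fun q _ => neg_le_abs _
  have hD : σ * energy (k + 1) Y ≤ ∑ q : Bool × Fin 2,
      ∑ j, ((ν + η) / 2 * sobSq k (pd j (Y q.1 q.2))
        + (ν - η) / 2 * pairing k (pd j (Y (!q.1) q.2)) (pd j (Y q.1 q.2))) := by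
    rw [energy, Fintype.sum_prod_type_right, Fintype.sum_prod_type_right, Finset.mul_sum]
    refine Finset.sum_le_sum fun i _ => ?_
    simp only [fun s => sobSq_succ_eq_pd k (hY.smooth s i), Fintype.sum_bool, Bool.not_true,
      Bool.not_false, ← Finset.sum_add_distrib, Finset.mul_sum]
    refine Finset.sum_le_sum fun j _ => ?_
    have := diffusion_coercive hν hη k ((hY.smooth true i).pd j) ((hY.smooth false i).pd j)
    rw [pairing_comm k (pd j (Y true i))] at *
    linarith
  linarith

theorem le_add_div_of_pow_four_le {T H P ε : ℝ} (hε : 0 < ε) (hH : 0 ≤ H) (hP : 0 ≤ P)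
    (h : T ^ 4 ≤ 16 * P ^ 2 * H ^ 2) : |T| ≤ ε * H + 1 / ε * P := by
  have h2 : T ^ 2 ≤ 4 * (P * H) := by
    refine le_of_sq_le_sq ?_ (by positivity)
    nlinarith
  refine abs_le_of_sq_le_sq (h2.trans ?_) (by positivity)
  have : ε * H * (1 / ε * P) = P * H := by field_simp
  nlinarith [sq_nonneg (ε * H - 1 / ε * P)]

theorem le_add_div_of_pow_four_le' {T H P ε : ℝ} (hε : 0 < ε) (hH : 0 ≤ H) (hP : 0 ≤ P)
    (h : T ^ 4 ≤ 16 * P * H ^ 3) : |T| ≤ ε * H + 16 / ε ^ 3 * P := by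
  have hx : 0 ≤ ε * H := by positivity
  have hy : 0 ≤ 16 / ε ^ 3 * P := by positivity
  refine le_of_pow_le_pow_left₀ (n := 4) (by norm_num) (by positivity) ?_
  have e : (ε * H) ^ 3 * (16 / ε ^ 3 * P) = 16 * P * H ^ 3 := by field_simp
  have : |T| ^ 4 = T ^ 4 := by rw [show (4 : ℕ) = 2 * 2 by rfl, pow_mul, sq_abs, ← pow_mul]
  rw [this]
  generalize ε * H = a at *
  generalize 16 / ε ^ 3 * P = b at *
  have h1 : 0 ≤ a * b := mul_nonneg hx hy
  have h3 : (a + b) ^ 4 = a ^ 4 + 4 * (a ^ 3 * b) + 6 * (a * b) ^ 2 + 4 * (a * b) * b ^ 2 + b ^ 4 := by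
    ring
  have h4 : 0 ≤ a ^ 3 * b := by positivity
  have h5 : 0 ≤ (a * b) * b ^ 2 := by positivity
  have h6 : 0 ≤ a ^ 4 := by positivity
  have h7 : 0 ≤ b ^ 4 := by positivity
  nlinarith [sq_nonneg (a * b)]

end Energy

section Nonlinear

variable {X Y Z : Bool → Fin 2 → (Fin 2 → ℝ) → ℝ}

/-- Leibniz' rule applied to a transport term in divergence form. -/
theorem abs_pairing_conv_le (k : ℕ) {U : Fin 2 → (Fin 2 → ℝ) → ℝ} {f h : (Fin 2 → ℝ) → ℝ}
    (hU : ∀ j, SmoothPer (U j)) (hdiv : ∀ x, ∑ j, pd j (U j) x = 0) (hf : SmoothPer f)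
    (hh : SmoothPer h) {B : ℝ} (hB0 : 0 ≤ B)
    (hB : ∀ j : Fin 2, ∀ a b c : List (Fin 2), a.length + b.length = k → c.length = k →
      |avg (fun x => pdList a (U j) x * pdList b f x * pdList (j :: c) h x)| ≤ B) :
    |pairing k (conv U f) h| ≤ 2 ^ k * (2 * (2 * 2 ^ k * B)) := by
  have hprod := fun j => (hU j).mul hf
  have e : pairing k (conv U f) h
      = -∑ j, pairing k (fun y => U j y * f y) (pd j h) := by
    rw [conv_eq_div hU hdiv hf, pairing_sum k Finset.univ (fun j => (hprod j).pd j) hh,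
      ← Finset.sum_neg_distrib]
    exact Finset.sum_congr rfl fun j _ => pairing_pd k j (hprod j) hh
  rw [e, abs_neg]
  simp only [pairing]
  rw [Finset.sum_comm]
  have hw : ∀ w : Fin k → Fin 2, ∀ j, |avg (fun x =>
      pdList (List.ofFn w) (fun y => U j y * f y) x * pdList (List.ofFn w) (pd j h) x)|
      ≤ 2 * 2 ^ k * B := by
    intro w j
    set l := List.ofFn w with hl
    have hlk : l.length = k := by simp [hl]
    have hT : ∀ p : List (Fin 2) × List (Fin 2),
        SmoothPer (fun x => pdList p.1 (U j) x * pdList p.2 f x * pdList (j :: l) h x) :=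
      fun p => (((hU j).pdList _).mul (hf.pdList _)).mul (hh.pdList _)
    have e1 : (fun x => pdList l (fun y => U j y * f y) x * pdList l (pd j h) x)
        = fun x => pdList [] (U j) x * pdList l f x * pdList (j :: l) h x
          + ((properSplits l).map fun p =>
            pdList p.1 (U j) x * pdList p.2 f x * pdList (j :: l) h x).sum := by
      rw [pdList_mul l (hU j) hf, pdList_pd l j hh]
      simp only [add_mul, List.sum_map_mul_right, pdList]
    rw [e1, avg_add (hT ([], l)).cont (SmoothPer.listSum _ hT).cont,
      avg_listSum _ fun p => (hT p).cont]
    refine (abs_add_le _ _).trans ?_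
    have h1 := hB j [] l l (by simpa using hlk) hlk
    have h2 := abs_listSum_le (properSplits l)
      (fun p => avg fun x => pdList p.1 (U j) x * pdList p.2 f x * pdList (j :: l) h x) B
      fun p hp => hB j p.1 p.2 l ((length_of_mem_properSplits p hp).2.trans hlk) hlk
    have h3 : ((properSplits l).length : ℝ) * B ≤ 2 ^ k * B := by
      have : ((properSplits l).length : ℝ) ≤ 2 ^ k := by
        rw [← hlk]
        exact_mod_cast length_properSplits_le l
      gcongr
    have h4 : 1 * B ≤ 2 ^ k * B := by
      have : (1 : ℝ) ≤ 2 ^ k := one_le_pow₀ (by norm_num)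
      gcongr
    linarith
  calc _ ≤ _ := Finset.abs_sum_le_sum_abs _ _
    _ ≤ ∑ _w : Fin k → Fin 2, 2 * (2 * 2 ^ k * B) := by
        refine Finset.sum_le_sum fun w _ => (Finset.abs_sum_le_sum_abs _ _).trans ?_
        calc _ ≤ ∑ _j : Fin 2, 2 * 2 ^ k * B := Finset.sum_le_sum fun j _ => hw w j
          _ = _ := by simp
    _ = _ := by simp

theorem trilinear_energy_bound (hX : Solenoidal X) (hY : Solenoidal Y) (hZ : Solenoidal Z)
    (a b c : List (Fin 2)) (s s' s'' : Bool) (i i' i'' : Fin 2) :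
    avg (fun x => pdList a (X s i) x * pdList b (Y s' i') x * pdList c (Z s'' i'') x) ^ 4
      ≤ 16 * (energy a.length X * energy (a.length + 1) X)
        * (energy b.length Y * energy (b.length + 1) Y) * energy c.length Z ^ 2 := by
  refine (trilinear_bound a b c (hX.smooth s i) (hX.mean s i) (hY.smooth s' i') (hY.mean s' i')
    (hZ.smooth s'' i'')).trans ?_
  have E1 := sobSq_le_energy
  have S0 := sobSq_nonneg
  have E0 := energy_nonneg
  have hXX := mul_le_mul (E1 a.length X s i) (E1 (a.length + 1) X s i) (S0 _ _) (E0 _ _)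
  have hYY := mul_le_mul (E1 b.length Y s' i') (E1 (b.length + 1) Y s' i') (S0 _ _) (E0 _ _)
  have hZZ := pow_le_pow_left₀ (S0 _ _) (E1 c.length Z s'' i'') 2
  have p1 := mul_nonneg (S0 a.length (X s i)) (S0 (a.length + 1) (X s i))
  have p2 := mul_nonneg (S0 b.length (Y s' i')) (S0 (b.length + 1) (Y s' i'))
  have p3 := mul_nonneg (E0 a.length X) (E0 (a.length + 1) X)
  have p4 := mul_nonneg (E0 b.length Y) (E0 (b.length + 1) Y)
  gcongr

theorem energy_interpolation (hY : Solenoidal Y) {a b k : ℕ} (ha : 1 ≤ a) (hk : a + b = k) :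
    energy a Y * energy (a + 1) Y * (energy (b + 1) Y * energy (b + 2) Y) * energy k Y ^ 2
      ≤ (energy 1 Y * energy k Y) ^ 2 * energy (k + 1) Y ^ 2 := by
  obtain ⟨a, rfl⟩ := Nat.exists_eq_add_of_le ha
  have E0 := fun k => energy_nonneg k Y
  have i1 := energy_mul_le hY 1 a b
  have i2 := energy_mul_le hY 2 a b
  have i3 := energy_mul_le hY 1 1 (a + b)
  rw [hk] at i1
  rw [show 2 + a + b = k + 1 by omega] at i2
  rw [show 1 + 1 + (a + b) = k + 1 by omega, show 1 + (a + b) = k by omega] at i3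
  rw [show 1 + a + 1 = 2 + a by ring, show b + 1 = 1 + b by ring, show b + 2 = 2 + b by ring]
  have p0 := mul_nonneg (E0 2) (E0 (k + 1))
  have p1 := mul_nonneg (E0 1) (E0 k)
  have p2 := mul_nonneg (E0 (2 + a)) (E0 (2 + b))
  calc _ = energy (1 + a) Y * energy (1 + b) Y * (energy (2 + a) Y * energy (2 + b) Y)
        * energy k Y ^ 2 := by ring
    _ ≤ energy 1 Y * energy k Y * (energy 2 Y * energy (k + 1) Y) * energy k Y ^ 2 := by gcongr
    _ = energy 1 Y * energy k Y * (energy (1 + 1) Y * energy k Y)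
        * (energy k Y * energy (k + 1) Y) := by ring
    _ ≤ energy 1 Y * energy k Y * (energy 1 Y * energy (k + 1) Y)
        * (energy k Y * energy (k + 1) Y) := by
        have := mul_nonneg (E0 k) (E0 (k + 1))
        gcongr
    _ = _ := by ring

/-- Energy inequality for a single solution. -/
theorem energy_estimate_self {ν η σ : ℝ} (hσ : 0 < σ) (hν : σ ≤ ν) (hη : σ ≤ η)
    {p : (Fin 2 → ℝ) → ℝ} (hp : SmoothPer p) (hY : Solenoidal Y) (k : ℕ) :
    2 * ∑ q : Bool × Fin 2,
        pairing k (elsasserRhs ν η p Y (fun s i => conv (Y (!s)) (Y s i)) q.1 q.2) (Y q.1 q.2)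
      + 2 * σ * energy k Y + σ / 2 * energy (k + 1) Y
      ≤ (if k = 0 then 0 else 512 * 16 ^ k / σ * (energy 1 Y * energy k Y)) := by
  have h1 := pairing_elsasserRhs_le hν hη hp (G := fun s i => conv (Y (!s)) (Y s i))
    (fun s i => SmoothPer.conv (hY.smooth _) (hY.smooth _ _)) hY k
  have h2 := mul_le_mul_of_nonneg_left (energy_le_succ hY k) hσ.le
  have E0 := fun k => energy_nonneg k Y
  set R := (if k = 0 then 0 else 512 * 16 ^ k / σ * (energy 1 Y * energy k Y)) with hR
  suffices hN : ∀ q : Bool × Fin 2, 8 * |pairing k (conv (Y (!q.1)) (Y q.1 q.2)) (Y q.1 q.2)|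
      ≤ σ / 2 * energy (k + 1) Y + R by
    have h3 := Finset.sum_le_sum fun q (_ : q ∈ Finset.univ) => hN q
    rw [← Finset.mul_sum, Finset.sum_const, Finset.card_univ, Fintype.card_prod,
      Fintype.card_bool, Fintype.card_fin, nsmul_eq_mul] at h3
    push_cast at h3
    linarith
  intro q
  rcases Nat.eq_zero_or_pos k with rfl | hk
  · have h3 := abs_pairing_conv_self_le 0 (hY.smooth (!q.1)) (hY.div (!q.1)) (hY.smooth q.1 q.2)
      le_rfl fun j a b c ha hab _ => by omega
    have h4 := mul_nonneg hσ.le (E0 1)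
    simp only [hR, if_true]
    simp only [mul_zero, zero_add] at h3 ⊢
    linarith
  · rw [if_neg hk.ne'] at hR
    set ε := σ / (32 * 4 ^ k) with hε
    have hε0 : 0 < ε := by positivity
    have h3 := abs_pairing_conv_self_le k (hY.smooth (!q.1)) (hY.div (!q.1)) (hY.smooth q.1 q.2)
      (B := ε * energy (k + 1) Y + 1 / ε * (energy 1 Y * energy k Y))
      (by have := E0 1; have := E0 k; have := E0 (k + 1); positivity)
      fun j a b c ha hab hc => by
        have hpow := trilinear_energy_bound hY hY hY a (j :: b) c (!q.1) q.1 q.1 j q.2 q.2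
        have hE := energy_interpolation hY ha hab
        refine le_add_div_of_pow_four_le hε0 (E0 _) (mul_nonneg (E0 _) (E0 _)) ?_
        rw [hc, List.length_cons] at hpow
        linarith
    have e : 8 * (2 ^ k * (2 * (2 ^ k * (ε * energy (k + 1) Y
        + 1 / ε * (energy 1 Y * energy k Y))))) = σ / 2 * energy (k + 1) Y + R := by
      rw [hR, hε, show (16 : ℝ) ^ k = 4 ^ k * 4 ^ k by rw [← mul_pow]; norm_num,
        show (4 : ℝ) ^ k = 2 ^ k * 2 ^ k by rw [← mul_pow]; norm_num]
      field_simp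
      ring
    linarith

/-- The lower-order part of the energy inequality for a difference of solutions. -/
def lowerOrder (G E : ℕ → ℝ) (k : ℕ) : ℝ :=
  ∑ i ∈ Finset.range k, (G (i + 1) * E (k - i) + G (i + 2) * E (k - 1 - i))

theorem lowerOrder_nonneg {G E : ℕ → ℝ} (hG : ∀ k, 0 ≤ G k) (hE : ∀ k, 0 ≤ E k) (k : ℕ) :
    0 ≤ lowerOrder G E k :=
  Finset.sum_nonneg fun _ _ => add_nonneg (mul_nonneg (hG _) (hE _)) (mul_nonneg (hG _) (hE _))

theorem abs_le_of_pow_four_le_lowerOrder {G E : ℕ → ℝ} (hG : ∀ k, 0 ≤ G k) (hE : ∀ k, 0 ≤ E k)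
    {ε T : ℝ} (hε : 0 < ε) {k a b : ℕ} (hab : a + b = k)
    (hT : T ^ 4 ≤ 16 * (G a * G (a + 1)) * (E b * E (b + 1)) * E (k + 1) ^ 2) :
    |T| ≤ ε * E (k + 1) + 16 / ε ^ 3 * (G 0 * G 1 * E k) + 1 / ε * lowerOrder G E k := by
  have hL := lowerOrder_nonneg hG hE k
  cases a with
  | zero =>
    obtain rfl : b = k := by omega
    have := le_add_div_of_pow_four_le' hε (hE (b + 1))
      (mul_nonneg (mul_nonneg (hG 0) (hG 1)) (hE b)) (hT.trans_eq (by ring))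
    have : 0 ≤ 1 / ε * lowerOrder G E b := by positivity
    linarith
  | succ a =>
    have hx := mul_nonneg (hG (a + 1)) (hE (b + 1))
    have hy := mul_nonneg (hG (a + 2)) (hE b)
    have h1 := le_add_div_of_pow_four_le (P := G (a + 1) * E (b + 1) + G (a + 2) * E b)
      hε (hE (k + 1)) (add_nonneg hx hy) (hT.trans (by
        have : (G (a + 1) * E (b + 1)) * (G (a + 2) * E b)
          ≤ (G (a + 1) * E (b + 1) + G (a + 2) * E b) ^ 2 := by nlinarith
        have := mul_le_mul_of_nonneg_right this (sq_nonneg (E (k + 1)))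
        linarith))
    have h2 := Finset.single_le_sum
      (f := fun i => G (i + 1) * E (k - i) + G (i + 2) * E (k - 1 - i)) (s := Finset.range k)
      (fun i _ => add_nonneg (mul_nonneg (hG _) (hE _)) (mul_nonneg (hG _) (hE _)))
      (Finset.mem_range.2 (by omega : a < k))
    simp only [show k - a = b + 1 by omega, show k - 1 - a = b by omega] at h2
    have h3 : 1 / ε * (G (a + 1) * E (b + 1) + G (a + 2) * E b) ≤ 1 / ε * lowerOrder G E k :=
      mul_le_mul_of_nonneg_left h2 (by positivity)
    have h4 : 0 ≤ 16 / ε ^ 3 * (G 0 * G 1 * E k) := by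
      have := mul_nonneg (mul_nonneg (hG 0) (hG 1)) (hE k)
      positivity
    linarith

/-- Energy inequality for the difference of two solutions. -/
theorem energy_estimate_sub {σ : ℝ} (hσ : 0 < σ) (k : ℕ) : ∃ K : ℝ, 0 ≤ K ∧
    ∀ ν η : ℝ, σ ≤ ν → σ ≤ η → ∀ (p : (Fin 2 → ℝ) → ℝ)
      (X Y Z : Bool → Fin 2 → (Fin 2 → ℝ) → ℝ) (G : ℕ → ℝ), SmoothPer p →
      Solenoidal X → Solenoidal Y → Solenoidal Z →
      (∀ j, energy j X ≤ G j) → (∀ j, energy j Z ≤ G j) →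
      2 * ∑ q : Bool × Fin 2,
        pairing k (elsasserRhs ν η p Y (fun s i x => conv (X (!s)) (Y s i) x
          + conv (Y (!s)) (Z s i) x) q.1 q.2) (Y q.1 q.2)
      + 2 * σ * energy k Y + σ / 2 * energy (k + 1) Y
      ≤ K * (G 0 * G 1 * energy k Y + lowerOrder G (fun j => energy j Y) k) := by
  set ε := σ / (128 * 4 ^ k) with hε
  have hε0 : 0 < ε := by positivity
  refine ⟨64 * 4 ^ k * (16 / ε ^ 3 + 1 / ε), by positivity, ?_⟩
  intro ν η hν hη p X Y Z G hp hX hY hZ hXG hZG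
  have hc1 := fun s i => SmoothPer.conv (hX.smooth (!s)) (hY.smooth s i)
  have hc2 := fun s i => SmoothPer.conv (hY.smooth (!s)) (hZ.smooth s i)
  have h1 := pairing_elsasserRhs_le hν hη hp (G := fun s i x => conv (X (!s)) (Y s i) x
          + conv (Y (!s)) (Z s i) x)
    (fun s i => (hc1 s i).add (hc2 s i)) hY k
  have h2 := mul_le_mul_of_nonneg_left (energy_le_succ hY k) hσ.le
  have E0 := fun k => energy_nonneg k Y
  have G0 := fun k => (energy_nonneg k X).trans (hXG k)
  have hL := lowerOrder_nonneg G0 E0 k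
  have hP := mul_nonneg (mul_nonneg (G0 0) (G0 1)) (E0 k)
  set L := lowerOrder G (fun j => energy j Y) k with hLd
  set B := ε * energy (k + 1) Y + 16 / ε ^ 3 * (G 0 * G 1 * energy k Y) + 1 / ε * L with hB
  have hB0 : 0 ≤ B := by have := E0 (k + 1); positivity
  have four : (4 : ℝ) ^ k = 2 ^ k * 2 ^ k := by rw [← mul_pow]; norm_num
  have hN : ∀ q : Bool × Fin 2, 8 * |pairing k (fun x => conv (X (!q.1)) (Y q.1 q.2) x
      + conv (Y (!q.1)) (Z q.1 q.2) x) (Y q.1 q.2)| ≤ 64 * 4 ^ k * B := by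
    intro q
    rw [pairing_add k (hc1 _ _) (hc2 _ _) (hY.smooth _ _)]
    have b1 := abs_pairing_conv_le k (hX.smooth (!q.1)) (hX.div (!q.1)) (hY.smooth q.1 q.2)
      (hY.smooth q.1 q.2) hB0 fun j a b c hab hc => by
        have hpow := trilinear_energy_bound hX hY hY a b (j :: c) (!q.1) q.1 q.1 j q.2 q.2
        refine abs_le_of_pow_four_le_lowerOrder G0 E0 hε0 hab (hpow.trans ?_)
        have := mul_le_mul (hXG a.length) (hXG (a.length + 1)) (energy_nonneg _ _) (G0 _)
        have := mul_nonneg (E0 b.length) (E0 (b.length + 1))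
        rw [List.length_cons, hc]
        gcongr
    have b2 := abs_pairing_conv_le k (hY.smooth (!q.1)) (hY.div (!q.1)) (hZ.smooth q.1 q.2)
      (hY.smooth q.1 q.2) hB0 fun j a b c hab hc => by
        have hpow := trilinear_energy_bound hY hZ hY a b (j :: c) (!q.1) q.1 q.1 j q.2 q.2
        refine abs_le_of_pow_four_le_lowerOrder G0 E0 hε0 ((add_comm _ _).trans hab)
          (hpow.trans ?_)
        have := mul_le_mul (hZG b.length) (hZG (b.length + 1)) (energy_nonneg _ _) (G0 _)
        have := mul_nonneg (E0 a.length) (E0 (a.length + 1))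
        rw [List.length_cons, hc, mul_right_comm (16 : ℝ)]
        gcongr
    have b3 := abs_add_le (pairing k (conv (X (!q.1)) (Y q.1 q.2)) (Y q.1 q.2))
      (pairing k (conv (Y (!q.1)) (Z q.1 q.2)) (Y q.1 q.2))
    rw [four]
    linarith
  have h3 := Finset.sum_le_sum fun q (_ : q ∈ Finset.univ) => hN q
  rw [← Finset.mul_sum, Finset.sum_const, Finset.card_univ, Fintype.card_prod,
    Fintype.card_bool, Fintype.card_fin, nsmul_eq_mul] at h3
  push_cast at h3
  have e1 : 64 * 4 ^ k * ε = σ / 2 := by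
    rw [hε]
    field_simp
    norm_num
  have e2 : 64 * 4 ^ k * B = σ / 2 * energy (k + 1) Y
      + 64 * 4 ^ k * (16 / ε ^ 3 * (G 0 * G 1 * energy k Y) + 1 / ε * L) := by
    rw [hB, ← e1]
    ring
  have e3 : 16 / ε ^ 3 * (G 0 * G 1 * energy k Y) + 1 / ε * L
      ≤ (16 / ε ^ 3 + 1 / ε) * (G 0 * G 1 * energy k Y + L) := by
    have : 0 ≤ 16 / ε ^ 3 * L := by positivity
    have : 0 ≤ 1 / ε * (G 0 * G 1 * energy k Y) := by positivity
    linarith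
  have e4 := mul_le_mul_of_nonneg_left e3 (by positivity : (0 : ℝ) ≤ 64 * 4 ^ k)
  linarith

end Nonlinear

section Gronwall

/-- Grönwall's inequality with a dissipative term and a source. -/
theorem gronwall_dissipative {y y' z g F : ℝ → ℝ} (hy : Continuous y) (hz : Continuous z)
    (hg : Continuous g) (hF : Continuous F) (hz0 : ∀ t, 0 ≤ z t) (hg0 : ∀ t, 0 ≤ g t)
    (hF0 : ∀ t, 0 ≤ F t) (hd : ∀ t, 0 < t → HasDerivAt y (y' t) t)
    (hle : ∀ t, 0 < t → y' t + z t ≤ g t * y t + F t) {T : ℝ} (hT : 0 ≤ T) :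
    y T + ∫ s in (0 : ℝ)..T, z s
      ≤ exp (∫ s in (0 : ℝ)..T, g s) * (y 0 + ∫ s in (0 : ℝ)..T, F s) := by
  set I : ℝ → ℝ := fun t => ∫ s in (0 : ℝ)..t, g s with hI
  have dI : ∀ t, HasDerivAt I (g t) t := fun t => hg.integral_hasStrictDerivAt 0 t |>.hasDerivAt
  have cI : Continuous I := continuous_iff_continuousAt.2 fun t => (dI t).continuousAt
  have I0 : I 0 = 0 := by simp [hI]
  have hmono : ∀ s ∈ Icc 0 T, 0 ≤ I s ∧ I s ≤ I T := by
    intro s hs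
    have hm : Monotone I := monotone_of_deriv_nonneg (fun t => (dI t).differentiableAt)
      fun t => by rw [(dI t).deriv]; exact hg0 t
    exact ⟨I0 ▸ hm hs.1, hm hs.2⟩
  have cq : Continuous fun t => exp (-I t) * (z t - F t) := by fun_prop
  set Φ : ℝ → ℝ := fun t => exp (-I t) * y t
    + ∫ s in (0 : ℝ)..t, exp (-I s) * (z s - F s) with hΦ
  have dq : ∀ t, HasDerivAt (fun t => ∫ s in (0 : ℝ)..t, exp (-I s) * (z s - F s))
      (exp (-I t) * (z t - F t)) t := fun t => (cq.integral_hasStrictDerivAt 0 t).hasDerivAt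
  have dΦ : ∀ t, 0 < t → HasDerivAt Φ
      (exp (-I t) * -(g t) * y t + exp (-I t) * y' t + exp (-I t) * (z t - F t)) t :=
    fun t ht => (((dI t).neg.exp).mul (hd t ht)).add (dq t)
  have cΦ : Continuous Φ := by
    have : Continuous fun t => ∫ s in (0 : ℝ)..t, exp (-I s) * (z s - F s) :=
      continuous_iff_continuousAt.2 fun t => (dq t).continuousAt
    fun_prop
  have hanti : AntitoneOn Φ (Ici 0) := by
    refine antitoneOn_of_deriv_nonpos (convex_Ici 0) cΦ.continuousOn ?_ ?_
    · intro t ht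
      rw [interior_Ici] at ht
      exact (dΦ t ht).differentiableAt.differentiableWithinAt
    · intro t ht
      rw [interior_Ici] at ht
      rw [(dΦ t ht).deriv]
      have := mul_nonneg (exp_pos (-I t)).le (sub_nonneg.2 (hle t ht))
      linarith
  have hfin := hanti (mem_Ici.2 le_rfl) (mem_Ici.2 hT) hT
  simp only [hΦ, I0, neg_zero, exp_zero, one_mul, intervalIntegral.integral_same, add_zero] at hfin
  have ci : ∀ {f : ℝ → ℝ}, Continuous f → IntervalIntegrable f volume 0 T :=
    fun hf => hf.intervalIntegrable 0 T
  have split : (∫ s in (0 : ℝ)..T, exp (-I s) * (z s - F s))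
      = (∫ s in (0 : ℝ)..T, exp (-I s) * z s) - ∫ s in (0 : ℝ)..T, exp (-I s) * F s := by
    rw [← intervalIntegral.integral_sub (ci (by fun_prop)) (ci (by fun_prop))]
    simp only [mul_sub]
  have hzl : exp (-I T) * (∫ s in (0 : ℝ)..T, z s) ≤ ∫ s in (0 : ℝ)..T, exp (-I s) * z s := by
    rw [← intervalIntegral.integral_const_mul]
    refine intervalIntegral.integral_mono_on hT (ci (by fun_prop)) (ci (by fun_prop)) fun s hs => ?_
    exact mul_le_mul_of_nonneg_right (exp_le_exp.2 (neg_le_neg (hmono s hs).2)) (hz0 s)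
  have hFl : (∫ s in (0 : ℝ)..T, exp (-I s) * F s) ≤ ∫ s in (0 : ℝ)..T, F s := by
    refine intervalIntegral.integral_mono_on hT (ci (by fun_prop)) (ci (by fun_prop)) fun s hs => ?_
    exact mul_le_of_le_one_left (hF0 s) (exp_le_one_iff.2 (neg_nonpos.2 (hmono s hs).1))
  have hmain : exp (-I T) * (y T + ∫ s in (0 : ℝ)..T, z s) ≤ y 0 + ∫ s in (0 : ℝ)..T, F s := by
    rw [split] at hfin
    linarith
  have := mul_le_mul_of_nonneg_left hmain (exp_pos (I T)).le
  rwa [← mul_assoc, ← exp_add, add_neg_cancel, exp_zero, one_mul] at this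

/-- Energy inequalities of exponentially weighted type, integrated in time. -/
theorem gronwall_weighted {σ : ℝ} (hσ : 0 < σ) {e e' z g F : ℝ → ℝ} (he : Continuous e)
    (hz : Continuous z) (hg : Continuous g) (hF : Continuous F) (hz0 : ∀ t, 0 ≤ z t)
    (hg0 : ∀ t, 0 ≤ g t) (hF0 : ∀ t, 0 ≤ F t) (hd : ∀ t, 0 < t → HasDerivAt e (e' t) t)
    (hle : ∀ t, 0 < t → e' t + 2 * σ * e t + σ / 2 * z t ≤ g t * e t + F t) {T : ℝ} (hT : 0 ≤ T) :
    exp (2 * σ * T) * e T + σ / 2 * ∫ s in (0 : ℝ)..T, exp (2 * σ * s) * z s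
      ≤ exp (∫ s in (0 : ℝ)..T, g s) * (e 0 + ∫ s in (0 : ℝ)..T, exp (2 * σ * s) * F s) := by
  have dexp : ∀ t, HasDerivAt (fun t => exp (2 * σ * t)) (exp (2 * σ * t) * (2 * σ)) t := fun t => by
    simpa using ((hasDerivAt_id t).const_mul (2 * σ)).exp
  have h := gronwall_dissipative (y := fun t => exp (2 * σ * t) * e t)
    (z := fun t => σ / 2 * (exp (2 * σ * t) * z t)) (g := g)
    (F := fun t => exp (2 * σ * t) * F t) (by fun_prop) (by fun_prop) hg (by fun_prop)
    (fun t => by have := hz0 t; positivity) hg0 (fun t => by have := hF0 t; positivity)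
    (fun t ht => (dexp t).mul (hd t ht)) (fun t ht => by
      have := mul_le_mul_of_nonneg_left (hle t ht) (exp_pos (2 * σ * t)).le
      linarith) hT
  simpa [intervalIntegral.integral_const_mul] using h

theorem integral_le_weighted {σ : ℝ} (hσ : 0 < σ) {z : ℝ → ℝ} (hz : Continuous z)
    (hz0 : ∀ t, 0 ≤ z t) {T : ℝ} (hT : 0 ≤ T) :
    ∫ s in (0 : ℝ)..T, z s ≤ ∫ s in (0 : ℝ)..T, exp (2 * σ * s) * z s := by
  refine intervalIntegral.integral_mono_on hT (hz.intervalIntegrable _ _)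
    (Continuous.intervalIntegrable (by fun_prop) _ _) fun s hs => ?_
  refine le_mul_of_one_le_left (hz0 s) (one_le_exp ?_)
  have := hs.1
  positivity

/-- Decay of all Sobolev energies of a single solution. -/
theorem energy_decay_self {σ : ℝ} (hσ : 0 < σ) {E D : ℕ → ℝ → ℝ} (hc : ∀ k, Continuous (E k))
    (h0 : ∀ k t, 0 ≤ E k t) (hd : ∀ k t, 0 < t → HasDerivAt (E k) (D k t) t)
    (hle : ∀ k t, 0 < t → D k t + 2 * σ * E k t + σ / 2 * E (k + 1) t
      ≤ if k = 0 then 0 else 512 * 16 ^ k / σ * (E 1 t * E k t))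
    (k : ℕ) {T : ℝ} (hT : 0 ≤ T) :
    exp (2 * σ * T) * E k T + σ / 2 * ∫ s in (0 : ℝ)..T, exp (2 * σ * s) * E (k + 1) s
      ≤ exp (1024 * 16 ^ k / σ ^ 2 * E 0 0) * E k 0 := by
  have zero : exp (2 * σ * T) * E 0 T + σ / 2 * ∫ s in (0 : ℝ)..T, exp (2 * σ * s) * E 1 s
      ≤ E 0 0 := by
    have h := gronwall_weighted hσ (hc 0) (hc 1) (g := fun _ => 0) (F := fun _ => 0)
      continuous_const continuous_const (h0 1) (fun _ => le_rfl) (fun _ => le_rfl) (hd 0)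
      (fun t ht => by simpa using hle 0 t ht) hT
    simpa using h
  have hE1 : ∫ s in (0 : ℝ)..T, E 1 s ≤ 2 / σ * E 0 0 := by
    have h1 := integral_le_weighted hσ (hc 1) (h0 1) hT
    have h2 : 0 ≤ exp (2 * σ * T) * E 0 T := mul_nonneg (exp_pos _).le (h0 0 T)
    have h3 : σ / 2 * ∫ s in (0 : ℝ)..T, exp (2 * σ * s) * E 1 s ≤ E 0 0 := by linarith
    have h4 := mul_le_mul_of_nonneg_left h3 (by positivity : 0 ≤ 2 / σ)
    rw [← mul_assoc, show 2 / σ * (σ / 2) = 1 by field_simp, one_mul] at h4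
    exact h1.trans h4
  rcases Nat.eq_zero_or_pos k with rfl | hk
  · refine zero.trans (le_mul_of_one_le_left (h0 0 0) (one_le_exp ?_))
    have := h0 0 0
    positivity
  · have h := gronwall_weighted hσ (hc k) (hc (k + 1))
      (g := fun t => 512 * 16 ^ k / σ * E 1 t) (F := fun _ => 0)
      (by have := hc 1; fun_prop) continuous_const (h0 (k + 1))
      (fun t => by have := h0 1 t; positivity) (fun _ => le_rfl) (hd k)
      (fun t ht => by
        have := hle k t ht
        rw [if_neg hk.ne'] at this
        linarith) hT
    refine h.trans ?_
    simp only [mul_zero, intervalIntegral.integral_zero, add_zero,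
      intervalIntegral.integral_const_mul]
    refine mul_le_mul_of_nonneg_right (exp_le_exp.2 ?_) (h0 k 0)
    calc _ ≤ 512 * 16 ^ k / σ * (2 / σ * E 0 0) := by gcongr
      _ = _ := by ring

/-- Decay of all Sobolev energies of the difference of two solutions. -/
theorem energy_decay_sub {σ A : ℝ} (hσ : 0 < σ) (hA : 0 ≤ A) (κ : ℕ → ℝ) (hκ : ∀ k, 0 ≤ κ k)
    (r : ℕ) : ∃ K : ℝ, 0 ≤ K ∧ ∀ (n d : ℝ) (G E D : ℕ → ℝ → ℝ), 1 ≤ n → 0 ≤ d →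
      (∀ k, Continuous (G k)) → (∀ k, Continuous (E k)) → (∀ k t, 0 ≤ G k t) →
      (∀ k t, 0 ≤ E k t) → (∀ k t, 0 < t → HasDerivAt (E k) (D k t) t) →
      (∀ k t, 0 < t → D k t + 2 * σ * E k t + σ / 2 * E (k + 1) t
        ≤ κ k * (G 0 t * G 1 t * E k t + lowerOrder (fun j => G j t) (fun j => E j t) k)) →
      (∀ j < r, ∀ t, 0 ≤ t → G j t ≤ A * n ^ j) →
      (∀ j < r, ∀ T, 0 ≤ T → ∫ s in (0 : ℝ)..T, G (j + 1) s ≤ A * n ^ j) →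
      (∀ j < r, E j 0 ≤ A * d) →
      ∀ j < r, ∀ T, 0 ≤ T →
        exp (2 * σ * T) * E j T + σ / 2 * ∫ s in (0 : ℝ)..T, exp (2 * σ * s) * E (j + 1) s
          ≤ K * d * n ^ j := by
  induction r with
  | zero => exact ⟨0, le_rfl, fun _ _ _ _ _ _ _ _ _ _ _ _ _ _ _ _ j hj => by omega⟩
  | succ k ih =>
    obtain ⟨K, hK, ih⟩ := ih
    refine ⟨max K (exp (κ k * (A * A)) * (A + κ k * (k * ((2 / σ + 1) * (A * K))))),
      hK.trans (le_max_left _ _), ?_⟩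
    intro n d G E D hn hd0 cG cE hG hE hd hle hGs hGi hE0 j hj T hT
    have ih := ih n d G E D hn hd0 cG cE hG hE hd hle (fun j hj => hGs j (by omega))
      (fun j hj => hGi j (by omega)) fun j hj => hE0 j (by omega)
    have hn0 : 0 ≤ n := by linarith
    rcases (Nat.lt_succ_iff.1 hj).lt_or_eq with hjk | rfl
    · refine (ih j hjk T hT).trans ?_
      have := le_max_left K (exp (κ k * (A * A)) * (A + κ k * (k * ((2 / σ + 1) * (A * K)))))
      gcongr
    · have cL : Continuous fun t => lowerOrder (fun i => G i t) (fun i => E i t) j := by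
        simp only [lowerOrder]
        fun_prop
      have hL := fun t => lowerOrder_nonneg (fun i => hG i t) (fun i => hE i t) j
      have h := gronwall_weighted hσ (cE j) (cE (j + 1)) (g := fun t => κ j * (G 0 t * G 1 t))
        (F := fun t => κ j * lowerOrder (fun i => G i t) (fun i => E i t) j)
        (by fun_prop) (by fun_prop) (hE (j + 1))
        (fun t => mul_nonneg (hκ j) (mul_nonneg (hG 0 t) (hG 1 t)))
        (fun t => mul_nonneg (hκ j) (hL t)) (hd j)
        (fun t ht => (hle j t ht).trans_eq (by ring)) hT
      have ci : ∀ {f : ℝ → ℝ}, Continuous f → IntervalIntegrable f volume 0 T :=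
        fun hf => hf.intervalIntegrable 0 T
      have hg : ∫ s in (0 : ℝ)..T, κ j * (G 0 s * G 1 s) ≤ κ j * (A * A) := by
        rw [intervalIntegral.integral_const_mul]
        refine mul_le_mul_of_nonneg_left ?_ (hκ j)
        calc _ ≤ ∫ s in (0 : ℝ)..T, A * G 1 s :=
              intervalIntegral.integral_mono_on hT (ci (by fun_prop)) (ci (by fun_prop))
                fun s hs => mul_le_mul_of_nonneg_right
                  (by simpa using hGs 0 (by omega) s hs.1) (hG 1 s)
          _ ≤ A * A := by
              rw [intervalIntegral.integral_const_mul]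
              exact mul_le_mul_of_nonneg_left (by simpa using hGi 0 (by omega) T hT) hA
      have h1 : ∀ i ∈ Finset.range j,
          ∫ s in (0 : ℝ)..T, exp (2 * σ * s) * (G (i + 1) s * E (j - i) s
            + G (i + 2) s * E (j - 1 - i) s) ≤ (2 / σ + 1) * (A * K) * (d * n ^ j) := by
        intro i hi
        have hi := Finset.mem_range.1 hi
        obtain ⟨l, rfl⟩ : ∃ l, j = i + 1 + l := Nat.exists_eq_add_of_le (by omega)
        rw [show i + 1 + l - i = l + 1 by omega, show i + 1 + l - 1 - i = l by omega]
        have a1 : ∫ s in (0 : ℝ)..T, exp (2 * σ * s) * E (l + 1) s ≤ 2 / σ * (K * d * n ^ l) := by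
          have b1 := ih l (by omega) T hT
          have b2 : 0 ≤ exp (2 * σ * T) * E l T := mul_nonneg (exp_pos _).le (hE l T)
          have b3 : σ / 2 * ∫ s in (0 : ℝ)..T, exp (2 * σ * s) * E (l + 1) s ≤ K * d * n ^ l := by
            linarith
          have b4 := mul_le_mul_of_nonneg_left b3 (by positivity : 0 ≤ 2 / σ)
          rwa [← mul_assoc, show 2 / σ * (σ / 2) = 1 by field_simp, one_mul] at b4
        have a2 : ∀ s ∈ Icc 0 T, exp (2 * σ * s) * E l s ≤ K * d * n ^ l := by
          intro s hs
          have b1 := ih l (by omega) s hs.1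
          have b2 : 0 ≤ ∫ s in (0 : ℝ)..s, exp (2 * σ * s) * E (l + 1) s :=
            intervalIntegral.integral_nonneg hs.1 fun t _ =>
              mul_nonneg (exp_pos _).le (hE (l + 1) t)
          have b3 : 0 ≤ σ / 2 * ∫ s in (0 : ℝ)..s, exp (2 * σ * s) * E (l + 1) s := by positivity
          linarith
        calc _ ≤ ∫ s in (0 : ℝ)..T, (A * n ^ (i + 1) * (exp (2 * σ * s) * E (l + 1) s)
              + K * d * n ^ l * G (i + 2) s) := by
              refine intervalIntegral.integral_mono_on hT (ci (by fun_prop)) (ci (by fun_prop))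
                fun s hs => ?_
              have c1 := mul_le_mul_of_nonneg_right (hGs (i + 1) (by omega) s hs.1)
                (mul_nonneg (exp_pos (2 * σ * s)).le (hE (l + 1) s))
              have c2 := mul_le_mul_of_nonneg_right (a2 s hs) (hG (i + 2) s)
              linarith
          _ ≤ A * n ^ (i + 1) * (2 / σ * (K * d * n ^ l))
              + K * d * n ^ l * (A * n ^ (i + 1)) := by
              rw [intervalIntegral.integral_add (ci (by fun_prop)) (ci (by fun_prop)),
                intervalIntegral.integral_const_mul, intervalIntegral.integral_const_mul]
              have := hGi (i + 1) (by omega) T hT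
              gcongr
          _ = _ := by
              rw [pow_add n (i + 1) l]
              ring
      have hFi : ∫ s in (0 : ℝ)..T, exp (2 * σ * s)
          * (κ j * lowerOrder (fun i => G i s) (fun i => E i s) j)
          ≤ κ j * (j * ((2 / σ + 1) * (A * K))) * (d * n ^ j) := by
        have e : ∀ s, exp (2 * σ * s) * (κ j * lowerOrder (fun i => G i s) (fun i => E i s) j)
            = κ j * ∑ i ∈ Finset.range j, exp (2 * σ * s) * (G (i + 1) s * E (j - i) s
            + G (i + 2) s * E (j - 1 - i) s) := by
          intro s
          rw [← Finset.mul_sum, lowerOrder]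
          ring
        simp only [e]
        rw [intervalIntegral.integral_const_mul,
          intervalIntegral.integral_finsetSum fun i _ => ci (by fun_prop)]
        have := mul_le_mul_of_nonneg_left (Finset.sum_le_sum h1) (hκ j)
        rw [Finset.sum_const, Finset.card_range, nsmul_eq_mul] at this
        linarith
      have hAd : E j 0 ≤ A * (d * n ^ j) := by
        refine (hE0 j (by omega)).trans (mul_le_mul_of_nonneg_left ?_ hA)
        exact le_mul_of_one_le_right hd0 (one_le_pow₀ hn)
      have hlow := hκ j
      calc _ ≤ _ := h
        _ ≤ exp (κ j * (A * A)) * (A * (d * n ^ j)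
            + κ j * (j * ((2 / σ + 1) * (A * K))) * (d * n ^ j)) := by
            gcongr
            have : 0 ≤ ∫ s in (0 : ℝ)..T, exp (2 * σ * s)
                * (κ j * lowerOrder (fun i => G i s) (fun i => E i s) j) :=
              intervalIntegral.integral_nonneg hT fun t _ =>
                mul_nonneg (exp_pos _).le (mul_nonneg (hκ j) (hL t))
            exact add_nonneg (hE j 0) this
        _ = exp (κ j * (A * A)) * (A + κ j * (j * ((2 / σ + 1) * (A * K)))) * d * n ^ j := by ring
        _ ≤ _ := by
            have := le_max_right K
              (exp (κ j * (A * A)) * (A + κ j * (j * ((2 / σ + 1) * (A * K)))))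
            gcongr

end Gronwall

/-- Smoothness in space-time of a scalar function, up to the initial time. -/
def EvolSmooth (f : ℝ → (Fin 2 → ℝ) → ℝ) : Prop :=
  ContDiffOn ℝ (⊤ : ℕ∞) (fun p : ℝ × (Fin 2 → ℝ) => f p.1 p.2) (Ici 0 ×ˢ univ)

/-- The time derivative. -/
def dt (f : ℝ → (Fin 2 → ℝ) → ℝ) (t : ℝ) (x : Fin 2 → ℝ) : ℝ := deriv (fun s => f s x) t

section Evolution

variable {f g : ℝ → (Fin 2 → ℝ) → ℝ}

theorem EvolSmooth.add (hf : EvolSmooth f) (hg : EvolSmooth g) :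
    EvolSmooth fun t x => f t x + g t x := ContDiffOn.add hf hg

theorem EvolSmooth.sub (hf : EvolSmooth f) (hg : EvolSmooth g) :
    EvolSmooth fun t x => f t x - g t x := ContDiffOn.sub hf hg

theorem EvolSmooth.mul (hf : EvolSmooth f) (hg : EvolSmooth g) :
    EvolSmooth fun t x => f t x * g t x := ContDiffOn.mul hf hg

theorem EvolSmooth.slice (hf : EvolSmooth f) {t : ℝ} (ht : 0 ≤ t) :
    ContDiff ℝ (⊤ : ℕ∞) (f t) := by
  rw [← contDiffOn_univ]
  exact ContDiffOn.comp (g := fun p : ℝ × (Fin 2 → ℝ) => f p.1 p.2) hf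
    (f := fun x => (t, x)) (contDiff_prodMk_right t).contDiffOn fun x _ => ⟨ht, mem_univ x⟩

theorem EvolSmooth.pd_eq (hf : EvolSmooth f) (i : Fin 2) {t : ℝ} (ht : 0 ≤ t) (x : Fin 2 → ℝ) :
    pd i (f t) x = fderivWithin ℝ (fun p : ℝ × (Fin 2 → ℝ) => f p.1 p.2) (Ici 0 ×ˢ univ) (t, x)
      (0, Pi.single i 1) := by
  have h1 : HasFDerivWithinAt (fun p : ℝ × (Fin 2 → ℝ) => f p.1 p.2) _ (Ici 0 ×ˢ univ) (t, x) :=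
    ((hf.differentiableOn (by simp)) (t, x) ⟨ht, mem_univ x⟩).hasFDerivWithinAt
  have h2 := h1.comp x (hasFDerivAt_prodMk_right t x).hasFDerivWithinAt
    (s := univ) fun y _ => ⟨ht, mem_univ y⟩
  rw [hasFDerivWithinAt_univ] at h2
  have h3 : fderiv ℝ (f t) x = _ := h2.fderiv
  rw [pd, h3]
  rfl

theorem EvolSmooth.pd (hf : EvolSmooth f) (i : Fin 2) : EvolSmooth fun t => pd i (f t) := by
  have hU : UniqueDiffOn ℝ (Ici (0 : ℝ) ×ˢ (univ : Set (Fin 2 → ℝ))) :=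
    (uniqueDiffOn_Ici 0).prod uniqueDiffOn_univ
  refine ContDiffOn.congr (f := fun p => fderivWithin ℝ (fun p : ℝ × (Fin 2 → ℝ) => f p.1 p.2)
    (Ici 0 ×ˢ univ) p (0, Pi.single i 1)) ?_ fun p hp => hf.pd_eq i hp.1 p.2
  exact (ContDiffOn.fderivWithin (m := (⊤ : ℕ∞)) hf hU (by simp)).clm_apply contDiffOn_const

theorem EvolSmooth.pdList (hf : EvolSmooth f) (l : List (Fin 2)) :
    EvolSmooth fun t => pdList l (f t) := by
  induction l with
  | nil => exact hf
  | cons i l ih => exact ih.pd i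

theorem EvolSmooth.continuous_avg (hf : EvolSmooth f) :
    Continuous fun t => avg (f (max t 0)) := by
  refine continuous_parametric_integral_of_continuous (f := fun t x => f (max t 0) x) ?_
    (isCompact_box 2 1)
  have h : ContinuousOn (fun p : ℝ × (Fin 2 → ℝ) => f p.1 p.2) (Ici 0 ×ˢ univ) :=
    ContDiffOn.continuousOn hf
  exact h.comp_continuous (f := fun p : ℝ × (Fin 2 → ℝ) => (max p.1 0, p.2)) (by fun_prop)
    fun p => ⟨mem_Ici.2 (le_max_right p.1 0), mem_univ _⟩

theorem EvolSmooth.contDiffAt (hf : EvolSmooth f) {t : ℝ} (ht : 0 < t) (x : Fin 2 → ℝ) :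
    ContDiffAt ℝ (⊤ : ℕ∞) (fun p : ℝ × (Fin 2 → ℝ) => f p.1 p.2) (t, x) :=
  ContDiffOn.contDiffAt hf (prod_mem_nhds (Ici_mem_nhds ht) Filter.univ_mem)

theorem EvolSmooth.hasDerivAt_fderiv (hf : EvolSmooth f) {t : ℝ} (ht : 0 < t) (x : Fin 2 → ℝ) :
    HasDerivAt (fun s => f s x) (fderiv ℝ (fun p : ℝ × (Fin 2 → ℝ) => f p.1 p.2) (t, x) (1, 0)) t := by
  have h1 := ((hf.contDiffAt ht x).differentiableAt (by simp)).hasFDerivAt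
  exact h1.comp_hasDerivAt t ((hasDerivAt_id t).prodMk (hasDerivAt_const t x))

theorem EvolSmooth.hasDerivAt (hf : EvolSmooth f) {t : ℝ} (ht : 0 < t) (x : Fin 2 → ℝ) :
    HasDerivAt (fun s => f s x) (dt f t x) t := by
  rw [dt, (hf.hasDerivAt_fderiv ht x).deriv]
  exact hf.hasDerivAt_fderiv ht x

theorem EvolSmooth.dt_eq (hf : EvolSmooth f) {t : ℝ} (ht : 0 < t) (x : Fin 2 → ℝ) :
    dt f t x = fderiv ℝ (fun p : ℝ × (Fin 2 → ℝ) => f p.1 p.2) (t, x) (1, 0) :=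
  (hf.hasDerivAt_fderiv ht x).deriv

theorem EvolSmooth.pd_eq_fderiv (hf : EvolSmooth f) (i : Fin 2) {t : ℝ} (ht : 0 < t)
    (x : Fin 2 → ℝ) : _root_.pd i (f t) x
      = fderiv ℝ (fun p : ℝ × (Fin 2 → ℝ) => f p.1 p.2) (t, x) (0, Pi.single i 1) := by
  rw [hf.pd_eq i ht.le, fderivWithin_of_mem_nhds (prod_mem_nhds (Ici_mem_nhds ht) Filter.univ_mem)]

theorem EvolSmooth.continuousOn_dt (hf : EvolSmooth f) :
    ContinuousOn (fun p : ℝ × (Fin 2 → ℝ) => dt f p.1 p.2) (Ioi 0 ×ˢ univ) := by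
  have h : ContDiffOn ℝ (⊤ : ℕ∞) (fun p : ℝ × (Fin 2 → ℝ) => f p.1 p.2) (Ioi 0 ×ˢ univ) :=
    ContDiffOn.mono hf (prod_mono Ioi_subset_Ici_self Subset.rfl)
  have h2 := h.continuousOn_fderiv_of_isOpen (isOpen_Ioi.prod isOpen_univ) (by simp)
  exact (h2.clm_apply continuousOn_const).congr fun p hp => hf.dt_eq hp.1 p.2

theorem EvolSmooth.dt_pd (hf : EvolSmooth f) (i : Fin 2) {t : ℝ} (ht : 0 < t) :
    dt (fun s => _root_.pd i (f s)) t = _root_.pd i (dt f t) := by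
  funext x
  set F := fun p : ℝ × (Fin 2 → ℝ) => f p.1 p.2 with hF
  have hc := hf.contDiffAt ht x
  have hd : DifferentiableAt ℝ (fderiv ℝ F) (t, x) :=
    (hc.fderiv_right (m := (⊤ : ℕ∞)) (by simp)).differentiableAt (by simp)
  have e1 : dt (fun s => _root_.pd i (f s)) t x
      = fderiv ℝ (fderiv ℝ F) (t, x) (1, 0) (0, Pi.single i 1) := by
    have h1 : (fun s => _root_.pd i (f s) x)
        =ᶠ[nhds t] fun s => fderiv ℝ F (s, x) (0, Pi.single i 1) := by
      filter_upwards [Ioi_mem_nhds ht] with s hs using hf.pd_eq_fderiv i hs x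
    rw [dt, h1.deriv_eq]
    have h2 := hd.hasFDerivAt.comp_hasDerivAt t ((hasDerivAt_id t).prodMk (hasDerivAt_const t x))
    exact (h2.clm_apply (hasDerivAt_const t ((0 : ℝ), (Pi.single i 1 : Fin 2 → ℝ)))).deriv.trans
      (by simp)
  have e2 : _root_.pd i (dt f t) x
      = fderiv ℝ (fderiv ℝ F) (t, x) (0, Pi.single i 1) (1, 0) := by
    have h1 : dt f t = fun y => fderiv ℝ F (t, y) (1, 0) := funext fun y => hf.dt_eq ht y
    rw [h1, _root_.pd]
    have h2 := hd.hasFDerivAt.comp x (hasFDerivAt_prodMk_right t x)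
    have h3 := h2.clm_apply (hasFDerivAt_const ((1 : ℝ), (0 : Fin 2 → ℝ)) x)
    have h4 := congrArg (fun L => L (Pi.single i 1)) h3.fderiv
    refine h4.trans ?_
    simp
  have hs : IsSymmSndFDerivAt ℝ F (t, x) := by
    have h2 : ((2 : ℕ∞) : WithTop ℕ∞) ≤ ((⊤ : ℕ∞) : WithTop ℕ∞) := WithTop.coe_le_coe.2 le_top
    exact hc.isSymmSndFDerivAt (by simpa using h2)
  rw [e1, e2, hs]

theorem EvolSmooth.dt_pdList (hf : EvolSmooth f) (l : List (Fin 2)) {t : ℝ} (ht : 0 < t) :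
    dt (fun s => _root_.pdList l (f s)) t = _root_.pdList l (dt f t) := by
  induction l with
  | nil => rfl
  | cons i l ih =>
    have := (hf.pdList l).dt_pd i ht
    rw [ih] at this
    exact this

theorem EvolSmooth.hasDerivAt_avg (hf : EvolSmooth f) {t : ℝ} (ht : 0 < t) :
    HasDerivAt (fun s => avg (f s)) (avg (dt f t)) t := by
  have hsub : Icc (t / 2) (2 * t) ⊆ Ioi 0 := fun s hs => lt_of_lt_of_le (by positivity) hs.1
  obtain ⟨M, hM⟩ := ((isCompact_Icc (a := t / 2) (b := 2 * t)).prod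
    (isCompact_box 2 1)).exists_bound_of_continuousOn
    (hf.continuousOn_dt.mono (prod_mono hsub (subset_univ _)))
  have cdt : Continuous (dt f t) := by
    have := hf.continuousOn_dt.comp_continuous (f := fun x : Fin 2 → ℝ => (t, x)) (by fun_prop)
      fun x => ⟨ht, mem_univ x⟩
    exact this
  refine (hasDerivAt_integral_of_dominated_loc_of_deriv_le (μ := volume.restrict (box 2 1))
    (F := f) (F' := dt f) (bound := fun _ => M)
    (Icc_mem_nhds (by linarith : t / 2 < t) (by linarith : t < 2 * t)) ?_ ?_ ?_ ?_ ?_ ?_).2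
  · filter_upwards [Ioi_mem_nhds ht] with s hs
    exact (hf.slice (le_of_lt hs)).continuous.aestronglyMeasurable
  · exact integrableOn_box (hf.slice ht.le).continuous
  · exact cdt.aestronglyMeasurable
  · exact (ae_restrict_mem (measurableSet_box 2 1)).mono fun x hx s hs => hM (s, x) ⟨hs, hx⟩
  · exact integrableOn_box continuous_const
  · exact Filter.Eventually.of_forall fun x s hs => hf.hasDerivAt (hsub hs) x

theorem EvolSmooth.hasDerivAt_sobSq (hf : EvolSmooth f) (k : ℕ) {t : ℝ} (ht : 0 < t) :
    HasDerivAt (fun s => sobSq k (f s)) (2 * pairing k (dt f t) (f t)) t := by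
  have h : ∀ w : Fin k → Fin 2, HasDerivAt
      (fun s => avg (fun x => _root_.pdList (List.ofFn w) (f s) x ^ 2))
      (2 * avg (fun x => _root_.pdList (List.ofFn w) (dt f t) x
        * _root_.pdList (List.ofFn w) (f t) x)) t := by
    intro w
    have hl := hf.pdList (List.ofFn w)
    have h1 := (hl.mul hl).hasDerivAt_avg ht
    have h2 : dt (fun s x => _root_.pdList (List.ofFn w) (f s) x
        * _root_.pdList (List.ofFn w) (f s) x) t
        = fun x => 2 * (_root_.pdList (List.ofFn w) (dt f t) x
          * _root_.pdList (List.ofFn w) (f t) x) := by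
      funext x
      have h3 := hl.hasDerivAt ht x
      rw [hf.dt_pdList _ ht] at h3
      rw [dt, (h3.fun_mul h3).deriv]
      ring
    rw [h2, avg_const_mul] at h1
    simpa only [sq] using h1
  simp only [sobSq, pairing, Finset.mul_sum]
  exact HasDerivAt.fun_sum fun w _ => h w

theorem EvolSmooth.continuous_sobSq (hf : EvolSmooth f) (k : ℕ) :
    Continuous fun t => sobSq k (f (max t 0)) := by
  simp only [sobSq]
  refine continuous_finsetSum _ fun w _ => ?_
  have := ((hf.pdList (List.ofFn w)).mul (hf.pdList (List.ofFn w))).continuous_avg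
  simpa only [sq] using this

end Evolution

/-- The Elsässer variables `u ± b`. -/
def elsasser (u b : ℝ → (Fin 2 → ℝ) → Fin 2 → ℝ) (t : ℝ) : Bool → Fin 2 → (Fin 2 → ℝ) → ℝ
  | true, i, x => u t x i + b t x i
  | false, i, x => u t x i - b t x i

/-- A global smooth solution of the MHD system in Elsässer variables, with zero average. -/
structure ElsasserFlow (ν η : ℝ) (Y : ℝ → Bool → Fin 2 → (Fin 2 → ℝ) → ℝ)
    (p : ℝ → (Fin 2 → ℝ) → ℝ) : Prop where
  evol : ∀ s i, EvolSmooth fun t => Y t s i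
  solenoidal : ∀ t, 0 ≤ t → Solenoidal (Y t)
  pressure : ∀ t, 0 ≤ t → SmoothPer (p t)
  eq : ∀ t, 0 < t → ∀ s i, dt (fun τ => Y τ s i) t
    = elsasserRhs ν η (p t) (Y t) (fun s i => conv (Y t (!s)) (Y t s i)) s i

section Elsasser

variable {ν η : ℝ} {u b : ℝ → (Fin 2 → ℝ) → Fin 2 → ℝ} {P : ℝ → (Fin 2 → ℝ) → ℝ}

theorem SmoothPer.elsasser {t : ℝ} (hu : ∀ i, SmoothPer fun x => u t x i)
    (hb : ∀ i, SmoothPer fun x => b t x i) (s : Bool) (i : Fin 2) :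
    SmoothPer (elsasser u b t s i) := by
  cases s
  · exact (hu i).sub (hb i)
  · exact (hu i).add (hb i)

theorem pd_sub (i : Fin 2) {f g : (Fin 2 → ℝ) → ℝ} (hf : SmoothPer f) (hg : SmoothPer g) :
    pd i (fun x => f x - g x) = fun x => pd i f x - pd i g x :=
  pdList_sub [i] hf hg

theorem lapl_add {f g : (Fin 2 → ℝ) → ℝ} (hf : SmoothPer f) (hg : SmoothPer g)
    (x : Fin 2 → ℝ) : lapl (fun x => f x + g x) x = lapl f x + lapl g x := by
  simp only [lapl, fun j => pd_add j hf hg, fun j => pd_add j (hf.pd j) (hg.pd j),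
    Finset.sum_add_distrib]

theorem lapl_sub {f g : (Fin 2 → ℝ) → ℝ} (hf : SmoothPer f) (hg : SmoothPer g)
    (x : Fin 2 → ℝ) : lapl (fun x => f x - g x) x = lapl f x - lapl g x := by
  simp only [lapl, fun j => pd_sub j hf hg, fun j => pd_sub j (hf.pd j) (hg.pd j),
    Finset.sum_sub_distrib]

theorem IsMHD.evolSmooth_u (h : IsMHD 2 1 ν η (Ici 0) u b P) (i : Fin 2) :
    EvolSmooth fun t x => u t x i := contDiffOn_pi.1 h.smooth_u i

theorem IsMHD.evolSmooth_b (h : IsMHD 2 1 ν η (Ici 0) u b P) (i : Fin 2) :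
    EvolSmooth fun t x => b t x i := contDiffOn_pi.1 h.smooth_b i

theorem IsMHD.smoothPer_u (h : IsMHD 2 1 ν η (Ici 0) u b P) {t : ℝ} (ht : 0 ≤ t) (i : Fin 2) :
    SmoothPer fun x => u t x i :=
  ⟨(h.evolSmooth_u i).slice ht, fun x j => congrFun (h.periodic_u t ht x j) i⟩

theorem IsMHD.smoothPer_b (h : IsMHD 2 1 ν η (Ici 0) u b P) {t : ℝ} (ht : 0 ≤ t) (i : Fin 2) :
    SmoothPer fun x => b t x i :=
  ⟨(h.evolSmooth_b i).slice ht, fun x j => congrFun (h.periodic_b t ht x j) i⟩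

theorem IsMHD.smoothPer_pressure (h : IsMHD 2 1 ν η (Ici 0) u b P) {t : ℝ} (ht : 0 ≤ t) :
    SmoothPer (P t) :=
  ⟨EvolSmooth.slice (f := P) h.smooth_P ht, h.periodic_P t ht⟩

theorem IsMHD.evolSmooth_elsasser (h : IsMHD 2 1 ν η (Ici 0) u b P) (s : Bool) (i : Fin 2) :
    EvolSmooth fun t => elsasser u b t s i := by
  cases s
  · exact (h.evolSmooth_u i).sub (h.evolSmooth_b i)
  · exact (h.evolSmooth_u i).add (h.evolSmooth_b i)

theorem IsMHD.smoothPer_elsasser (h : IsMHD 2 1 ν η (Ici 0) u b P) {t : ℝ} (ht : 0 ≤ t)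
    (s : Bool) (i : Fin 2) : SmoothPer (elsasser u b t s i) :=
  SmoothPer.elsasser (h.smoothPer_u ht) (h.smoothPer_b ht) s i

theorem IsMHD.div_elsasser (h : IsMHD 2 1 ν η (Ici 0) u b P) {t : ℝ} (ht : 0 ≤ t)
    (s : Bool) (x : Fin 2 → ℝ) : ∑ j, pd j (elsasser u b t s j) x = 0 := by
  have hu : ∑ j, pd j (fun y => u t y j) x = 0 := h.div_u t ht x
  have hb : ∑ j, pd j (fun y => b t y j) x = 0 := h.div_b t ht x
  cases s
  · have e : ∀ j, pd j (elsasser u b t false j) x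
        = pd j (fun y => u t y j) x - pd j (fun y => b t y j) x :=
      fun j => congrFun (pd_sub j (h.smoothPer_u ht j) (h.smoothPer_b ht j)) x
    simp only [e, Finset.sum_sub_distrib, hu, hb, sub_zero]
  · have e : ∀ j, pd j (elsasser u b t true j) x
        = pd j (fun y => u t y j) x + pd j (fun y => b t y j) x :=
      fun j => congrFun (pd_add j (h.smoothPer_u ht j) (h.smoothPer_b ht j)) x
    simp only [e, Finset.sum_add_distrib, hu, hb, add_zero]

theorem IsMHD.dt_elsasser (h : IsMHD 2 1 ν η (Ici 0) u b P) {t : ℝ} (ht : 0 < t)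
    (s : Bool) (i : Fin 2) : dt (fun τ => elsasser u b τ s i) t
      = elsasserRhs ν η (P t) (elsasser u b t)
        (fun s i => conv (elsasser u b t (!s)) (elsasser u b t s i)) s i := by
  funext x
  have su := h.smoothPer_u ht.le
  have sb := h.smoothPer_b ht.le
  have du := (h.evolSmooth_u i).hasDerivAt ht x
  have db := (h.evolSmooth_b i).hasDerivAt ht x
  have hm : dt (fun t x => u t x i) t x + conv (fun j x => u t x j) (fun y => u t y i) x
      + pd i (P t) x = ν * lapl (fun y => u t y i) x
        + conv (fun j x => b t x j) (fun y => b t y i) x := h.momentum t ht.le ht x i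
  have hi : dt (fun t x => b t x i) t x + conv (fun j x => u t x j) (fun y => b t y i) x
      = conv (fun j x => b t x j) (fun y => u t y i) x + η * lapl (fun y => b t y i) x :=
    h.induction_eq t ht.le ht x i
  have ep : ∀ j, pd j (elsasser u b t true i) x
      = pd j (fun y => u t y i) x + pd j (fun y => b t y i) x :=
    fun j => congrFun (pd_add j (su i) (sb i)) x
  have em : ∀ j, pd j (elsasser u b t false i) x
      = pd j (fun y => u t y i) x - pd j (fun y => b t y i) x :=
    fun j => congrFun (pd_sub j (su i) (sb i)) x
  have lp : lapl (elsasser u b t true i) x = lapl (fun y => u t y i) x + lapl (fun y => b t y i) x :=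
    lapl_add (su i) (sb i) x
  have lm : lapl (elsasser u b t false i) x
      = lapl (fun y => u t y i) x - lapl (fun y => b t y i) x :=
    lapl_sub (su i) (sb i) x
  simp only [conv, Fin.sum_univ_two] at hm hi
  cases s
  · have e : dt (fun τ => elsasser u b τ false i) t x
        = dt (fun t x => u t x i) t x - dt (fun t x => b t x i) t x := (du.fun_sub db).deriv
    rw [e, elsasserRhs]
    simp only [Bool.not_false, lp, lm, conv, em, Fin.sum_univ_two, elsasser]
    linarith
  · have e : dt (fun τ => elsasser u b τ true i) t x
        = dt (fun t x => u t x i) t x + dt (fun t x => b t x i) t x := (du.fun_add db).deriv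
    rw [e, elsasserRhs]
    simp only [Bool.not_true, lp, lm, conv, ep, Fin.sum_univ_two, elsasser]
    linarith

theorem IsMHD.avg_elsasser (h : IsMHD 2 1 ν η (Ici 0) u b P) (hu : ZeroAvg 1 (u 0))
    (hb : ZeroAvg 1 (b 0)) {t : ℝ} (ht : 0 ≤ t) (s : Bool) (i : Fin 2) :
    avg (elsasser u b t s i) = 0 := by
  have hE := h.evolSmooth_elsasser s i
  have h0 : avg (elsasser u b 0 s i) = 0 := by
    have cu := (h.smoothPer_u le_rfl i).cont
    have cb := (h.smoothPer_b le_rfl i).cont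
    have eu : avg (fun x => u 0 x i) = 0 := hu i
    have eb : avg (fun x => b 0 x i) = 0 := hb i
    cases s
    · exact (avg_sub cu cb).trans (by rw [eu, eb, sub_zero])
    · exact (avg_add cu cb).trans (by rw [eu, eb, add_zero])
  have hd : ∀ τ, 0 < τ → HasDerivAt (fun τ => avg (elsasser u b τ s i)) 0 τ := by
    intro τ hτ
    have h1 := hE.hasDerivAt_avg hτ
    have S := h.smoothPer_elsasser hτ.le
    have h2 : avg (dt (fun τ => elsasser u b τ s i) τ) = 0 := by
      rw [h.dt_elsasser hτ s i]
      have c1 := ((S s i).lapl.const_mul ((ν + η) / 2)).cont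
      have c2 := ((S (!s) i).lapl.const_mul ((ν - η) / 2)).cont
      have c3 := ((h.smoothPer_pressure hτ.le).pd i).cont
      have c4 := (SmoothPer.conv (S (!s)) (S s i)).cont
      refine (avg_sub ((c1.add c2).sub c3) c4).trans ?_
      rw [show avg (conv (elsasser u b τ (!s)) (elsasser u b τ s i)) = 0 from
        avg_conv (S (!s)) (h.div_elsasser hτ.le (!s)) (S s i), sub_zero]
      refine (avg_sub (c1.add c2) c3).trans ?_
      rw [avg_pd i (h.smoothPer_pressure hτ.le), sub_zero]
      refine (avg_add c1 c2).trans ?_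
      rw [avg_const_mul, avg_const_mul, avg_lapl (S s i), avg_lapl (S (!s) i)]
      ring
    rwa [h2] at h1
  have hc : Continuous fun τ => avg (elsasser u b (max τ 0) s i) := hE.continuous_avg
  rcases ht.eq_or_lt with rfl | ht
  · exact h0
  obtain ⟨c, hc1, hc2⟩ := exists_hasDerivAt_eq_slope
    (fun τ => avg (elsasser u b (max τ 0) s i)) (fun _ => 0) ht hc.continuousOn
    fun τ hτ => (hd τ hτ.1).congr_of_eventuallyEq (by
      filter_upwards [Ioi_mem_nhds hτ.1] with r hr
      rw [max_eq_left (le_of_lt hr)])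
  rw [sub_zero, eq_comm, div_eq_zero_iff, max_eq_left ht.le, max_self, h0, sub_zero] at hc2
  exact hc2.resolve_right ht.ne'

theorem IsMHD.elsasserFlow (h : IsMHD 2 1 ν η (Ici 0) u b P) (hu : ZeroAvg 1 (u 0))
    (hb : ZeroAvg 1 (b 0)) : ElsasserFlow ν η (elsasser u b) P where
  evol := h.evolSmooth_elsasser
  solenoidal _ ht := ⟨h.smoothPer_elsasser ht, h.avg_elsasser hu hb ht, h.div_elsasser ht⟩
  pressure _ ht := h.smoothPer_pressure ht
  eq _ ht := h.dt_elsasser ht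

theorem ElsasserFlow.dt_sub {Y Z : ℝ → Bool → Fin 2 → (Fin 2 → ℝ) → ℝ}
    {p q : ℝ → (Fin 2 → ℝ) → ℝ} (hY : ElsasserFlow ν η Y p) (hZ : ElsasserFlow ν η Z q)
    {t : ℝ} (ht : 0 < t) (s : Bool) (i : Fin 2) :
    dt (fun τ x => Y τ s i x - Z τ s i x) t
      = elsasserRhs ν η (fun x => p t x - q t x) (fun s i x => Y t s i x - Z t s i x)
        (fun s i x => conv (Y t (!s)) (fun x => Y t s i x - Z t s i x) x
          + conv (fun i x => Y t (!s) i x - Z t (!s) i x) (Z t s i) x) s i := by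
  funext x
  have sY := (hY.solenoidal t ht.le).smooth
  have sZ := (hZ.solenoidal t ht.le).smooth
  have e : dt (fun τ x => Y τ s i x - Z τ s i x) t x
      = dt (fun τ => Y τ s i) t x - dt (fun τ => Z τ s i) t x :=
    (((hY.evol s i).hasDerivAt ht x).fun_sub ((hZ.evol s i).hasDerivAt ht x)).deriv
  rw [e, hY.eq t ht, hZ.eq t ht]
  simp only [elsasserRhs, fun s => lapl_sub (sY s i) (sZ s i),
    pd_sub i (hY.pressure t ht.le) (hZ.pressure t ht.le), conv,
    fun j => pd_sub j (sY s i) (sZ s i), Fin.sum_univ_two]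
  ring

end Elsasser

section Stability

variable {σ ν η : ℝ} {Y Z : ℝ → Bool → Fin 2 → (Fin 2 → ℝ) → ℝ} {p q : ℝ → (Fin 2 → ℝ) → ℝ}

theorem continuous_energy (hY : ∀ s i, EvolSmooth fun t => Y t s i) (k : ℕ) :
    Continuous fun t => energy k (Y (max t 0)) :=
  continuous_finsetSum _ fun a _ => (hY a.1 a.2).continuous_sobSq k

theorem hasDerivAt_energy (hY : ∀ s i, EvolSmooth fun t => Y t s i) (k : ℕ) {t : ℝ} (ht : 0 < t) :
    HasDerivAt (fun t => energy k (Y (max t 0)))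
      (2 * ∑ a : Bool × Fin 2, pairing k (dt (fun τ => Y τ a.1 a.2) t) (Y t a.1 a.2)) t := by
  have h : HasDerivAt (fun t => energy k (Y t))
      (2 * ∑ a : Bool × Fin 2, pairing k (dt (fun τ => Y τ a.1 a.2) t) (Y t a.1 a.2)) t := by
    rw [Finset.mul_sum]
    exact HasDerivAt.fun_sum fun a _ => (hY a.1 a.2).hasDerivAt_sobSq k ht
  refine h.congr_of_eventuallyEq ?_
  filter_upwards [Ioi_mem_nhds ht] with τ hτ
  rw [max_eq_left (le_of_lt hτ)]

theorem energy_le_sub {X Y : Bool → Fin 2 → (Fin 2 → ℝ) → ℝ} (hX : Solenoidal X)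
    (hY : Solenoidal Y) (k : ℕ) :
    energy k X ≤ 2 * energy k (fun s i x => X s i x - Y s i x) + 2 * energy k Y := by
  simp only [energy, Finset.mul_sum, ← Finset.sum_add_distrib]
  refine Finset.sum_le_sum fun a _ => ?_
  have hs := (hX.smooth a.1 a.2).sub (hY.smooth a.1 a.2)
  have h1 := sobSq_add k hs (hY.smooth a.1 a.2)
  have h2 := sobSq_sub k hs (hY.smooth a.1 a.2)
  have h3 := sobSq_nonneg k (fun x => X a.1 a.2 x - Y a.1 a.2 x - Y a.1 a.2 x)
  simp only [sub_add_cancel] at h1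
  change sobSq k (X a.1 a.2) = _ at h1
  linarith

namespace ElsasserFlow

theorem energy_decay (hY : ElsasserFlow ν η Y p) (hσ : 0 < σ) (hν : σ ≤ ν) (hη : σ ≤ η) (k : ℕ)
    {T : ℝ} (hT : 0 ≤ T) :
    exp (2 * σ * T) * energy k (Y T)
      + σ / 2 * ∫ s in (0 : ℝ)..T, exp (2 * σ * s) * energy (k + 1) (Y (max s 0))
      ≤ exp (1024 * 16 ^ k / σ ^ 2 * energy 0 (Y 0)) * energy k (Y 0) := by
  have h := energy_decay_self hσ (E := fun k t => energy k (Y (max t 0)))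
    (continuous_energy hY.evol) (fun _ _ => energy_nonneg _ _)
    (fun k t ht => hasDerivAt_energy hY.evol k ht) (fun k t ht => by
      rw [max_eq_left ht.le]
      simp only [hY.eq t ht]
      exact energy_estimate_self hσ hν hη (hY.pressure t ht.le) (hY.solenoidal t ht.le) k) k hT
  simpa only [max_self, max_eq_left hT] using h

theorem exp_mul_energy_le (hY : ElsasserFlow ν η Y p) (hσ : 0 < σ) (hν : σ ≤ ν) (hη : σ ≤ η)
    (k : ℕ) {T : ℝ} (hT : 0 ≤ T) :
    exp (2 * σ * T) * energy k (Y T)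
      ≤ exp (1024 * 16 ^ k / σ ^ 2 * energy 0 (Y 0)) * energy k (Y 0) := by
  refine le_trans (le_add_of_nonneg_right ?_) (hY.energy_decay hσ hν hη k hT)
  exact mul_nonneg (by positivity) (intervalIntegral.integral_nonneg hT fun s _ =>
    mul_nonneg (exp_pos _).le (energy_nonneg _ _))

theorem energy_le (hY : ElsasserFlow ν η Y p) (hσ : 0 < σ) (hν : σ ≤ ν) (hη : σ ≤ η)
    (k : ℕ) {T : ℝ} (hT : 0 ≤ T) :
    energy k (Y T) ≤ exp (1024 * 16 ^ k / σ ^ 2 * energy 0 (Y 0)) * energy k (Y 0) :=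
  (le_mul_of_one_le_left (energy_nonneg _ _) (one_le_exp (by positivity))).trans
    (hY.exp_mul_energy_le hσ hν hη k hT)

theorem integral_energy_le (hY : ElsasserFlow ν η Y p) (hσ : 0 < σ) (hν : σ ≤ ν) (hη : σ ≤ η)
    (k : ℕ) {T : ℝ} (hT : 0 ≤ T) :
    ∫ s in (0 : ℝ)..T, energy (k + 1) (Y (max s 0))
      ≤ 2 / σ * (exp (1024 * 16 ^ k / σ ^ 2 * energy 0 (Y 0)) * energy k (Y 0)) := by
  have h1 := integral_le_weighted hσ (continuous_energy hY.evol (k + 1))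
    (fun _ => energy_nonneg _ _) hT
  have h2 : 0 ≤ exp (2 * σ * T) * energy k (Y T) := mul_nonneg (exp_pos _).le (energy_nonneg _ _)
  have h3 := hY.energy_decay hσ hν hη k hT
  have h4 := mul_le_mul_of_nonneg_left (le_of_add_le_of_nonneg_right h3 h2)
    (by positivity : 0 ≤ 2 / σ)
  rw [← mul_assoc, show 2 / σ * (σ / 2) = 1 by field_simp, one_mul] at h4
  exact h1.trans h4

theorem exists_exp_mul_energy_sub_le {B : ℝ} (hσ : 0 < σ) (hB : 0 ≤ B) (r : ℕ) :
    ∃ K : ℝ, 0 ≤ K ∧ ∀ (ν η n d : ℝ) (Y Z : ℝ → Bool → Fin 2 → (Fin 2 → ℝ) → ℝ)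
      (p q : ℝ → (Fin 2 → ℝ) → ℝ), σ ≤ ν → σ ≤ η → 1 ≤ n → 0 ≤ d →
      ElsasserFlow ν η Y p → ElsasserFlow ν η Z q →
      (∀ j ≤ r, energy j (Y 0) ≤ B * n ^ j) → (∀ j ≤ r, energy j (Z 0) ≤ B * n ^ j) →
      (∀ j ≤ r, energy j (fun s i x => Y 0 s i x - Z 0 s i x) ≤ B * d) →
      ∀ j ≤ r, ∀ T, 0 ≤ T →
        exp (2 * σ * T) * energy j (fun s i x => Y T s i x - Z T s i x) ≤ K * d * n ^ j := by
  choose κ hκ hest using fun k => energy_estimate_sub hσ k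
  set M := exp (1024 * 16 ^ r / σ ^ 2 * B) with hM
  have hM1 : 1 ≤ M := one_le_exp (by positivity)
  set A := (1 + 2 / σ) * (2 * (M * B)) with hA
  have hMB : 0 ≤ M * B := by positivity
  have hA1 : 2 * (M * B) ≤ A := le_mul_of_one_le_left (by linarith) (by
    have : 0 ≤ 2 / σ := by positivity
    linarith)
  have hA2 : 2 / σ * (2 * (M * B)) ≤ A := by
    rw [hA, add_mul]
    linarith
  have hBA : B ≤ A := by
    have : 1 * B ≤ M * B := by gcongr
    linarith
  obtain ⟨K, hK, h⟩ := energy_decay_sub hσ (hB.trans hBA) κ hκ (r + 1)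
  refine ⟨K, hK, ?_⟩
  intro ν η n d Y Z p q hν hη hn hd hY hZ hY0 hZ0 hV0 j hj T hT
  have bound : ∀ {X : ℝ → Bool → Fin 2 → (Fin 2 → ℝ) → ℝ}, (∀ j ≤ r, energy j (X 0) ≤ B * n ^ j) →
      ∀ j < r + 1, exp (1024 * 16 ^ j / σ ^ 2 * energy 0 (X 0)) * energy j (X 0)
        ≤ M * B * n ^ j := by
    intro X hX j hj
    have h0 := hX 0 (Nat.zero_le r)
    rw [pow_zero, mul_one] at h0
    have h1 := hX j (by omega)
    have h2 := energy_nonneg 0 (X 0)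
    have h2' := energy_nonneg j (X 0)
    rw [mul_assoc]
    have h3 : (16 : ℝ) ^ j ≤ 16 ^ r := pow_le_pow_right₀ (by norm_num) (by omega)
    rw [hM]
    gcongr
  have hV : ∀ s i, EvolSmooth fun t x => Y t s i x - Z t s i x :=
    fun s i => (hY.evol s i).sub (hZ.evol s i)
  have hcV := continuous_energy (Y := fun t s i x => Y t s i x - Z t s i x) hV
  have hcY := continuous_energy hY.evol
  have hcZ := continuous_energy hZ.evol
  have main := h n d (fun k t => energy k (Y (max t 0)) + energy k (Z (max t 0)))
    (fun k t => energy k (fun s i x => Y (max t 0) s i x - Z (max t 0) s i x)) _ hn hd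
    (fun k => (hcY k).add (hcZ k)) hcV
    (fun k t => add_nonneg (energy_nonneg _ _) (energy_nonneg _ _)) (fun k t => energy_nonneg _ _)
    (fun k t ht => hasDerivAt_energy (Y := fun t s i x => Y t s i x - Z t s i x) hV k ht)
    (fun k t ht => by
      simp only [max_eq_left ht.le, hY.dt_sub hZ ht]
      exact hest k ν η hν hη _ (Y t) _ (Z t) (fun j => energy j (Y t) + energy j (Z t))
        ((hY.pressure t ht.le).sub (hZ.pressure t ht.le)) (hY.solenoidal t ht.le)
        ((hY.solenoidal t ht.le).sub (hZ.solenoidal t ht.le)) (hZ.solenoidal t ht.le)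
        (fun j => le_add_of_nonneg_right (energy_nonneg _ _))
        (fun j => le_add_of_nonneg_left (energy_nonneg _ _)))
    (fun j hj t ht => by
      have h1 := (hY.energy_le hσ hν hη j ht).trans (bound hY0 j hj)
      have h2 := (hZ.energy_le hσ hν hη j ht).trans (bound hZ0 j hj)
      have h3 : 2 * (M * B) * n ^ j ≤ A * n ^ j := by gcongr
      simp only [max_eq_left ht]
      linarith)
    (fun j hj T hT => by
      have h1 := hY.integral_energy_le hσ hν hη j hT
      have h2 := hZ.integral_energy_le hσ hν hη j hT
      have h3 : 2 / σ * (2 * (M * B)) * n ^ j ≤ A * n ^ j := by gcongr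
      have h4 := mul_le_mul_of_nonneg_left (bound hY0 j hj) (by positivity : 0 ≤ 2 / σ)
      have h5 := mul_le_mul_of_nonneg_left (bound hZ0 j hj) (by positivity : 0 ≤ 2 / σ)
      rw [intervalIntegral.integral_add ((hcY _).intervalIntegrable _ _)
        ((hcZ _).intervalIntegrable _ _)]
      linarith)
    (fun j hj => by
      rw [max_self]
      refine (hV0 j (by omega)).trans ?_
      gcongr) j (by omega) T hT
  refine le_trans (le_add_of_nonneg_right ?_) ((max_eq_left hT) ▸ main)
  exact mul_nonneg (by positivity) (intervalIntegral.integral_nonneg hT fun s _ =>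
    mul_nonneg (exp_pos _).le (energy_nonneg _ _))

/-- Stability of the Elsässer flow, with a constant linear in the `L²` energy. -/
theorem exists_energy_sub_le {B : ℝ} (hσ : 0 < σ) (hB : 0 ≤ B) (r : ℕ) :
    ∃ C : ℝ, 0 ≤ C ∧ ∀ (ν η n d : ℝ) (Y Z : ℝ → Bool → Fin 2 → (Fin 2 → ℝ) → ℝ)
      (p q : ℝ → (Fin 2 → ℝ) → ℝ), σ ≤ ν → σ ≤ η → 1 ≤ n → 0 ≤ d →
      ElsasserFlow ν η Y p → ElsasserFlow ν η Z q →
      (∀ j ≤ r, energy j (Z 0) ≤ B * n ^ j) →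
      (∀ j ≤ r, energy j (fun s i x => Y 0 s i x - Z 0 s i x) ≤ B * d) →
      ∀ j ≤ r, ∀ T, 0 ≤ T →
        exp (2 * σ * T) * energy j (fun s i x => Y T s i x - Z T s i x)
          ≤ d * n ^ j * exp (C / σ ^ 2 * (1 + energy 0 (Z 0)
            + energy 0 (fun s i x => Y 0 s i x - Z 0 s i x))) := by
  obtain ⟨K, hK, h⟩ := exists_exp_mul_energy_sub_le hσ (by positivity : 0 ≤ 4 * B) r
  refine ⟨σ ^ 2 * (10 * B + K) + 3072 * 16 ^ r, by positivity, ?_⟩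
  intro ν η n d Y Z p q hν hη hn hd hY hZ hZ0 hV0 j hj T hT
  have sY := hY.solenoidal 0 le_rfl
  have sZ := hZ.solenoidal 0 le_rfl
  set V0 := fun s i x => Y 0 s i x - Z 0 s i x with hV
  have hY0 := fun j => energy_le_sub sY sZ j
  have e0 := energy_nonneg 0 (Z 0)
  have e1 := energy_nonneg 0 V0
  set Γ := 1 + energy 0 (Z 0) + energy 0 V0 with hΓ
  have hΓ1 : 1 ≤ Γ := by linarith
  have hn1 : ∀ j, 1 ≤ n ^ j := fun j => one_le_pow₀ hn
  have hexp : (σ ^ 2 * (10 * B + K) + 3072 * 16 ^ r) / σ ^ 2 * Γ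
      = (10 * B + K) * Γ + 3072 * 16 ^ r / σ ^ 2 * Γ := by field_simp
  rw [hexp, Real.exp_add]
  have hBK : 10 * B + K ≤ exp ((10 * B + K) * Γ) := by
    have h1 := add_one_le_exp ((10 * B + K) * Γ)
    have h2 : (10 * B + K) * 1 ≤ (10 * B + K) * Γ := by gcongr
    linarith
  rcases le_or_gt 1 d with hd1 | hd1
  · have hdiff := energy_sub_le (hY.solenoidal T hT) (hZ.solenoidal T hT) j
    have hYT := hY.exp_mul_energy_le hσ hν hη j hT
    have hZT := hZ.exp_mul_energy_le hσ hν hη j hT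
    have h16 : (16 : ℝ) ^ j ≤ 16 ^ r := pow_le_pow_right₀ (by norm_num) hj
    have x1 : exp (1024 * 16 ^ j / σ ^ 2 * energy 0 (Y 0))
        ≤ exp (3072 * 16 ^ r / σ ^ 2 * Γ) := by
      refine exp_le_exp.2 ?_
      have h1 : energy 0 (Y 0) ≤ 3 * Γ := by
        have := hY0 0
        linarith
      calc 1024 * 16 ^ j / σ ^ 2 * energy 0 (Y 0) ≤ 1024 * 16 ^ r / σ ^ 2 * (3 * Γ) := by
            have := energy_nonneg 0 (Y 0)
            gcongr
        _ = _ := by ring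
    have x2 : exp (1024 * 16 ^ j / σ ^ 2 * energy 0 (Z 0))
        ≤ exp (3072 * 16 ^ r / σ ^ 2 * Γ) := by
      refine exp_le_exp.2 ?_
      have h1 : energy 0 (Z 0) ≤ 3 * Γ := by linarith
      calc 1024 * 16 ^ j / σ ^ 2 * energy 0 (Z 0) ≤ 1024 * 16 ^ r / σ ^ 2 * (3 * Γ) := by
            gcongr
        _ = _ := by ring
    set M := exp (3072 * 16 ^ r / σ ^ 2 * Γ) with hM
    have y1 := mul_le_mul_of_nonneg_right x1 (energy_nonneg j (Y 0))
    have y2 := mul_le_mul_of_nonneg_right x2 (energy_nonneg j (Z 0))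
    have b1 : energy j (Z 0) ≤ B * (d * n ^ j) := (hZ0 j hj).trans (by
      have : 1 * n ^ j ≤ d * n ^ j := by have := hn1 j; gcongr
      rw [one_mul] at this
      gcongr)
    have b2 : energy j V0 ≤ B * (d * n ^ j) := (hV0 j hj).trans (by
      have : d * 1 ≤ d * n ^ j := by have := hn1 j; gcongr
      rw [mul_one] at this
      gcongr)
    have b3 : 2 * (energy j (Y 0) + energy j (Z 0)) ≤ 10 * B * (d * n ^ j) := by
      have := hY0 j
      linarith
    have hdn : 0 ≤ d * n ^ j := by have := hn1 j; positivity
    calc exp (2 * σ * T) * energy j (fun s i x => Y T s i x - Z T s i x)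
        ≤ exp (2 * σ * T) * (2 * energy j (Y T) + 2 * energy j (Z T)) := by gcongr
      _ ≤ M * (2 * (energy j (Y 0) + energy j (Z 0))) := by linarith
      _ ≤ M * (10 * B * (d * n ^ j)) := by gcongr
      _ ≤ M * (exp ((10 * B + K) * Γ) * (d * n ^ j)) := by
          have : 10 * B ≤ exp ((10 * B + K) * Γ) := by linarith
          gcongr
      _ = _ := by ring
  · have hs := h ν η n d Y Z p q hν hη hn hd hY hZ (fun j hj => by
        have h1 := hY0 j
        have h2 := hZ0 j hj
        have h3 : energy j V0 ≤ B * n ^ j := (hV0 j hj).trans (by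
          have := hn1 j
          have : d ≤ n ^ j := by linarith
          gcongr)
        linarith) (fun j hj => (hZ0 j hj).trans (by
          have := hn1 j
          gcongr
          linarith)) (fun j hj => (hV0 j hj).trans (by gcongr; linarith)) j hj T hT
    refine hs.trans ?_
    have hdn : 0 ≤ d * n ^ j := by have := hn1 j; positivity
    have h1 : K * (d * n ^ j) ≤ exp ((10 * B + K) * Γ) * (d * n ^ j) := by
      have : K ≤ exp ((10 * B + K) * Γ) := by linarith
      gcongr
    have h2 : 1 ≤ exp (3072 * 16 ^ r / σ ^ 2 * Γ) := one_le_exp (by positivity)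
    calc K * d * n ^ j = K * (d * n ^ j) := by ring
      _ ≤ exp ((10 * B + K) * Γ) * (d * n ^ j) * 1 := by rwa [mul_one]
      _ ≤ exp ((10 * B + K) * Γ) * (d * n ^ j) * exp (3072 * 16 ^ r / σ ^ 2 * Γ) := by gcongr
      _ = _ := by ring

end ElsasserFlow

end Stability

section SobolevComparison

variable {w : (Fin 2 → ℝ) → Fin 2 → ℝ}

theorem integral_gradSq (m : ℕ) (hw : ∀ i, SmoothPer fun x => w x i) :
    ∫ x in box 2 1, gradSq m w x
      = ∑ α ∈ Finset.Nat.antidiagonalTuple 2 m, ∑ i,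
        avg (fun x => pdM α (fun y => w y i) x ^ 2) := by
  have h : ∀ (α : Fin 2 → ℕ) i, Continuous fun x => pdM α (fun y => w y i) x ^ 2 :=
    fun α i => (((hw i).pdList (mIdxList α)).pow 2).cont
  refine (avg_sum _ fun α _ => ?_).trans (Finset.sum_congr rfl fun α _ => avg_sum _ fun i _ => h α i)
  exact continuous_finsetSum _ fun i _ => h α i

theorem integral_gradSq_nonneg (m : ℕ) : 0 ≤ ∫ x in box 2 1, gradSq m w x :=
  avg_nonneg fun _ => Finset.sum_nonneg fun _ _ => Finset.sum_nonneg fun _ _ => sq_nonneg _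

theorem HnormSq_nonneg (k : ℕ) : 0 ≤ HnormSq 1 k w :=
  Finset.sum_nonneg fun m _ => integral_gradSq_nonneg m

theorem sum_sobSq_le_HnormSq (k : ℕ) (hw : ∀ i, SmoothPer fun x => w x i) :
    ∑ i, sobSq k (fun x => w x i) ≤ 2 ^ k * HnormSq 1 k w := by
  have h1 : ∫ x in box 2 1, gradSq k w x ≤ HnormSq 1 k w :=
    Finset.single_le_sum (f := fun m => ∫ x in box 2 1, gradSq m w x)
      (fun m _ => integral_gradSq_nonneg m) (Finset.self_mem_range_succ k)
  calc ∑ i, sobSq k (fun x => w x i)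
      ≤ ∑ i, 2 ^ k * ∑ α ∈ Finset.Nat.antidiagonalTuple 2 k,
          avg (fun x => pdM α (fun y => w y i) x ^ 2) :=
        Finset.sum_le_sum fun i _ => sobSq_le_pdM k (hw i)
    _ = 2 ^ k * ∫ x in box 2 1, gradSq k w x := by
        rw [integral_gradSq k hw, ← Finset.mul_sum, Finset.sum_comm]
    _ ≤ _ := by gcongr

theorem HnormSq_le_sum_sobSq (r : ℕ) (hw : ∀ i, SmoothPer fun x => w x i) :
    HnormSq 1 r w ≤ ∑ k ∈ Finset.range (r + 1),
      (Finset.Nat.antidiagonalTuple 2 k).card * ∑ i, sobSq k (fun x => w x i) := by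
  refine Finset.sum_le_sum fun k _ => ?_
  rw [integral_gradSq k hw, ← nsmul_eq_mul]
  exact Finset.sum_le_card_nsmul _ _ _ fun α hα =>
    Finset.sum_le_sum fun i _ => avg_pdM_sq_le hα _

theorem energy_elsasser (k : ℕ) {u b : ℝ → (Fin 2 → ℝ) → Fin 2 → ℝ} {t : ℝ}
    (hu : ∀ i, SmoothPer fun x => u t x i) (hb : ∀ i, SmoothPer fun x => b t x i) :
    energy k (elsasser u b t)
      = 2 * (∑ i, sobSq k (fun x => u t x i) + ∑ i, sobSq k (fun x => b t x i)) := by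
  have h1 : ∀ i, sobSq k (elsasser u b t true i) = _ := fun i => sobSq_add k (hu i) (hb i)
  have h2 : ∀ i, sobSq k (elsasser u b t false i) = _ := fun i => sobSq_sub k (hu i) (hb i)
  rw [energy, Fintype.sum_prod_type, Fintype.sum_bool, ← Finset.sum_add_distrib,
    ← Finset.sum_add_distrib, Finset.mul_sum]
  refine Finset.sum_congr rfl fun i _ => ?_
  rw [h1, h2]
  ring

theorem energy_elsasser_le (k : ℕ) {u b : ℝ → (Fin 2 → ℝ) → Fin 2 → ℝ} {t : ℝ}
    (hu : ∀ i, SmoothPer fun x => u t x i) (hb : ∀ i, SmoothPer fun x => b t x i) :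
    energy k (elsasser u b t) ≤ 2 * 2 ^ k * (HnormSq 1 k (u t) + HnormSq 1 k (b t)) := by
  rw [energy_elsasser k hu hb]
  have h1 := sum_sobSq_le_HnormSq k hu
  have h2 := sum_sobSq_le_HnormSq k hb
  linarith

theorem HnormSq_add_le (r : ℕ) {u b : ℝ → (Fin 2 → ℝ) → Fin 2 → ℝ} {t : ℝ}
    (hu : ∀ i, SmoothPer fun x => u t x i) (hb : ∀ i, SmoothPer fun x => b t x i) :
    HnormSq 1 r (u t) + HnormSq 1 r (b t) ≤ ∑ k ∈ Finset.range (r + 1),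
      (Finset.Nat.antidiagonalTuple 2 k).card * energy k (elsasser u b t) := by
  refine (add_le_add (HnormSq_le_sum_sobSq r hu) (HnormSq_le_sum_sobSq r hb)).trans ?_
  rw [← Finset.sum_add_distrib]
  refine Finset.sum_le_sum fun k _ => ?_
  rw [← mul_add]
  have h := energy_elsasser k hu hb
  have h0 := energy_nonneg k (elsasser u b t)
  gcongr
  linarith

theorem elsasser_sub (u b w m : ℝ → (Fin 2 → ℝ) → Fin 2 → ℝ) (t : ℝ) :
    (fun s i x => elsasser w m t s i x - elsasser u b t s i x)
      = elsasser (fun t x => w t x - u t x) (fun t x => m t x - b t x) t := by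
  funext s i x
  cases s <;> simp only [elsasser, Pi.sub_apply] <;> ring

theorem HnormSq_add_le_of_Hnorm_add_le {u b : (Fin 2 → ℝ) → Fin 2 → ℝ} {k : ℕ} {c : ℝ}
    (h : Hnorm 1 k u + Hnorm 1 k b ≤ c) : HnormSq 1 k u + HnormSq 1 k b ≤ c ^ 2 := by
  have hu := sq_sqrt (HnormSq_nonneg k (w := u))
  have hb := sq_sqrt (HnormSq_nonneg k (w := b))
  have hu0 : 0 ≤ Hnorm 1 k u := sqrt_nonneg _
  have hb0 : 0 ≤ Hnorm 1 k b := sqrt_nonneg _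
  change Hnorm 1 k u ^ 2 = _ at hu
  change Hnorm 1 k b ^ 2 = _ at hb
  nlinarith [mul_nonneg hu0 hb0]

end SobolevComparison

/-- stability estimate for the difference of two 2D MHD solutions,
Theorem 6.5 of the paper. The constant `C` depends only on `r`, `σ` and `C₁`. -/
theorem mhd_difference_stability_2d (σ C₁ : ℝ) (r : ℕ) (hσ : 0 < σ) :
    ∃ C : ℝ, 0 < C ∧
    ∀ ν η N δ : ℝ, 0 < ν → 0 < η → σ < min ν η → 1 < N → 0 < δ →
    ∀ (u b w m : ℝ → (Fin 2 → ℝ) → Fin 2 → ℝ) (P Q : ℝ → (Fin 2 → ℝ) → ℝ),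
      IsMHD 2 1 ν η (Set.Ici 0) u b P →
      IsMHD 2 1 ν η (Set.Ici 0) w m Q →
      ZeroAvg 1 (u 0) → ZeroAvg 1 (b 0) → ZeroAvg 1 (w 0) → ZeroAvg 1 (m 0) →
      (∀ j : ℕ, j ≤ r → Hnorm 1 j (u 0) + Hnorm 1 j (b 0) ≤ C₁ * N ^ j) →
      (∀ j : ℕ, j ≤ r →
        Hnorm 1 j (fun x => w 0 x - u 0 x) + Hnorm 1 j (fun x => m 0 x - b 0 x) ≤ C₁ * δ) →
      ∀ t : ℝ, 0 ≤ t →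
        HnormSq 1 r (fun x => w t x - u t x) + HnormSq 1 r (fun x => m t x - b t x)
          ≤ δ ^ 2 * N ^ (2 * r) * Real.exp (-(2 * σ) * t)
            * Real.exp (C * (1 + HnormSq 1 0 (u 0) + HnormSq 1 0 (b 0)
                + HnormSq 1 0 (fun x => w 0 x - u 0 x)
                + HnormSq 1 0 (fun x => m 0 x - b 0 x)) / σ ^ 2) := by
  obtain ⟨B, hB⟩ : ∃ B : ℝ, B = 2 * 2 ^ r * C₁ ^ 2 := ⟨_, rfl⟩
  have hB0 : 0 ≤ B := by rw [hB]; positivity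
  obtain ⟨c, hc⟩ : ∃ c : ℝ, c = ∑ k ∈ Finset.range (r + 1),
    ((Finset.Nat.antidiagonalTuple 2 k).card : ℝ) := ⟨_, rfl⟩
  have hc0 : 0 ≤ c := hc ▸ Finset.sum_nonneg fun _ _ => Nat.cast_nonneg _
  obtain ⟨C, hC, hstab⟩ := ElsasserFlow.exists_energy_sub_le hσ hB0 r
  refine ⟨2 * C + c * σ ^ 2 + 1, by positivity, ?_⟩
  intro ν η N δ _ _ hmin hN hδ u b w m P Q hub hwm hu0 hb0 hw0 hm0 hdata hdiff t ht
  obtain ⟨hν, hη⟩ := lt_min_iff.1 hmin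
  have hn1 : 1 ≤ N ^ 2 := one_le_pow₀ hN.le
  have hvs : ∀ {τ : ℝ}, 0 ≤ τ → ∀ i, SmoothPer fun x => w τ x i - u τ x i :=
    fun hτ i => (hwm.smoothPer_u hτ i).sub (hub.smoothPer_u hτ i)
  have hhs : ∀ {τ : ℝ}, 0 ≤ τ → ∀ i, SmoothPer fun x => m τ x i - b τ x i :=
    fun hτ i => (hwm.smoothPer_b hτ i).sub (hub.smoothPer_b hτ i)
  have h2 : ∀ j ≤ r, (2 : ℝ) ^ j ≤ 2 ^ r := fun j hj => pow_le_pow_right₀ (by norm_num) hj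
  have hZ0 : ∀ j ≤ r, energy j (elsasser u b 0) ≤ B * (N ^ 2) ^ j := fun j hj => by
    have e1 := energy_elsasser_le j (hub.smoothPer_u le_rfl) (hub.smoothPer_b le_rfl)
    have e2 := HnormSq_add_le_of_Hnorm_add_le (hdata j hj)
    have e3 := h2 j hj
    calc _ ≤ _ := e1
      _ ≤ 2 * 2 ^ r * (C₁ * N ^ j) ^ 2 := by
          gcongr
          exact add_nonneg (HnormSq_nonneg j) (HnormSq_nonneg j)
      _ = _ := by rw [hB]; ring
  have hV0 : ∀ j ≤ r, energy j (elsasser (fun t x => w t x - u t x) (fun t x => m t x - b t x) 0)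
      ≤ B * δ ^ 2 := fun j hj => by
    have e1 := energy_elsasser_le j (u := fun t x => w t x - u t x)
      (b := fun t x => m t x - b t x) (hvs le_rfl) (hhs le_rfl)
    have e2 := HnormSq_add_le_of_Hnorm_add_le (hdiff j hj)
    have e3 := h2 j hj
    calc _ ≤ _ := e1
      _ ≤ 2 * 2 ^ r * (C₁ * δ) ^ 2 := by
          gcongr
          exact add_nonneg (HnormSq_nonneg j) (HnormSq_nonneg j)
      _ = _ := by rw [hB]; ring
  have hst := hstab ν η (N ^ 2) (δ ^ 2) (elsasser w m) (elsasser u b) Q P hν.le hη.le hn1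
    (sq_nonneg δ) (hwm.elsasserFlow hw0 hm0) (hub.elsasserFlow hu0 hb0) hZ0
    fun j hj => by rw [elsasser_sub]; exact hV0 j hj
  rw [elsasser_sub u b w m 0] at hst
  have eZ := energy_elsasser_le 0 (hub.smoothPer_u le_rfl) (hub.smoothPer_b le_rfl)
  have eV := energy_elsasser_le 0 (u := fun t x => w t x - u t x)
      (b := fun t x => m t x - b t x) (hvs le_rfl) (hhs le_rfl)
  set Γ := 1 + HnormSq 1 0 (u 0) + HnormSq 1 0 (b 0) + HnormSq 1 0 (fun x => w 0 x - u 0 x)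
    + HnormSq 1 0 (fun x => m 0 x - b 0 x) with hΓ
  have hΓ1 : 1 ≤ Γ := by
    have := HnormSq_nonneg 0 (w := u 0)
    have := HnormSq_nonneg 0 (w := b 0)
    have := HnormSq_nonneg 0 (w := fun x => w 0 x - u 0 x)
    have := HnormSq_nonneg 0 (w := fun x => m 0 x - b 0 x)
    linarith
  have hexp : exp (C / σ ^ 2 * (1 + energy 0 (elsasser u b 0)
      + energy 0 (elsasser (fun t x => w t x - u t x) (fun t x => m t x - b t x) 0)))
      ≤ exp (2 * C / σ ^ 2 * Γ) := by
    refine exp_le_exp.2 ?_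
    rw [show 2 * C / σ ^ 2 * Γ = C / σ ^ 2 * (2 * Γ) by ring]
    gcongr
    simp only [pow_zero, mul_one] at eZ eV
    linarith
  have hk : ∀ k ∈ Finset.range (r + 1),
      energy k (elsasser (fun t x => w t x - u t x) (fun t x => m t x - b t x) t)
        ≤ δ ^ 2 * N ^ (2 * r) * exp (-(2 * σ) * t) * exp (2 * C / σ ^ 2 * Γ) := fun k hk => by
    have hkr : k ≤ r := Finset.mem_range_succ_iff.1 hk
    have e1 := mul_le_mul_of_nonneg_left (elsasser_sub u b w m t ▸ hst k hkr t ht) (exp_pos (-(2 * σ) * t)).le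
    rw [← mul_assoc, ← Real.exp_add, show -(2 * σ) * t + 2 * σ * t = 0 by ring, Real.exp_zero,
      one_mul] at e1
    have e2 : (N ^ 2) ^ k ≤ N ^ (2 * r) := by
      rw [pow_mul]
      exact pow_le_pow_right₀ hn1 hkr
    calc _ ≤ _ := e1
      _ ≤ exp (-(2 * σ) * t) * (δ ^ 2 * N ^ (2 * r) * exp (2 * C / σ ^ 2 * Γ)) := by gcongr
      _ = _ := by ring
  have hcexp : c ≤ exp ((c + 1 / σ ^ 2) * Γ) := by
    have e1 := add_one_le_exp ((c + 1 / σ ^ 2) * Γ)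
    have e2 : (c + 0) * 1 ≤ (c + 1 / σ ^ 2) * Γ := by gcongr; positivity
    linarith
  have hsplit : exp ((2 * C + c * σ ^ 2 + 1) * Γ / σ ^ 2)
      = exp ((c + 1 / σ ^ 2) * Γ) * exp (2 * C / σ ^ 2 * Γ) := by
    rw [← Real.exp_add]
    congr 1
    field_simp
    ring
  rw [hsplit]
  have hN0 : 0 < N := by linarith
  calc HnormSq 1 r (fun x => w t x - u t x) + HnormSq 1 r (fun x => m t x - b t x)
      ≤ ∑ k ∈ Finset.range (r + 1), (Finset.Nat.antidiagonalTuple 2 k).card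
          * energy k (elsasser (fun t x => w t x - u t x) (fun t x => m t x - b t x) t) :=
        HnormSq_add_le r (u := fun t x => w t x - u t x) (b := fun t x => m t x - b t x)
          (hvs ht) (hhs ht)
    _ ≤ ∑ k ∈ Finset.range (r + 1), (Finset.Nat.antidiagonalTuple 2 k).card
          * (δ ^ 2 * N ^ (2 * r) * exp (-(2 * σ) * t) * exp (2 * C / σ ^ 2 * Γ)) :=
        Finset.sum_le_sum fun k hkr => mul_le_mul_of_nonneg_left (hk k hkr) (Nat.cast_nonneg _)
    _ = c * (δ ^ 2 * N ^ (2 * r) * exp (-(2 * σ) * t) * exp (2 * C / σ ^ 2 * Γ)) := by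
        rw [← Finset.sum_mul, hc]
    _ ≤ exp ((c + 1 / σ ^ 2) * Γ)
          * (δ ^ 2 * N ^ (2 * r) * exp (-(2 * σ) * t) * exp (2 * C / σ ^ 2 * Γ)) := by gcongr
    _ = _ := by ring

end
end

section
/- (Stability of the critical points of a Taylor field under small perturbations.) Let n, m ≥ 1 be integers and set N² = n² + m². Let V_N = V¹_{nm} be the Taylor field on 𝕋² and let W : 𝕋² → ℝ² be a C¹ vector field. For every integer L ≥ 2 there exists N₀ (depending only on L and ‖W‖_{C¹}) such that if N ≥ N₀, then for every δ ∈ ℝ with |δ| < N^{−L}, the vector field Ṽ = V_N + δW has at least 8nm zeros at each of which the differential of Ṽ is an invertible linear map (i.e., at least 8nm regular critical points). -/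
open MeasureTheory Real Set

noncomputable section

/-- The Taylor field `V¹_{nm}` on the `2π`-torus. -/
def TaylorV (n m : ℕ) : (Fin 2 → ℝ) → Fin 2 → ℝ := fun x =>
  ![(m : ℝ) * Real.sin ((n : ℝ) * x 0) * Real.cos ((m : ℝ) * x 1),
    -((n : ℝ) * Real.cos ((n : ℝ) * x 0) * Real.sin ((m : ℝ) * x 1))]

namespace Prdc

variable {d : ℕ} {E : Type*} {T : ℝ} {w : (Fin d → ℝ) → E}

theorem add_single_zsmul (hw : Prdc T w) (x : Fin d → ℝ) (i : Fin d) (k : ℤ) :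
    w (x + Pi.single i (k • T)) = w x := by
  induction k using Int.induction_on generalizing x with
  | zero => simp
  | succ k ih => rw [add_smul, one_smul, Pi.single_add, ← add_assoc, hw, ih]
  | pred k ih =>
    rw [sub_smul, one_smul, Pi.single_sub, ← hw, ← ih x]
    congr 1
    abel

theorem add_zsmul (hw : Prdc T w) (x : Fin d → ℝ) (k : Fin d → ℤ) :
    w (x + fun i => k i • T) = w x := by
  have key : ∀ s : Finset (Fin d), w (x + ∑ i ∈ s, Pi.single i (k i • T)) = w x := by
    intro s
    induction s using Finset.induction_on with
    | empty => simp
    | insert i s hi ih =>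
      rw [Finset.sum_insert hi, add_comm (Pi.single i _), ← add_assoc, hw.add_single_zsmul, ih]
  simpa only [Finset.univ_sum_single] using key Finset.univ

theorem apply_toIcoMod (hw : Prdc T w) (hT : 0 < T) (x : Fin d → ℝ) :
    w (fun i => toIcoMod hT 0 (x i)) = w x := by
  rw [← hw.add_zsmul x fun i => -toIcoDiv hT 0 (x i)]
  congr 1
  ext i
  simp [toIcoMod, sub_eq_add_neg]

theorem fderiv [NormedAddCommGroup E] [NormedSpace ℝ E] (hw : Prdc T w) :
    Prdc T (fderiv ℝ w) := fun x i => by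
  rw [← fderiv_comp_add_right, funext fun y => hw y i]

theorem bddAbove_range {f : (Fin d → ℝ) → ℝ} (hf : Prdc T f) (hT : 0 < T)
    (hc : Continuous f) : BddAbove (range f) := by
  refine ((isCompact_Icc (a := (0 : Fin d → ℝ)) (b := fun _ => T)).bddAbove_image
    hc.continuousOn).mono ?_
  rintro _ ⟨x, rfl⟩
  refine ⟨fun i => toIcoMod hT 0 (x i), ⟨fun i => ?_, fun i => ?_⟩, hf.apply_toIcoMod hT x⟩
  · exact (toIcoMod_mem_Ico' hT (x i)).1
  · exact (toIcoMod_mem_Ico' hT (x i)).2.le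

end Prdc

theorem gradSq_zero {d k : ℕ} (w : (Fin d → ℝ) → Fin k → ℝ) (x : Fin d → ℝ) :
    gradSq 0 w x = ∑ i, w x i ^ 2 := by
  have h : mIdxList (0 : Fin d → ℕ) = [] := by simp [mIdxList]
  simp [gradSq, Finset.Nat.antidiagonalTuple_zero_right, pdM, h, pdList]

theorem gradSq_one {k : ℕ} (w : (Fin 2 → ℝ) → Fin k → ℝ) (x : Fin 2 → ℝ) :
    gradSq 1 w x = ∑ j, ∑ i, pd j (fun y => w y i) x ^ 2 := by
  have h : Finset.Nat.antidiagonalTuple 2 1 = {![0, 1], ![1, 0]} := by decide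
  have h01 : mIdxList ![0, 1] = [(1 : Fin 2)] := by decide
  have h10 : mIdxList ![1, 0] = [(0 : Fin 2)] := by decide
  have hne : (![0, 1] : Fin 2 → ℕ) ≠ ![1, 0] := by decide
  rw [gradSq, h, Finset.sum_pair hne, Fin.sum_univ_two, add_comm]
  simp only [pdM, h01, h10, pdList]

theorem sqrt_gradSq_le_LinfGrad {d k r : ℕ} {T : ℝ} (hT : 0 < T)
    {w : (Fin d → ℝ) → Fin k → ℝ} (hc : Continuous (gradSq r w)) (hp : Prdc T (gradSq r w))
    (x : Fin d → ℝ) : √(gradSq r w x) ≤ LinfGrad r w :=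
  le_ciSup (f := fun x => √(gradSq r w x)) (Prdc.bddAbove_range
    (fun x i => by rw [hp x i]) hT hc.sqrt) x

theorem norm_le_LinfGrad_zero {d k : ℕ} {T : ℝ} (hT : 0 < T) {w : (Fin d → ℝ) → Fin k → ℝ}
    (hc : Continuous w) (hp : Prdc T w) (x : Fin d → ℝ) : ‖w x‖ ≤ LinfGrad 0 w := by
  have hx : √(gradSq 0 w x) ≤ LinfGrad 0 w := by
    refine sqrt_gradSq_le_LinfGrad hT ?_ (fun x i => ?_) x
    · rw [funext (gradSq_zero w)]
      fun_prop
    · rw [gradSq_zero, gradSq_zero, hp x i]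
  refine le_trans ((pi_norm_le_iff_of_nonneg (Real.sqrt_nonneg _)).2 fun i => ?_) hx
  rw [gradSq_zero]
  exact Real.abs_le_sqrt
    (Finset.single_le_sum (f := fun i => w x i ^ 2) (fun _ _ => sq_nonneg _) (Finset.mem_univ i))

theorem pd_apply {d k : ℕ} {w : (Fin d → ℝ) → Fin k → ℝ} {x : Fin d → ℝ}
    (hw : DifferentiableAt ℝ w x) (j : Fin d) (i : Fin k) :
    pd j (fun y => w y i) x = fderiv ℝ w x (Pi.single j 1) i := by
  rw [pd, fderiv_apply hw i]
  rfl

theorem norm_fderiv_le_LinfGrad_one {k : ℕ} {T : ℝ} (hT : 0 < T)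
    {w : (Fin 2 → ℝ) → Fin k → ℝ} (hc : ContDiff ℝ 1 w) (hp : Prdc T w) (x : Fin 2 → ℝ) :
    ‖fderiv ℝ w x‖ ≤ 2 * LinfGrad 1 w := by
  have hd := hc.differentiable one_ne_zero
  have hgrad : gradSq 1 w = fun x => ∑ j, ∑ i, fderiv ℝ w x (Pi.single j 1) i ^ 2 := by
    ext x
    simp only [gradSq_one, pd_apply (hd x)]
  have hx : √(gradSq 1 w x) ≤ LinfGrad 1 w := by
    refine sqrt_gradSq_le_LinfGrad hT ?_ (fun x i => ?_) x
    · rw [hgrad]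
      have := hc.continuous_fderiv one_ne_zero
      fun_prop
    · rw [hgrad]
      simp only [hp.fderiv x i]
  have hentry : ∀ j i, |fderiv ℝ w x (Pi.single j 1) i| ≤ LinfGrad 1 w := fun j i => by
    refine le_trans (Real.abs_le_sqrt ?_) hx
    rw [hgrad]
    exact (Finset.single_le_sum (f := fun i => fderiv ℝ w x (Pi.single j 1) i ^ 2)
      (fun _ _ => sq_nonneg _) (Finset.mem_univ i)).trans
      (Finset.single_le_sum (f := fun j => ∑ i, fderiv ℝ w x (Pi.single j 1) i ^ 2)
        (fun _ _ => Finset.sum_nonneg fun _ _ => sq_nonneg _) (Finset.mem_univ j))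
  have h0 : 0 ≤ LinfGrad 1 w := (Real.sqrt_nonneg _).trans hx
  refine ContinuousLinearMap.opNorm_le_bound _ (by positivity) fun h => ?_
  refine (pi_norm_le_iff_of_nonneg (by positivity)).2 fun i => ?_
  have hsum : fderiv ℝ w x h i = ∑ j, h j * fderiv ℝ w x (Pi.single j 1) i := by
    conv_lhs => rw [pi_eq_sum_univ' h]
    simp
  rw [hsum, Real.norm_eq_abs]
  calc |∑ j, h j * fderiv ℝ w x (Pi.single j 1) i|
      ≤ ∑ j : Fin 2, |h j * fderiv ℝ w x (Pi.single j 1) i| := Finset.abs_sum_le_sum_abs _ _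
    _ ≤ ∑ _j : Fin 2, ‖h‖ * LinfGrad 1 w := Finset.sum_le_sum fun j _ => by
        rw [abs_mul]
        exact mul_le_mul (norm_le_pi_norm h j) (hentry j i) (abs_nonneg _) (norm_nonneg _)
    _ = 2 * LinfGrad 1 w * ‖h‖ := by
        rw [Fin.sum_univ_two]
        ring

/-- A quantitative inverse function theorem: a map whose differential is close to the identity on
a ball, and whose value at the centre is small, has a zero in that ball. -/
theorem exists_zero_of_norm_fderiv_sub_id_le {E : Type*} [NormedAddCommGroup E]
    [NormedSpace ℝ E] [CompleteSpace E] {f : E → E} {f' : E → E →L[ℝ] E} {z₀ : E} {r : ℝ}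
    (hf : ∀ z, HasFDerivAt f (f' z) z)
    (hf' : ∀ z ∈ Metric.closedBall z₀ r, ‖f' z - ContinuousLinearMap.id ℝ E‖ ≤ 1 / 2)
    (hr : 0 ≤ r) (h₀ : ‖f z₀‖ ≤ r / 2) : ∃ z ∈ Metric.closedBall z₀ r, f z = 0 := by
  have hlip : ∀ x ∈ Metric.closedBall z₀ r, ∀ y ∈ Metric.closedBall z₀ r,
      ‖(y - f y) - (x - f x)‖ ≤ 1 / 2 * ‖y - x‖ := fun x hx y hy =>
    (convex_closedBall z₀ r).norm_image_sub_le_of_norm_hasFDerivWithin_le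
      (f := fun z => z - f z) (f' := fun z => ContinuousLinearMap.id ℝ E - f' z)
      (fun z _ => ((hasFDerivAt_id z).sub (hf z)).hasFDerivWithinAt)
      (fun z hz => by rw [norm_sub_rev]; exact hf' z hz) hx hy
  have hmaps : MapsTo (fun z => z - f z) (Metric.closedBall z₀ r) (Metric.closedBall z₀ r) := by
    intro z hz
    have h := hlip z₀ (Metric.mem_closedBall_self hr) z hz
    rw [mem_closedBall_iff_norm] at hz ⊢
    calc ‖z - f z - z₀‖ = ‖((z - f z) - (z₀ - f z₀)) - f z₀‖ := by congr 1; abel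
      _ ≤ ‖(z - f z) - (z₀ - f z₀)‖ + ‖f z₀‖ := norm_sub_le _ _
      _ ≤ r := by linarith
  have hcontr : ContractingWith (1 / 2) (hmaps.restrict _ _ _) := by
    refine ⟨by norm_num, LipschitzWith.of_dist_le_mul fun x y => ?_⟩
    rw [Subtype.dist_eq, Subtype.dist_eq, dist_eq_norm, dist_eq_norm]
    simpa using hlip y y.2 x x.2
  obtain ⟨z, hz, hfix, -⟩ := hcontr.exists_fixedPoint' Metric.isClosed_closedBall.isComplete
    hmaps (Metric.mem_closedBall_self hr) (edist_ne_top _ _)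
  exact ⟨z, hz, sub_eq_self.1 hfix⟩

theorem ContinuousLinearMap.injective_of_norm_sub_id_lt {E : Type*} [NormedAddCommGroup E]
    [NormedSpace ℝ E] {A : E →L[ℝ] E} (hA : ‖A - ContinuousLinearMap.id ℝ E‖ < 1) :
    Function.Injective A := by
  refine (injective_iff_map_eq_zero A).2 fun x hx => norm_eq_zero.1 ?_
  have h := (A - ContinuousLinearMap.id ℝ E).le_opNorm x
  rw [sub_apply, hx, id_apply, zero_sub, norm_neg] at h
  nlinarith [norm_nonneg x]

theorem abs_cos_int_mul_pi_mul_cos_sub_one_le {z : ℝ} (k : ℤ) (hz : |z - k * π| ≤ 1 / 2) :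
    |cos (k * π) * cos z - 1| ≤ 1 / 8 := by
  have h : cos (k * π) * cos z = cos (z - k * π) := by
    rw [cos_sub, Real.sin_int_mul_pi]
    ring
  have h1 := Real.one_sub_sq_div_two_le_cos (x := z - k * π)
  have h2 := Real.cos_le_one (z - k * π)
  have h3 : (z - k * π) ^ 2 ≤ (1 / 2) ^ 2 := sq_le_sq' (abs_le.1 hz).1 (abs_le.1 hz).2
  rw [h, abs_le]
  constructor <;> linarith

theorem prdc_taylorV (n m : ℕ) : Prdc (2 * π) (TaylorV n m) := by
  intro x i
  have hn := fun t : ℝ => Real.sin_add_nat_mul_two_pi t n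
  have hn' := fun t : ℝ => Real.cos_add_nat_mul_two_pi t n
  have hm := fun t : ℝ => Real.sin_add_nat_mul_two_pi t m
  have hm' := fun t : ℝ => Real.cos_add_nat_mul_two_pi t m
  fin_cases i <;> simp [TaylorV, mul_add, hn, hn', hm, hm']

theorem differentiable_taylorV (n m : ℕ) : Differentiable ℝ (TaylorV n m) := by
  refine differentiable_pi.2 fun i => ?_
  fin_cases i <;> simp only [TaylorV] <;> simp <;> fun_prop

/-- The change of variables `z ↦ ((z₀ + z₁) / 2n, (z₀ - z₁) / 2m)`, which diagonalizes the Taylor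
field. -/
def taylorSource (n m : ℕ) : (Fin 2 → ℝ) →L[ℝ] (Fin 2 → ℝ) :=
  LinearMap.toContinuousLinearMap
    { toFun := fun z => ![(z 0 + z 1) / (2 * n), (z 0 - z 1) / (2 * m)]
      map_add' := fun x y => by ext i; fin_cases i <;> simp <;> ring
      map_smul' := fun c x => by ext i; fin_cases i <;> simp <;> ring }

/-- The linear map `v ↦ (s₀ (v₀ / m - v₁ / n), s₁ (v₀ / m + v₁ / n))` on the values of the
Taylor field. -/
def taylorTarget (n m : ℕ) (s : Fin 2 → ℝ) : (Fin 2 → ℝ) →L[ℝ] (Fin 2 → ℝ) :=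
  LinearMap.toContinuousLinearMap
    { toFun := fun v => ![s 0 * (v 0 / m - v 1 / n), s 1 * (v 0 / m + v 1 / n)]
      map_add' := fun x y => by ext i; fin_cases i <;> simp <;> ring
      map_smul' := fun c x => by ext i; fin_cases i <;> simp <;> ring }

theorem taylorSource_apply (n m : ℕ) (z : Fin 2 → ℝ) :
    taylorSource n m z = ![(z 0 + z 1) / (2 * n), (z 0 - z 1) / (2 * m)] := rfl

theorem taylorTarget_apply (n m : ℕ) (s v : Fin 2 → ℝ) :
    taylorTarget n m s v = ![s 0 * (v 0 / m - v 1 / n), s 1 * (v 0 / m + v 1 / n)] := rfl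

theorem taylorTarget_taylorV_taylorSource {n m : ℕ} (hn : 1 ≤ n) (hm : 1 ≤ m)
    (s z : Fin 2 → ℝ) :
    taylorTarget n m s (TaylorV n m (taylorSource n m z)) = fun i => s i * sin (z i) := by
  have hn0 : (n : ℝ) ≠ 0 := by positivity
  have hm0 : (m : ℝ) ≠ 0 := by positivity
  have e0 : (n : ℝ) * ((z 0 + z 1) / (2 * n)) = (z 0 + z 1) / 2 := by field_simp
  have e1 : (m : ℝ) * ((z 0 - z 1) / (2 * m)) = (z 0 - z 1) / 2 := by field_simp
  have h0 := sin_add ((z 0 + z 1) / 2) ((z 0 - z 1) / 2)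
  have h1 := sin_sub ((z 0 + z 1) / 2) ((z 0 - z 1) / 2)
  rw [show (z 0 + z 1) / 2 + (z 0 - z 1) / 2 = z 0 by ring] at h0
  rw [show (z 0 + z 1) / 2 - (z 0 - z 1) / 2 = z 1 by ring] at h1
  ext i
  fin_cases i
  · simp [taylorTarget_apply, TaylorV, taylorSource_apply, e0, e1, h0]
    field_simp
    simp
  · simp [taylorTarget_apply, TaylorV, taylorSource_apply, e0, e1, h1]
    field_simp
    simp [sub_eq_add_neg]

theorem norm_taylorSource_le {n m : ℕ} (hn : 1 ≤ n) (hm : 1 ≤ m) : ‖taylorSource n m‖ ≤ 1 := by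
  have hn1 : (1 : ℝ) ≤ n := by exact_mod_cast hn
  have hm1 : (1 : ℝ) ≤ m := by exact_mod_cast hm
  refine ContinuousLinearMap.opNorm_le_bound _ zero_le_one fun z => ?_
  have h0 := abs_le.1 (norm_le_pi_norm z 0)
  have h1 := abs_le.1 (norm_le_pi_norm z 1)
  have hz := norm_nonneg z
  refine (pi_norm_le_iff_of_nonneg (by positivity)).2 fun i => ?_
  fin_cases i
  · simp only [taylorSource_apply, Real.norm_eq_abs]
    simp only [Fin.zero_eta, Matrix.cons_val_zero]
    rw [abs_div, abs_of_pos (by positivity : (0 : ℝ) < 2 * n), div_le_iff₀ (by positivity)]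
    have : |z 0 + z 1| ≤ 2 * ‖z‖ := abs_le.2 ⟨by linarith, by linarith⟩
    nlinarith
  · simp only [taylorSource_apply, Real.norm_eq_abs]
    simp only [Fin.mk_one, Matrix.cons_val_one, Matrix.cons_val_fin_one]
    rw [abs_div, abs_of_pos (by positivity : (0 : ℝ) < 2 * m), div_le_iff₀ (by positivity)]
    have : |z 0 - z 1| ≤ 2 * ‖z‖ := abs_le.2 ⟨by linarith, by linarith⟩
    nlinarith

theorem norm_taylorTarget_le {n m : ℕ} (hn : 1 ≤ n) (hm : 1 ≤ m)
    {s : Fin 2 → ℝ} (hs : ∀ i, |s i| ≤ 1) : ‖taylorTarget n m s‖ ≤ 2 := by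
  have hn1 : (1 : ℝ) ≤ n := by exact_mod_cast hn
  have hm1 : (1 : ℝ) ≤ m := by exact_mod_cast hm
  refine ContinuousLinearMap.opNorm_le_bound _ zero_le_two fun v => ?_
  have h0 : |v 0 / m| ≤ ‖v‖ := by
    rw [abs_div, Nat.abs_cast]
    exact (div_le_self (abs_nonneg _) hm1).trans (norm_le_pi_norm v 0)
  have h1 : |v 1 / n| ≤ ‖v‖ := by
    rw [abs_div, Nat.abs_cast]
    exact (div_le_self (abs_nonneg _) hn1).trans (norm_le_pi_norm v 1)
  have hmul : ∀ i t, |t| ≤ 2 * ‖v‖ → |s i * t| ≤ 2 * ‖v‖ := fun i t ht => by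
    rw [abs_mul]
    exact (mul_le_of_le_one_left (abs_nonneg _) (hs i)).trans ht
  refine (pi_norm_le_iff_of_nonneg (by positivity)).2 fun i => ?_
  fin_cases i
  · exact hmul 0 _ ((abs_sub _ _).trans (by linarith))
  · exact hmul 1 _ ((abs_add_le _ _).trans (by linarith))

theorem injective_taylorTarget {n m : ℕ} (hn : 1 ≤ n) (hm : 1 ≤ m)
    {s : Fin 2 → ℝ} (hs : ∀ i, s i ≠ 0) : Function.Injective (taylorTarget n m s) := by
  have hn0 : (n : ℝ) ≠ 0 := by positivity
  have hm0 : (m : ℝ) ≠ 0 := by positivity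
  refine (injective_iff_map_eq_zero _).2 fun v hv => ?_
  have h0 := congrFun hv 0
  have h1 := congrFun hv 1
  simp [taylorTarget_apply, hs] at h0 h1
  have hv0 : v 0 / m = 0 := by linarith
  have hv1 : v 1 / n = 0 := by linarith
  ext i
  fin_cases i
  · simpa [hm0] using hv0
  · simpa [hn0] using hv1

theorem surjective_taylorSource {n m : ℕ} (hn : 1 ≤ n) (hm : 1 ≤ m) :
    Function.Surjective (taylorSource n m) := by
  have hn0 : (n : ℝ) ≠ 0 := by positivity
  have hm0 : (m : ℝ) ≠ 0 := by positivity
  refine fun x => ⟨![n * x 0 + m * x 1, n * x 0 - m * x 1], ?_⟩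
  ext i
  fin_cases i
  · simp [taylorSource_apply]
    field_simp
    ring
  · simp [taylorSource_apply]
    field_simp
    ring

/-- Near every critical point of the Taylor field, a `C¹`-small perturbation of it has a regular
critical point. -/
theorem exists_regular_zero_near {n m : ℕ} (hn : 1 ≤ n) (hm : 1 ≤ m)
    {W : (Fin 2 → ℝ) → Fin 2 → ℝ} {K δ : ℝ}
    (hW : Differentiable ℝ W) (hW₀ : ∀ x, ‖W x‖ ≤ K) (hW₁ : ∀ x, ‖fderiv ℝ W x‖ ≤ 2 * K)
    (hδ : |δ| * K ≤ 1 / 16) (k : Fin 2 → ℤ) :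
    ∃ x : Fin 2 → ℝ, |n * x 0 - (k 0 + k 1) * (π / 2)| ≤ 1 / 2 ∧
      |m * x 1 - (k 0 - k 1) * (π / 2)| ≤ 1 / 2 ∧ TaylorV n m x + δ • W x = 0 ∧
      Function.Bijective (fderiv ℝ (fun x => TaylorV n m x + δ • W x) x) := by
  set s : Fin 2 → ℝ := fun i => cos (k i * π) with hsdef
  have hs : ∀ i, |s i| = 1 := fun i => Real.abs_cos_int_mul_pi (k i)
  set A := taylorTarget n m s
  set B := taylorSource n m
  set V : (Fin 2 → ℝ) → Fin 2 → ℝ := fun x => TaylorV n m x + δ • W x with hV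
  have hK : 0 ≤ K := (norm_nonneg _).trans (hW₀ 0)
  have hA : ‖A‖ ≤ 2 := norm_taylorTarget_le hn hm fun i => (hs i).le
  have hB : ‖B‖ ≤ 1 := norm_taylorSource_le hn hm
  have hAinj : Function.Injective A := injective_taylorTarget hn hm fun i h => by
    simpa [h] using hs i
  have hBsurj : Function.Surjective B := surjective_taylorSource hn hm
  have hAVB : ∀ z, A (V (B z)) = (fun i => s i * sin (z i)) + δ • A (W (B z)) := fun z => by
    rw [hV, map_add, map_smul, taylorTarget_taylorV_taylorSource hn hm]
  set D : (Fin 2 → ℝ) → (Fin 2 → ℝ) →L[ℝ] (Fin 2 → ℝ) := fun z =>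
    ContinuousLinearMap.pi fun i => (s i * cos (z i)) • ContinuousLinearMap.proj i
  set f' : (Fin 2 → ℝ) → (Fin 2 → ℝ) →L[ℝ] (Fin 2 → ℝ) := fun z =>
    D z + δ • (A ∘L (fderiv ℝ W (B z) ∘L B))
  have hf' : ∀ z, HasFDerivAt (fun z => A (V (B z))) (f' z) z := fun z => by
    rw [funext hAVB]
    refine HasFDerivAt.add (hasFDerivAt_pi.2 fun i => ?_) ((A.hasFDerivAt.comp z
      ((hW (B z)).hasFDerivAt.comp z B.hasFDerivAt)).const_smul δ)
    have h := ((hasFDerivAt_apply (𝕜 := ℝ) i z).sin).const_mul (s i)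
    rwa [smul_smul] at h
  set z₀ : Fin 2 → ℝ := fun i => k i * π
  have hbound : ∀ z ∈ Metric.closedBall z₀ (1 / 2),
      ‖f' z - ContinuousLinearMap.id ℝ (Fin 2 → ℝ)‖ ≤ 1 / 2 := fun z hz => by
    have hD : ‖D z - ContinuousLinearMap.id ℝ (Fin 2 → ℝ)‖ ≤ 1 / 8 := by
      refine ContinuousLinearMap.opNorm_le_bound _ (by norm_num) fun h => ?_
      refine (pi_norm_le_iff_of_nonneg (by positivity)).2 fun i => ?_
      have hzi : |z i - k i * π| ≤ 1 / 2 :=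
        (dist_le_pi_dist z z₀ i).trans (Metric.mem_closedBall.1 hz)
      have heq : (D z - ContinuousLinearMap.id ℝ (Fin 2 → ℝ)) h i
          = (s i * cos (z i) - 1) * h i := by
        simp [D]
        ring
      rw [heq, norm_mul]
      exact mul_le_mul (abs_cos_int_mul_pi_mul_cos_sub_one_le (k i) hzi) (norm_le_pi_norm h i)
        (norm_nonneg _) (by norm_num)
    have hP : ‖δ • (A ∘L (fderiv ℝ W (B z) ∘L B))‖ ≤ 1 / 4 := by
      have h1 : ‖fderiv ℝ W (B z) ∘L B‖ ≤ 2 * K * 1 :=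
        (ContinuousLinearMap.opNorm_comp_le _ _).trans
          (mul_le_mul (hW₁ _) hB (norm_nonneg _) (by positivity))
      have h2 : ‖A ∘L (fderiv ℝ W (B z) ∘L B)‖ ≤ 2 * (2 * K * 1) :=
        (ContinuousLinearMap.opNorm_comp_le _ _).trans
          (mul_le_mul hA h1 (norm_nonneg _) zero_le_two)
      rw [norm_smul, Real.norm_eq_abs]
      nlinarith [abs_nonneg δ]
    calc ‖f' z - ContinuousLinearMap.id ℝ (Fin 2 → ℝ)‖
        = ‖(D z - ContinuousLinearMap.id ℝ (Fin 2 → ℝ))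
            + δ • (A ∘L (fderiv ℝ W (B z) ∘L B))‖ := by
          congr 1
          exact add_sub_right_comm _ _ _
      _ ≤ 1 / 8 + 1 / 4 := (norm_add_le _ _).trans (add_le_add hD hP)
      _ ≤ 1 / 2 := by norm_num
  have hstart : ‖A (V (B z₀))‖ ≤ 1 / 2 / 2 := by
    have hsin : (fun i => s i * sin (z₀ i)) = 0 := by
      ext i
      simp [z₀, Real.sin_int_mul_pi]
    have h1 : ‖A (W (B z₀))‖ ≤ 2 * K :=
      (A.le_opNorm _).trans (mul_le_mul hA (hW₀ _) (norm_nonneg _) zero_le_two)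
    rw [hAVB, hsin, zero_add, norm_smul, Real.norm_eq_abs]
    nlinarith [abs_nonneg δ]
  obtain ⟨z, hz, hzero⟩ :=
    exists_zero_of_norm_fderiv_sub_id_le hf' hbound (by norm_num) hstart
  have hVd : DifferentiableAt ℝ V (B z) :=
    ((differentiable_taylorV n m).add (hW.const_smul δ)) (B z)
  have hcomp : f' z = A ∘L (fderiv ℝ V (B z) ∘L B) :=
    (hf' z).unique (A.hasFDerivAt.comp z (hVd.hasFDerivAt.comp z B.hasFDerivAt))
  have hf'inj : Function.Injective (f' z) :=
    ContinuousLinearMap.injective_of_norm_sub_id_lt ((hbound z hz).trans_lt (by norm_num))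
  have hVinj : Function.Injective (fderiv ℝ V (B z)) := by
    intro a b hab
    obtain ⟨a, rfl⟩ := hBsurj a
    obtain ⟨b, rfl⟩ := hBsurj b
    rw [hf'inj (a₁ := a) (a₂ := b) (by simp [hcomp, hab])]
  have hz0 := abs_le.1 ((dist_le_pi_dist z z₀ 0).trans (Metric.mem_closedBall.1 hz))
  have hz1 := abs_le.1 ((dist_le_pi_dist z z₀ 1).trans (Metric.mem_closedBall.1 hz))
  have hn0 : (n : ℝ) ≠ 0 := by positivity
  have hm0 : (m : ℝ) ≠ 0 := by positivity
  have e0 : (n : ℝ) * B z 0 = (z 0 + z 1) / 2 := by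
    simp [B, taylorSource_apply]
    field_simp
  have e1 : (m : ℝ) * B z 1 = (z 0 - z 1) / 2 := by
    simp [B, taylorSource_apply]
    field_simp
  refine ⟨B z, ?_, ?_, hAinj (hzero.trans (map_zero A).symm), hVinj,
    LinearMap.injective_iff_surjective (f := (fderiv ℝ V (B z)).toLinearMap).1 hVinj⟩
  · rw [e0, abs_le]
    constructor <;> linarith
  · rw [e1, abs_le]
    constructor <;> linarith

/-- Two points which are congruent modulo `2π` and lie within `1 / (2n)` of the points
`a π / (2n)` and `b π / (2n)` have the same label modulo `4n`. -/
theorem int_eq_of_toIcoMod_eq {n : ℕ} {x y : ℝ} {a b : ℤ}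
    (hx : |n * x - a * (π / 2)| ≤ 1 / 2) (hy : |n * y - b * (π / 2)| ≤ 1 / 2)
    (ha : 0 ≤ a ∧ a < 4 * n) (hb : 0 ≤ b ∧ b < 4 * n)
    (h : toIcoMod two_pi_pos 0 x = toIcoMod two_pi_pos 0 y) : a = b := by
  obtain ⟨j, hj⟩ := (toIcoMod_eq_toIcoMod two_pi_pos).1 h
  rw [zsmul_eq_mul] at hj
  have hπ := Real.pi_gt_three
  have hx := abs_le.1 hx
  have hy := abs_le.1 hy
  have key : ((b - a - 4 * n * j : ℤ) : ℝ) * (π / 2)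
      = (n * x - a * (π / 2)) - (n * y - b * (π / 2)) := by
    have : (n : ℝ) * y = n * x + n * (j * (2 * π)) := by rw [← hj]; ring
    rw [this]
    push_cast
    ring
  have hlt : |((b - a - 4 * n * j : ℤ) : ℝ)| < 1 := by
    rw [abs_lt]
    constructor <;> nlinarith
  have hzero : b - a - 4 * n * j = 0 := by
    rw [← Int.abs_lt_one_iff]
    exact_mod_cast hlt
  have hj0 : j = 0 := by
    by_contra hne
    rcases lt_or_gt_of_ne hne with hj | hj
    · nlinarith [show j ≤ -1 by omega]
    · nlinarith [show 1 ≤ j by omega]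
  subst hj0
  omega

/-- stability of the critical points of a Taylor field under small
perturbations, Lemma 5.4 of the paper. The threshold `N₀` depends only on `L` and on (a bound
`K` for) the `C¹` norm of the perturbation `W`. -/
theorem taylor_critical_points_perturbation (L : ℕ) (hL : 2 ≤ L) (K : ℝ) :
    ∃ N₀ : ℝ, ∀ W : (Fin 2 → ℝ) → Fin 2 → ℝ,
      ContDiff ℝ 1 W → Prdc (2 * π) W →
      max (LinfGrad 0 W) (LinfGrad 1 W) ≤ K →
      ∀ n m : ℕ, 1 ≤ n → 1 ≤ m → N₀ ≤ Real.sqrt ((n : ℝ) ^ 2 + (m : ℝ) ^ 2) →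
      ∀ δ : ℝ, |δ| < Real.sqrt ((n : ℝ) ^ 2 + (m : ℝ) ^ 2) ^ (-(L : ℤ)) →
      ∃ S : Finset (Fin 2 → ℝ), 8 * n * m ≤ S.card ∧
        ∀ p ∈ S, (∀ i, p i ∈ Set.Ico (0 : ℝ) (2 * π)) ∧
          TaylorV n m p + δ • W p = 0 ∧
          Function.Bijective (fderiv ℝ (fun x => TaylorV n m x + δ • W x) p) := by
  refine ⟨16 * |K| + 1, fun W hW hper hK n m hn hm hN δ hδ => ?_⟩
  have hK₀ : ∀ x, ‖W x‖ ≤ K := fun x =>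
    (norm_le_LinfGrad_zero two_pi_pos hW.continuous hper x).trans ((le_max_left _ _).trans hK)
  have hK₁ : ∀ x, ‖fderiv ℝ W x‖ ≤ 2 * K := fun x =>
    (norm_fderiv_le_LinfGrad_one two_pi_pos hW hper x).trans
      (mul_le_mul_of_nonneg_left ((le_max_right _ _).trans hK) zero_le_two)
  have hsmall : |δ| * K ≤ 1 / 16 := by
    set N := Real.sqrt ((n : ℝ) ^ 2 + (m : ℝ) ^ 2)
    have hN1 : 1 ≤ N := by linarith [abs_nonneg K]
    have hpow : N ^ (-(L : ℤ)) ≤ N⁻¹ := by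
      rw [← zpow_neg_one]
      exact zpow_le_zpow_right₀ hN1 (by omega)
    have hδN : |δ| * N ≤ 1 := by
      rw [← le_div_iff₀ (by linarith), one_div]
      exact hδ.le.trans hpow
    nlinarith [abs_nonneg δ, le_abs_self K]
  have hex := exists_regular_zero_near hn hm (hW.differentiable one_ne_zero) hK₀ hK₁ hsmall
  choose x hx₀ hx₁ hzero hbij using hex
  have hVper : Prdc (2 * π) fun x => TaylorV n m x + δ • W x := fun y i => by
    simp only [prdc_taylorV n m y i, hper y i]
  let I := Finset.range (2 * n) ×ˢ Finset.range (2 * m) ×ˢ Finset.range 2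
  let k : ℕ × ℕ × ℕ → Fin 2 → ℤ := fun q => ![q.1 + q.2.1 + q.2.2, q.1 - q.2.1]
  let p : ℕ × ℕ × ℕ → Fin 2 → ℝ := fun q i => toIcoMod two_pi_pos 0 (x (k q) i)
  have hp₀ : ∀ q, |n * x (k q) 0 - ((2 * q.1 + q.2.2 : ℤ) : ℝ) * (π / 2)| ≤ 1 / 2 := fun q => by
    convert hx₀ (k q) using 4
    simp [k]
    ring
  have hp₁ : ∀ q, |m * x (k q) 1 - ((2 * q.2.1 + q.2.2 : ℤ) : ℝ) * (π / 2)| ≤ 1 / 2 :=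
    fun q => by
      convert hx₁ (k q) using 4
      simp [k]
      ring
  have hinj : Set.InjOn p I := by
    rintro ⟨a, b, e⟩ hq ⟨a', b', e'⟩ hq' h
    simp only [I, Finset.coe_product, Set.mem_prod, Finset.mem_coe, Finset.mem_range] at hq hq'
    have h0 := int_eq_of_toIcoMod_eq (hp₀ (a, b, e)) (hp₀ (a', b', e'))
      (by dsimp only; omega) (by dsimp only; omega) (congrFun h 0)
    have h1 := int_eq_of_toIcoMod_eq (hp₁ (a, b, e)) (hp₁ (a', b', e'))
      (by dsimp only; omega) (by dsimp only; omega) (congrFun h 1)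
    dsimp only at h0 h1
    simp only [Prod.mk.injEq]
    omega
  refine ⟨I.image p, ?_, fun y hy => ?_⟩
  · rw [Finset.card_image_of_injOn hinj]
    simp only [I, Finset.card_product, Finset.card_range]
    exact le_of_eq (by ring)
  · obtain ⟨q, -, rfl⟩ := Finset.mem_image.1 hy
    refine ⟨fun i => toIcoMod_mem_Ico' two_pi_pos _, ?_, ?_⟩
    · exact (hVper.apply_toIcoMod two_pi_pos (x (k q))).trans (hzero (k q))
    · rw [hVper.fderiv.apply_toIcoMod two_pi_pos (x (k q))]
      exact hbij (k q)

end
end
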